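/- arXiv:math/9810128 — 3 statements merged into one kernel-verified Lean document; each statement's English description precedes it below -/
import Mathlib

section
/- No treelike continuum admits a nontrivial k-fold covering map: if X is a treelike continuum and f : X → Y is a continuous surjection onto a continuum Y that is open, locally injective, and exactly k-to-1 for some positive integer k, then k = 1 (so f is a homeomorphism). -/
open Set Metric Topology

/-- A subcontinuum of a topological space: a nonempty compact connected subset. -/
def IsSubcontinuum {X : Type*} [TopologicalSpace X] (K : Set X) : Prop :=
  IsCompact K ∧ IsConnected K

/-- The metric space `Y` is an `m`-to-1 retract of a continuum: there is a continuum `X`,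
a subcontinuum `Y'` of `X` homeomorphic to `Y`, and a continuous retraction of `X` onto `Y'`
under which every point of `Y'` has exactly `m` preimages. -/
def IsMToOneRetract (m : ℕ) (Y : Type*) [MetricSpace Y] : Prop :=
  ∃ (X : Type) (_ : MetricSpace X), CompactSpace X ∧ ConnectedSpace X ∧ Nonempty X ∧
    ∃ Y' : Set X, IsSubcontinuum Y' ∧ Nonempty (Y ≃ₜ Y') ∧
      ∃ r : X → X, Continuous r ∧ (∀ x, r x ∈ Y') ∧ (∀ y ∈ Y', r y = y) ∧
        ∀ y ∈ Y', {x : X | r x = y}.ncard = m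

/-- A 1-to-1 cover of a map `f` : a restriction of `f` to an open proper subset `U`
of the domain such that `f` is injective on `U` and `f(U) = f(X)`. -/
def HasOneToOneCover {X Y : Type*} [TopologicalSpace X] (f : X → Y) : Prop :=
  ∃ U : Set X, IsOpen U ∧ U ≠ Set.univ ∧ Set.InjOn f U ∧ f '' U = Set.range f

/-- Strictly locally 1-to-1: locally injective but not injective. -/
def StrictlyLocallyInjective {X Y : Type*} [TopologicalSpace X] (f : X → Y) : Prop :=
  (∀ x : X, ∃ U ∈ 𝓝 x, Set.InjOn f U) ∧ ¬ Function.Injective f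

/-- A map is simple if each point-inverse of a point of the image has cardinality one or two. -/
def SimpleMap {X Y : Type*} (f : X → Y) : Prop :=
  ∀ y ∈ Set.range f, (f ⁻¹' {y}).ncard = 1 ∨ (f ⁻¹' {y}).ncard = 2

/-- `f` is injective on each proper subcontinuum of its domain. -/
def InjOnProperSubcontinua {X Y : Type*} [TopologicalSpace X] (f : X → Y) : Prop :=
  ∀ K : Set X, IsSubcontinuum K → K ≠ Set.univ → Set.InjOn f K

/-- Two sets are separated if neither contains a limit point of the other. -/
def SeparatedSets {X : Type*} [TopologicalSpace X] (A B : Set X) : Prop :=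
  Disjoint (closure A) B ∧ Disjoint A (closure B)

/-- Every subcontinuum with more than one point is the union of two proper subcontinua. -/
def HereditarilyDecomposable (X : Type*) [TopologicalSpace X] : Prop :=
  ∀ K : Set X, IsSubcontinuum K → K.Nontrivial →
    ∃ A B : Set X, IsSubcontinuum A ∧ IsSubcontinuum B ∧
      A ⊆ K ∧ B ⊆ K ∧ A ≠ K ∧ B ≠ K ∧ A ∪ B = K

/-- Arclike: for each `ε > 0` there is an `ε`-map onto `[0,1]`. -/
def Arclike (X : Type*) [MetricSpace X] : Prop :=
  ∀ ε > (0:ℝ), ∃ g : X → ℝ, Continuous g ∧ Set.range g = Set.Icc 0 1 ∧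
    ∀ t : ℝ, Metric.diam (g ⁻¹' {t}) < ε

/-- A tree: a connected finite graph (a continuum that is a finite union of arcs meeting
only at endpoints) containing no simple closed curve. -/
def IsTree (T : Type*) [MetricSpace T] : Prop :=
  CompactSpace T ∧ ConnectedSpace T ∧ Nonempty T ∧
    (∃ (n : ℕ) (γ : Fin n → ℝ → T),
      (∀ i, ContinuousOn (γ i) (Set.Icc 0 1) ∧ Set.InjOn (γ i) (Set.Icc 0 1)) ∧
      (⋃ i, γ i '' Set.Icc 0 1) = Set.univ ∧
      (∀ i j, i ≠ j →
        (γ i '' Set.Icc 0 1) ∩ (γ j '' Set.Icc 0 1) ⊆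
          ({γ i 0, γ i 1, γ j 0, γ j 1} : Set T))) ∧
    ¬ ∃ S : Set T, Nonempty (S ≃ₜ (Metric.sphere (0:ℂ) 1))

/-- Treelike: for each `ε > 0` there is an `ε`-map onto a tree. -/
def Treelike (X : Type*) [MetricSpace X] : Prop :=
  ∀ ε > (0:ℝ), ∃ (T : Type) (_ : MetricSpace T), IsTree T ∧
    ∃ g : X → T, Continuous g ∧ Function.Surjective g ∧
      ∀ t : T, Metric.diam (g ⁻¹' {t}) < ε
/-- `S` is an arc from `p` to `q`, or a single point if `p = q`. -/
def IsArc {T : Type*} [TopologicalSpace T] (p q : T) (S : Set T) : Prop :=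
  ∃ (a b : ℝ) (γ : ℝ → T), a ≤ b ∧ ContinuousOn γ (Icc a b) ∧ InjOn γ (Icc a b) ∧
    γ a = p ∧ γ b = q ∧ γ '' Icc a b = S

/-- Concatenation of a path `γ` on `[a, b]` with a path `β` starting at time `c`. -/
noncomputable def pathConcat {T : Type*} (γ β : ℝ → T) (b c : ℝ) (t : ℝ) : T :=
  if t ≤ b then γ t else β (t - b + c)

section PathConcat

variable {T : Type*} {γ β : ℝ → T} {a b c d : ℝ}

lemma pathConcat_of_le {t : ℝ} (h : t ≤ b) : pathConcat γ β b c t = γ t := if_pos h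

lemma pathConcat_of_ge (hbc : γ b = β c) {t : ℝ} (h : b ≤ t) :
    pathConcat γ β b c t = β (t - b + c) := by
  rcases h.eq_or_lt with rfl | h
  · simp [pathConcat, hbc]
  · exact if_neg h.not_ge

lemma continuousOn_pathConcat [TopologicalSpace T] (hbc : γ b = β c)
    (hγ : ContinuousOn γ (Icc a b)) (hβ : ContinuousOn β (Icc c d)) :
    ContinuousOn (pathConcat γ β b c) (Icc a (b + (d - c))) := by
  have h₁ : ContinuousOn (pathConcat γ β b c) (Icc a b) :=
    hγ.congr fun t ht => pathConcat_of_le ht.2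
  have h₂ : ContinuousOn (pathConcat γ β b c) (Icc b (b + (d - c))) := by
    refine ContinuousOn.congr (f := fun t => β (t - b + c)) ?_
      fun t ht => pathConcat_of_ge hbc ht.1
    refine hβ.comp (by fun_prop) fun t ht => ?_
    simp only [mem_Icc] at ht ⊢
    constructor <;> linarith
  refine (h₁.union_of_isClosed h₂ isClosed_Icc isClosed_Icc).mono fun t ht => ?_
  rcases le_total t b with h | h
  · exact Or.inl ⟨ht.1, h⟩
  · exact Or.inr ⟨h, ht.2⟩

lemma image_pathConcat (hab : a ≤ b) (hcd : c ≤ d) (hbc : γ b = β c) :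
    pathConcat γ β b c '' Icc a (b + (d - c)) = γ '' Icc a b ∪ β '' Icc c d := by
  ext x
  constructor
  · rintro ⟨t, ht, rfl⟩
    rcases le_total t b with h | h
    · exact Or.inl ⟨t, ⟨ht.1, h⟩, (pathConcat_of_le h).symm⟩
    · refine Or.inr ⟨t - b + c, ⟨by linarith, by linarith [ht.2]⟩, (pathConcat_of_ge hbc h).symm⟩
  · rintro (⟨t, ht, rfl⟩ | ⟨t, ht, rfl⟩)
    · exact ⟨t, ⟨ht.1, by linarith [ht.2]⟩, pathConcat_of_le ht.2⟩
    · refine ⟨t + b - c, ⟨by linarith [ht.1], by linarith [ht.2]⟩, ?_⟩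
      rw [pathConcat_of_ge hbc (by linarith [ht.1])]
      congr 1
      ring

lemma injOn_pathConcat {I : Set ℝ} (hI : I ⊆ Icc a (b + (d - c)))
    (hγ : InjOn γ (Icc a b)) (hβ : InjOn β (Icc c d)) (hbc : γ b = β c)
    (h : ∀ s ∈ Icc a b, ∀ t ∈ Icc c d, c < t → t - c + b ∈ I → γ s ≠ β t) :
    InjOn (pathConcat γ β b c) I := by
  have key : ∀ s ∈ I, ∀ t ∈ I, s ≤ b → b < t → pathConcat γ β b c s ≠ pathConcat γ β b c t := by
    intro s hs t ht hsb hbt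
    rw [pathConcat_of_le hsb, pathConcat_of_ge hbc hbt.le]
    have := (hI ht).2
    refine h s ⟨(hI hs).1, hsb⟩ _ ⟨by linarith, by linarith⟩ (by linarith) ?_
    convert ht using 1
    ring
  intro s hs t ht hst
  rcases le_or_gt s b with h₁ | h₁ <;> rcases le_or_gt t b with h₂ | h₂
  · rw [pathConcat_of_le h₁, pathConcat_of_le h₂] at hst
    exact hγ ⟨(hI hs).1, h₁⟩ ⟨(hI ht).1, h₂⟩ hst
  · exact absurd hst (key s hs t ht h₁ h₂)
  · exact absurd hst.symm (key t ht s hs h₂ h₁)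
  · rw [pathConcat_of_ge hbc h₁.le, pathConcat_of_ge hbc h₂.le] at hst
    have h₃ := (hI hs).2
    have h₄ := (hI ht).2
    have := hβ ⟨by linarith, by linarith⟩ ⟨by linarith, by linarith⟩ hst
    linarith

end PathConcat

namespace IsArc

variable {T : Type*} [TopologicalSpace T] {p q r : T} {S S' : Set T}

lemma symm (h : IsArc p q S) : IsArc q p S := by
  obtain ⟨a, b, γ, hab, hc, hi, rfl, rfl, rfl⟩ := h
  have hm : MapsTo (fun t : ℝ => -t) (Icc (-b) (-a)) (Icc a b) := fun t ht =>
    ⟨by linarith [ht.2], by linarith [ht.1]⟩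
  refine ⟨-b, -a, fun t => γ (-t), by linarith, hc.comp (by fun_prop) hm,
    hi.comp neg_injective.injOn hm, by simp, by simp, ?_⟩
  have : (fun t => γ (-t)) '' Icc (-b) (-a) = γ '' ((fun t : ℝ => -t) '' Icc (-b) (-a)) :=
    (image_image γ _ _).symm
  rw [this]
  simp

lemma trans (h : IsArc p q S) (h' : IsArc q r S') (hS : S ∩ S' ⊆ {q}) : IsArc p r (S ∪ S') := by
  obtain ⟨a, b, γ, hab, hc, hi, rfl, hb, rfl⟩ := h
  obtain ⟨c, d, β, hcd, hc', hi', hc₀, rfl, rfl⟩ := h'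
  have hbc : γ b = β c := hb.trans hc₀.symm
  refine ⟨a, b + (d - c), pathConcat γ β b c, by linarith, continuousOn_pathConcat hbc hc hc',
    injOn_pathConcat subset_rfl hi hi' hbc ?_, pathConcat_of_le hab, ?_,
    image_pathConcat hab hcd hbc⟩
  · intro s hs t ht hct _ hst
    have : β t = q := hS ⟨⟨s, hs, hst⟩, ⟨t, ht, rfl⟩⟩
    exact hct.ne' (hi' ht ⟨le_rfl, hcd⟩ (this.trans hc₀.symm))
  · rw [pathConcat_of_ge hbc (by linarith)]
    congr 1
    ring

lemma refl (p : T) : IsArc p p {p} :=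
  ⟨0, 0, fun _ => p, le_rfl, continuousOn_const, by simp, rfl, rfl, by simp⟩

lemma isClosed [T2Space T] (h : IsArc p q S) : IsClosed S := by
  obtain ⟨a, b, γ, -, hc, -, -, -, rfl⟩ := h
  exact (isCompact_Icc.image_of_continuousOn hc).isClosed

lemma left_mem (h : IsArc p q S) : p ∈ S := by
  obtain ⟨a, b, γ, hab, -, -, rfl, -, rfl⟩ := h
  exact ⟨a, ⟨le_rfl, hab⟩, rfl⟩

lemma right_mem (h : IsArc p q S) : q ∈ S := h.symm.left_mem

lemma of_subinterval {a b s t : ℝ} {γ : ℝ → T} (hc : ContinuousOn γ (Icc a b))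
    (hi : InjOn γ (Icc a b)) (hs : a ≤ s) (hst : s ≤ t) (ht : t ≤ b) :
    IsArc (γ s) (γ t) (γ '' Icc s t) :=
  ⟨s, t, γ, hst, hc.mono (Icc_subset_Icc hs ht), hi.mono (Icc_subset_Icc hs ht), rfl, rfl, rfl⟩

lemma exists_subarc (h : IsArc p q S) {x y : T} (hx : x ∈ S) (hy : y ∈ S) :
    ∃ R ⊆ S, IsArc x y R := by
  obtain ⟨a, b, γ, hab, hc, hi, rfl, rfl, rfl⟩ := h
  obtain ⟨s, hs, rfl⟩ := hx
  obtain ⟨t, ht, rfl⟩ := hy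
  rcases le_total s t with hst | hst
  · exact ⟨_, image_mono (Icc_subset_Icc hs.1 ht.2), of_subinterval hc hi hs.1 hst ht.2⟩
  · exact ⟨_, image_mono (Icc_subset_Icc ht.1 hs.2), (of_subinterval hc hi ht.1 hst hs.2).symm⟩

/-- Two arcs with the same distinct endpoints and nothing else in common form a circle. -/
lemma exists_circle [T2Space T] (h : IsArc p q S) (h' : IsArc q p S') (hpq : p ≠ q)
    (hS : S ∩ S' ⊆ {p, q}) : ∃ C : Set T, Nonempty (C ≃ₜ (Metric.sphere (0 : ℂ) 1)) := by
  obtain ⟨a, b, γ, hab, hc, hi, ha, hb, rfl⟩ := h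
  obtain ⟨c, d, β, hcd, hc', hi', hc₀, hd, rfl⟩ := h'
  have hbc : γ b = β c := hb.trans hc₀.symm
  have hlt : a < b := hab.lt_of_ne fun h => hpq (by rw [← ha, ← hb, h])
  set δ := pathConcat γ β b c
  set P := b + (d - c) - a with hP
  have hP0 : 0 < P := by linarith
  have : Fact (0 < P) := ⟨hP0⟩
  have hPe : a + P = b + (d - c) := by ring
  have hδc : ContinuousOn δ (Icc a (a + P)) := hPe ▸ continuousOn_pathConcat hbc hc hc'
  have hδe : δ a = δ (a + P) := by
    rw [hPe, show δ a = γ a from pathConcat_of_le hab,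
      show δ (b + (d - c)) = _ from pathConcat_of_ge hbc (by linarith), ha, ← hd]
    congr 1
    ring
  have hδi : InjOn δ (Ico a (a + P)) := by
    refine injOn_pathConcat (hPe ▸ Ico_subset_Icc_self) hi hi' hbc ?_
    intro s hs t ht hct htI hst
    rcases hS ⟨⟨s, hs, hst⟩, ⟨t, ht, rfl⟩⟩ with h | h
    · have := hi' ht ⟨hcd, le_rfl⟩ (h.trans hd.symm)
      have := htI.2
      linarith
    · exact hct.ne' (hi' ht ⟨le_rfl, hcd⟩ (Eq.trans h hc₀.symm))
  have hLc : Continuous (AddCircle.liftIco P a δ) := AddCircle.liftIco_continuous hδe hδc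
  have hLi : Function.Injective (AddCircle.liftIco P a δ) := by
    intro x y hxy
    rw [← (AddCircle.coe_equivIco (p := P) (a := a) (y := x)),
      ← (AddCircle.coe_equivIco (p := P) (a := a) (y := y))] at hxy ⊢
    rw [AddCircle.liftIco_coe_apply (AddCircle.equivIco P a x).2,
      AddCircle.liftIco_coe_apply (AddCircle.equivIco P a y).2] at hxy
    rw [hδi (AddCircle.equivIco P a x).2 (AddCircle.equivIco P a y).2 hxy]
  have e₁ := (hLc.isClosedEmbedding hLi).isEmbedding.toHomeomorph
  have e₂ : AddCircle P ≃ₜ Circle := AddCircle.homeomorphCircle hP0.ne'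
  have e₃ : Circle ≃ₜ Metric.sphere (0 : ℂ) 1 := Homeomorph.refl _
  exact ⟨_, ⟨e₁.symm.trans (e₂.trans e₃)⟩⟩

end IsArc

/-- Sets obtained from a point by successively attaching arcs at one endpoint. -/
inductive ArcTree {T : Type*} [TopologicalSpace T] : Set T → Prop
  | point (x : T) : ArcTree {x}
  | attach {K S : Set T} {p q : T} : ArcTree K → IsArc p q S → K ∩ S = {p} → ArcTree (K ∪ S)

/-- Closed sets obtained by successively gluing closed small sets at single points. -/
inductive SmallTree {T : Type*} [TopologicalSpace T] (small : Set T → Prop) : Set T → Prop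
  | of_small {A : Set T} : IsClosed A → small A → SmallTree small A
  | glue {K L : Set T} {p : T} : SmallTree small K → SmallTree small L → K ∩ L = {p} →
      SmallTree small (K ∪ L)

lemma SmallTree.isClosed {T : Type*} [TopologicalSpace T] {small : Set T → Prop} {K : Set T}
    (h : SmallTree small K) : IsClosed K := by
  induction h with
  | of_small h _ => exact h
  | glue _ _ _ h₁ h₂ => exact h₁.union h₂

namespace ArcTree

variable {T : Type*} [TopologicalSpace T] {K : Set T}

lemma isClosed [T2Space T] (h : ArcTree K) : IsClosed K := by
  induction h with
  | point x => exact isClosed_singleton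
  | attach _ hS _ ih => exact ih.union hS.isClosed

lemma exists_arc (h : ArcTree K) : ∀ x ∈ K, ∀ y ∈ K, ∃ R ⊆ K, IsArc x y R := by
  induction h with
  | point x =>
    rintro _ rfl _ rfl
    exact ⟨_, subset_rfl, IsArc.refl _⟩
  | @attach K S p q _ hS hp ih =>
    have hpK : p ∈ K := (hp.ge rfl).1
    have mixed : ∀ x ∈ K, ∀ y ∈ S, ∃ R ⊆ K ∪ S, IsArc x y R := by
      intro x hx y hy
      obtain ⟨R, hR, hR'⟩ := ih x hx p hpK
      obtain ⟨Q, hQ, hQ'⟩ := hS.exists_subarc hS.left_mem hy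
      exact ⟨R ∪ Q, union_subset_union hR hQ,
        hR'.trans hQ' ((inter_subset_inter hR hQ).trans hp.le)⟩
    rintro x (hx | hx) y (hy | hy)
    · obtain ⟨R, hR, hR'⟩ := ih x hx y hy
      exact ⟨R, hR.trans subset_union_left, hR'⟩
    · exact mixed x hx y hy
    · obtain ⟨R, hR, hR'⟩ := mixed y hy x hx
      exact ⟨R, hR, hR'.symm⟩
    · obtain ⟨R, hR, hR'⟩ := hS.exists_subarc hx hy
      exact ⟨R, hR.trans subset_union_right, hR'⟩

/-- In a space without circles, an arc meets an arc tree in at most one point, provided that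
the intersection is finite. -/
lemma inter_subsingleton [T2Space T]
    (hT : ¬ ∃ C : Set T, Nonempty (C ≃ₜ (Metric.sphere (0 : ℂ) 1)))
    (h : ArcTree K) {p q : T} {S : Set T} (hS : IsArc p q S) (hfin : (K ∩ S).Finite) :
    (K ∩ S).Subsingleton := by
  by_contra hns
  rw [not_subsingleton_iff] at hns
  obtain ⟨a, b, γ, hab, hc, hi, rfl, rfl, rfl⟩ := hS
  set P : Set ℝ := {t ∈ Icc a b | γ t ∈ K} with hP
  have hPfin : P.Finite := by
    refine Set.Finite.of_finite_image (f := γ) (hfin.subset ?_) (hi.mono fun t ht => ht.1)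
    rintro _ ⟨t, ht, rfl⟩
    exact ⟨ht.2, t, ht.1, rfl⟩
  obtain ⟨_, ⟨hsK, s, hs, rfl⟩, _, ⟨htK, t, ht, rfl⟩, hst⟩ := hns
  obtain ⟨s, hsP, t, htP, hst⟩ : ∃ s ∈ P, ∃ t ∈ P, s < t := by
    have : s ≠ t := fun h => hst (by rw [h])
    rcases this.lt_or_gt with h | h
    · exact ⟨s, ⟨hs, hsK⟩, t, ⟨ht, htK⟩, h⟩
    · exact ⟨t, ⟨ht, htK⟩, s, ⟨hs, hsK⟩, h⟩
  obtain ⟨u, ⟨huP, hsu⟩, humin⟩ := Set.exists_min_image (P ∩ Ioi s) id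
    (hPfin.subset inter_subset_left) ⟨t, htP, hst⟩
  have hsu : s < u := hsu
  obtain ⟨R, hRK, hR⟩ := h.exists_arc (γ u) huP.2 (γ s) hsP.2
  have harc := IsArc.of_subinterval hc hi hsP.1.1 hsu.le huP.1.2
  refine hT (harc.exists_circle hR (fun h => hsu.ne (hi hsP.1 huP.1 h)) ?_)
  rintro _ ⟨⟨v, hv, rfl⟩, hvR⟩
  rcases hv.1.eq_or_lt with h₁ | h₁
  · simp [h₁]
  · have := humin v ⟨⟨⟨hsP.1.1.trans hv.1, hv.2.trans huP.1.2⟩, hRK hvR⟩, h₁⟩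
    simp [le_antisymm hv.2 this]

lemma union_arc [T2Space T]
    (hT : ¬ ∃ C : Set T, Nonempty (C ≃ₜ (Metric.sphere (0 : ℂ) 1)))
    (h : ArcTree K) {p q : T} {S : Set T} (hS : IsArc p q S) (hfin : (K ∩ S).Finite)
    (hne : (K ∩ S).Nonempty) : ArcTree (K ∪ S) := by
  obtain ⟨x, hx⟩ := hne
  have hKS : K ∩ S = {x} := (h.inter_subsingleton hT hS hfin).eq_singleton_of_mem hx
  obtain ⟨a, b, γ, hab, hc, hi, rfl, rfl, rfl⟩ := hS
  obtain ⟨hxK, c, hcab, rfl⟩ := hx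
  have h₁ : ArcTree (K ∪ γ '' Icc c b) := by
    refine h.attach (IsArc.of_subinterval hc hi hcab.1 hcab.2 le_rfl) ?_
    refine subset_antisymm ?_ (singleton_subset_iff.2 ⟨hxK, c, ⟨le_rfl, hcab.2⟩, rfl⟩)
    exact (inter_subset_inter_right _ (image_mono (Icc_subset_Icc_left hcab.1))).trans hKS.le
  have h₂ : ArcTree ((K ∪ γ '' Icc c b) ∪ γ '' Icc a c) := by
    refine h₁.attach (IsArc.of_subinterval hc hi le_rfl hcab.1 hcab.2).symm ?_
    refine subset_antisymm ?_
      (singleton_subset_iff.2 ⟨Or.inl hxK, c, ⟨hcab.1, le_rfl⟩, rfl⟩)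
    rintro _ ⟨hK | ⟨s, hs, hst⟩, t, ht, rfl⟩
    · exact hKS.le ⟨hK, t, ⟨ht.1, ht.2.trans hcab.2⟩, rfl⟩
    · have := hi ⟨hcab.1.trans hs.1, hs.2⟩ ⟨ht.1, ht.2.trans hcab.2⟩ hst
      have : t = c := le_antisymm ht.2 (this ▸ hs.1)
      simp [this]
  have : γ '' Icc a b = γ '' Icc c b ∪ γ '' Icc a c := by
    rw [← image_union, union_comm, Icc_union_Icc_eq_Icc hcab.1 hcab.2]
  rwa [this, ← union_assoc]

lemma smallTree [T2Space T] {small : Set T → Prop}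
    (hmono : ∀ A B, A ⊆ B → small B → small A)
    (hnhds : ∀ x, ∃ U, IsOpen U ∧ x ∈ U ∧ small U) (h : ArcTree K) : SmallTree small K := by
  induction h with
  | point x =>
    obtain ⟨U, -, hx, hU⟩ := hnhds x
    exact .of_small isClosed_singleton (hmono _ _ (singleton_subset_iff.2 hx) hU)
  | @attach K S p q _ hS hp ih =>
    suffices SmallTree small S from ih.glue this hp
    obtain ⟨a, b, γ, hab, hc, hi, rfl, rfl, rfl⟩ := hS
    choose U hUo hUx hUs using hnhds
    obtain ⟨t, ht₀, htm, ⟨N, hN⟩, hts⟩ := exists_monotone_Icc_subset_open_cover_Icc hab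
      (c := fun x : T => (fun s : Icc a b => γ s) ⁻¹' U x)
      (fun x => (hUo x).preimage hc.domRestrict)
      (fun s _ => mem_iUnion.2 ⟨γ s, hUx _⟩)
    have hpiece : ∀ n, SmallTree small (γ '' Icc (t n : ℝ) (t (n + 1))) := by
      intro n
      obtain ⟨x, hx⟩ := hts n
      have hn := (t n).2
      have hn' := (t (n + 1)).2
      refine .of_small (IsArc.of_subinterval hc hi hn.1 (htm n.le_succ) hn'.2).isClosed
        (hmono _ (U x) ?_ (hUs x))
      rintro _ ⟨s, hs, rfl⟩
      exact @hx ⟨s, hn.1.trans hs.1, hs.2.trans hn'.2⟩ hs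
    have hinit : ∀ n, SmallTree small (γ '' Icc a (t n : ℝ)) := by
      intro n
      induction n with
      | zero =>
        refine .of_small ?_ (hmono _ (U (γ a)) ?_ (hUs _)) <;> simp [ht₀, hUx]
      | succ n ihn =>
        have hn := (t n).2
        have hn' := (t (n + 1)).2
        have hle : (t n : ℝ) ≤ t (n + 1) := htm n.le_succ
        rw [← Icc_union_Icc_eq_Icc hn.1 hle, image_union]
        refine ihn.glue (hpiece n) (p := γ (t n)) ?_
        rw [← hi.image_inter (Icc_subset_Icc_right hn.2) (Icc_subset_Icc hn.1 hn'.2),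
          Icc_inter_Icc_eq_singleton hn.1 hle, image_singleton]
    simpa [hN N le_rfl] using hinit N

end ArcTree

lemma IsTree.arcTree_univ {T : Type*} [MetricSpace T] (hT : IsTree T) :
    ArcTree (univ : Set T) := by
  obtain ⟨_, _, ⟨x₀⟩, ⟨n, γ, hγ, hcov, hint⟩, hcirc⟩ := hT
  set A : Fin n → Set T := fun i => γ i '' Icc 0 1
  have hA : ∀ i, IsArc (γ i 0) (γ i 1) (A i) := fun i =>
    ⟨0, 1, γ i, zero_le_one, (hγ i).1, (hγ i).2, rfl, rfl, rfl⟩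
  have hfin : ∀ i j, i ≠ j → (A i ∩ A j).Finite := fun i j hij =>
    (toFinite _).subset (hint i j hij)
  have hne : {I : Finset (Fin n) | I.Nonempty ∧ ArcTree (⋃ i ∈ I, A i)}.Nonempty := by
    obtain ⟨i, -⟩ := mem_iUnion.1 (hcov.ge (mem_univ x₀))
    refine ⟨{i}, Finset.singleton_nonempty i, ?_⟩
    have := (ArcTree.point (γ i 0)).attach (hA i) (by simpa using (hA i).left_mem)
    simpa [(hA i).left_mem] using this
  obtain ⟨I, ⟨⟨i₀, hi₀⟩, hI⟩, hmax⟩ := (toFinite _).exists_maximal hne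
  set K := ⋃ i ∈ I, A i
  by_cases hall : ∀ j, j ∈ I
  · have : K = univ := by
      rw [← hcov]
      simp [K, A, hall]
    rwa [← this]
  push Not at hall
  obtain ⟨j₀, hj₀⟩ := hall
  obtain ⟨x, -, hxK, hx⟩ := isPreconnected_closed_iff.1 (PreconnectedSpace.isPreconnected_univ)
    K (⋃ j ∈ (Iᶜ : Finset (Fin n)), A j) hI.isClosed
    (Set.Finite.isClosed_biUnion (Finset.finite_toSet _) fun j _ => (hA j).isClosed)
    (fun x _ => by
      obtain ⟨i, hi⟩ := mem_iUnion.1 (hcov.ge (mem_univ x))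
      by_cases h : i ∈ I
      · exact Or.inl (mem_biUnion (s := (I : Set (Fin n))) h hi)
      · exact Or.inr (mem_biUnion (s := ((Iᶜ : Finset (Fin n)) : Set (Fin n))) (by simpa) hi))
    ⟨γ i₀ 0, trivial, mem_biUnion (s := (I : Set (Fin n))) hi₀ (hA i₀).left_mem⟩
    ⟨γ j₀ 0, trivial, mem_biUnion (s := ((Iᶜ : Finset (Fin n)) : Set (Fin n))) (by simpa)
      (hA j₀).left_mem⟩
  obtain ⟨j, hj, hxj⟩ := mem_iUnion₂.1 hx
  have hjI : j ∉ I := Finset.mem_compl.1 hj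
  have hnew := hI.union_arc hcirc (hA j) (by
    rw [iUnion₂_inter]
    exact Set.Finite.biUnion (Finset.finite_toSet I)
      fun i hi => hfin i j (fun h => hjI (h ▸ hi))) ⟨x, hxK, hxj⟩
  refine absurd (hmax (y := insert j I) ⟨Finset.insert_nonempty j I, ?_⟩
    (Finset.subset_insert j I) (Finset.mem_insert_self j I)) hjI
  rwa [Finset.set_biUnion_insert, union_comm]

/-- A uniform version, for metric spaces, of the notion of covering map. -/
structure IsUniformCovering {E B : Type*} [MetricSpace E] [MetricSpace B] (p : E → B) : Prop where
  surjective : Function.Surjective p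
  separated : ∃ η > 0, ∀ e e', p e = p e' → dist e e' < 2 * η → e = e'
  uniformly_open : ∀ ρ > 0, ∃ δ > 0, ∀ e b, dist (p e) b < δ → ∃ e', p e' = b ∧ dist e e' < ρ

/-- `s` lifts `u` through `p` on `W`, and is `η`-coherent on the fibres of `g`. -/
structure IsCoherentLift {X T E B : Type*} [TopologicalSpace X] [MetricSpace E]
    (p : E → B) (u : X → B) (g : X → T) (η : ℝ) (W : Set X) (s : X → E) : Prop where
  continuousOn : ContinuousOn s W
  lift : ∀ x ∈ W, p (s x) = u x
  coherent : ∀ x ∈ W, ∀ x' ∈ W, g x = g x' → dist (s x) (s x') < η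

section Lift

variable {X T E B : Type*} [TopologicalSpace X] [MetricSpace E] {p : E → B} {u : X → B} {g : X → T} {η : ℝ} {Z : Set X}

lemma IsUniformCovering.exists_coherentLift_of_small [MetricSpace B]
    (hp : IsUniformCovering p) (hη : 0 < η)
    (hsep : ∀ e e', p e = p e' → dist e e' < 2 * η → e = e') {W : Set X}
    (hu : ContinuousOn u W)
    (hW : ∀ x ∈ W, ∀ x' ∈ W, ∀ e, p e = u x → ∃ e', p e' = u x' ∧ dist e e' < η / 2)
    {x₀ : X} (hx₀ : x₀ ∈ W) {e₀ : E} (he₀ : p e₀ = u x₀) :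
    ∃ s, IsCoherentLift p u g η W s ∧ s x₀ = e₀ := by
  have : ∀ x, ∃ e, x ∈ W → p e = u x ∧ dist e₀ e < η / 2 := by
    intro x
    by_cases hx : x ∈ W
    · obtain ⟨e, he⟩ := hW x₀ hx₀ x hx e₀ he₀
      exact ⟨e, fun _ => he⟩
    · exact ⟨e₀, fun h => absurd h hx⟩
  choose s hs using this
  refine ⟨s, ⟨?_, fun x hx => (hs x hx).1, ?_⟩, ?_⟩
  · intro x hx
    rw [Metric.continuousWithinAt_iff']
    intro ρ hρ
    obtain ⟨δ, hδ, hopen⟩ := hp.uniformly_open (min ρ (η / 2)) (by positivity)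
    filter_upwards [Metric.continuousWithinAt_iff'.1 (hu x hx) δ hδ, self_mem_nhdsWithin]
      with y hy hyW
    rw [dist_comm, ← (hs x hx).1] at hy
    obtain ⟨e, he, hde⟩ := hopen _ _ hy
    have h₁ := lt_min_iff.1 hde
    have : e = s y := by
      refine hsep _ _ (he.trans (hs y hyW).1.symm) ?_
      have h₂ := dist_triangle4 e (s x) e₀ (s y)
      have h₃ := (hs x hx).2
      have h₄ := (hs y hyW).2
      rw [dist_comm e (s x), dist_comm (s x) e₀] at h₂
      linarith [h₁.2]
    rw [← this, dist_comm]
    exact h₁.1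
  · intro x hx x' hx' _
    have h₂ := dist_triangle_left (s x) (s x') e₀
    linarith [(hs x hx).2, (hs x' hx').2]
  · refine hsep _ _ ((hs x₀ hx₀).1.trans he₀.symm) ?_
    rw [dist_comm]
    linarith [(hs x₀ hx₀).2]

/-- Through every point there is a coherent lift on the part of `Z` over `K`. -/
def LiftsOver (p : E → B) (u : X → B) (g : X → T) (η : ℝ) (Z : Set X) (K : Set T) : Prop :=
  ∀ x₀ ∈ Z ∩ g ⁻¹' K, ∀ e₀, p e₀ = u x₀ →
    ∃ s, IsCoherentLift p u g η (Z ∩ g ⁻¹' K) s ∧ s x₀ = e₀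

lemma LiftsOver.exists_lift {K : Set T} (h : LiftsOver p u g η Z K)
    (hp : Function.Surjective p) [Nonempty E] :
    ∃ s, IsCoherentLift p u g η (Z ∩ g ⁻¹' K) s := by
  rcases (Z ∩ g ⁻¹' K).eq_empty_or_nonempty with h₀ | ⟨x, hx⟩
  · rw [h₀]
    exact ⟨fun _ => Classical.arbitrary E, continuousOn_empty _, by simp, by simp⟩
  · obtain ⟨e, he⟩ := hp (u x)
    obtain ⟨s, hs, -⟩ := h x hx e he
    exact ⟨s, hs⟩

lemma LiftsOver.exists_glue [TopologicalSpace T] (hp : Function.Surjective p)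
    (hsep : ∀ e e', p e = p e' → dist e e' < 2 * η → e = e') (hg : Continuous g)
    (hZ : IsClosed Z) {K L : Set T} (hKc : IsClosed K) (hLc : IsClosed L)
    (hK : LiftsOver p u g η Z K) (hL : LiftsOver p u g η Z L) {c : T} (hKL : K ∩ L = {c})
    {x₀ : X} (hx₀ : x₀ ∈ Z ∩ g ⁻¹' K) {e₀ : E} (he₀ : p e₀ = u x₀) :
    ∃ s, IsCoherentLift p u g η (Z ∩ g ⁻¹' (K ∪ L)) s ∧ s x₀ = e₀ := by
  classical
  have : Nonempty E := ⟨e₀⟩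
  obtain ⟨sK, hsK, hsK₀⟩ := hK x₀ hx₀ e₀ he₀
  have hc : c ∈ K ∩ L := hKL.ge rfl
  obtain ⟨sL, hsL, hagree⟩ : ∃ sL, IsCoherentLift p u g η (Z ∩ g ⁻¹' L) sL ∧
      ∀ x ∈ Z, g x = c → sK x = sL x := by
    by_cases hne : ∃ x₁ ∈ Z, g x₁ = c
    · obtain ⟨x₁, hx₁, rfl⟩ := hne
      obtain ⟨sL, hsL, h₁⟩ := hL x₁ ⟨hx₁, hc.2⟩ (sK x₁) (hsK.lift _ ⟨hx₁, hc.1⟩)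
      refine ⟨sL, hsL, fun x hx hgx => ?_⟩
      have hxK : x ∈ Z ∩ g ⁻¹' K := ⟨hx, by simpa [hgx] using hc.1⟩
      have hxL : x ∈ Z ∩ g ⁻¹' L := ⟨hx, by simpa [hgx] using hc.2⟩
      refine hsep _ _ ((hsK.lift x hxK).trans (hsL.lift x hxL).symm) ?_
      have h₂ := hsK.coherent x hxK x₁ ⟨hx₁, hc.1⟩ hgx
      have h₃ := hsL.coherent x₁ ⟨hx₁, hc.2⟩ x hxL hgx.symm
      rw [h₁] at h₃
      linarith [dist_triangle (sK x) (sK x₁) (sL x)]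
    · push Not at hne
      obtain ⟨sL, hsL⟩ := hL.exists_lift hp
      exact ⟨sL, hsL, fun x hx hgx => absurd hgx (hne x hx)⟩
  set s : X → E := fun x => if g x ∈ K then sK x else sL x
  have hsK' : EqOn s sK (Z ∩ g ⁻¹' K) := fun x hx => if_pos hx.2
  have hsL' : EqOn s sL (Z ∩ g ⁻¹' L) := by
    intro x hx
    by_cases h : g x ∈ K
    · exact (if_pos h).trans (hagree x hx.1 (hKL.le ⟨h, hx.2⟩))
    · exact if_neg h
  refine ⟨s, ⟨?_, ?_, ?_⟩, (hsK' hx₀).trans hsK₀⟩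
  · rw [preimage_union, inter_union_distrib_left]
    exact (hsK.continuousOn.congr hsK').union_of_isClosed (hsL.continuousOn.congr hsL')
      (hZ.inter (hKc.preimage hg)) (hZ.inter (hLc.preimage hg))
  · rintro x ⟨hx, h | h⟩
    · rw [hsK' ⟨hx, h⟩, hsK.lift x ⟨hx, h⟩]
    · rw [hsL' ⟨hx, h⟩, hsL.lift x ⟨hx, h⟩]
  · rintro x ⟨hx, h | h⟩ x' ⟨hx', -⟩ hxx'
    · have h' : g x' ∈ K := hxx' ▸ h
      rw [hsK' ⟨hx, h⟩, hsK' ⟨hx', h'⟩]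
      exact hsK.coherent x ⟨hx, h⟩ x' ⟨hx', h'⟩ hxx'
    · have h' : g x' ∈ L := hxx' ▸ h
      rw [hsL' ⟨hx, h⟩, hsL' ⟨hx', h'⟩]
      exact hsL.coherent x ⟨hx, h⟩ x' ⟨hx', h'⟩ hxx'

lemma LiftsOver.union [TopologicalSpace T] (hp : Function.Surjective p)
    (hsep : ∀ e e', p e = p e' → dist e e' < 2 * η → e = e') (hg : Continuous g)
    (hZ : IsClosed Z) {K L : Set T} (hKc : IsClosed K) (hLc : IsClosed L)
    (hK : LiftsOver p u g η Z K) (hL : LiftsOver p u g η Z L) {c : T} (hKL : K ∩ L = {c}) :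
    LiftsOver p u g η Z (K ∪ L) := by
  rintro x₀ ⟨hx₀, h | h⟩ e₀ he₀
  · exact hK.exists_glue hp hsep hg hZ hKc hLc hL hKL ⟨hx₀, h⟩ he₀
  · rw [union_comm]
    exact hL.exists_glue hp hsep hg hZ hLc hKc hK (inter_comm K L ▸ hKL) ⟨hx₀, h⟩ he₀

end Lift

lemma exists_open_nhds_dist_lt {X T : Type*} [MetricSpace X] [CompactSpace X]
    [TopologicalSpace T] [T2Space T] {g : X → T} (hg : Continuous g) {ε : ℝ} {t : T}
    (ht : Metric.diam (g ⁻¹' {t}) < ε) :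
    ∃ U, IsOpen U ∧ t ∈ U ∧ ∀ x x', g x ∈ U → g x' ∈ U → dist x x' < ε := by
  have hC : IsClosed {q : X × X | ε ≤ dist q.1 q.2} :=
    isClosed_le continuous_const continuous_dist
  have hC' : IsClosed (Prod.map g g '' {q : X × X | ε ≤ dist q.1 q.2}) :=
    (hC.isCompact.image (hg.prodMap hg)).isClosed
  have hmem : (t, t) ∈ (Prod.map g g '' {q : X × X | ε ≤ dist q.1 q.2})ᶜ := by
    rintro ⟨⟨x, x'⟩, hd, hxx⟩
    obtain ⟨h₁, h₂⟩ := Prod.mk.inj hxx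
    have := Metric.dist_le_diam_of_mem (isCompact_univ.isBounded.subset (subset_univ _))
      (show x ∈ g ⁻¹' {t} from h₁) (show x' ∈ g ⁻¹' {t} from h₂)
    exact (lt_of_le_of_lt (le_trans hd this) ht).false
  obtain ⟨U, V, hU, hV, htU, htV, hUV⟩ := isOpen_prod_iff.1 hC'.isOpen_compl t t hmem
  refine ⟨U ∩ V, hU.inter hV, ⟨htU, htV⟩, fun x x' hx hx' => ?_⟩
  by_contra! h
  exact hUV (show (g x, g x') ∈ U ×ˢ V from ⟨hx.1, hx'.2⟩) ⟨(x, x'), h, rfl⟩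

/-- Maps from closed subsets of treelike continua lift through uniform coverings. -/
lemma Treelike.exists_lift {X E B : Type*} [MetricSpace X] [CompactSpace X] [MetricSpace E]
    [MetricSpace B] (hX : Treelike X) {p : E → B} (hp : IsUniformCovering p) {Z : Set X}
    (hZ : IsClosed Z) {u : X → B} (hu : ContinuousOn u Z)
    {x₀ : X} (hx₀ : x₀ ∈ Z) {e₀ : E} (he₀ : p e₀ = u x₀) :
    ∃ s : X → E, ContinuousOn s Z ∧ (∀ x ∈ Z, p (s x) = u x) ∧ s x₀ = e₀ := by
  obtain ⟨η, hη, hsep⟩ := hp.separated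
  obtain ⟨δ, hδ, hopen⟩ := hp.uniformly_open (η / 2) (by positivity)
  obtain ⟨ε, hε, huε⟩ := Metric.uniformContinuousOn_iff.1
    (hZ.isCompact.uniformContinuousOn_of_continuous hu) δ hδ
  obtain ⟨T, _, hT, g, hg, -, hgε⟩ := hX ε hε
  have hsmall : SmallTree (fun S => ∀ x x', g x ∈ S → g x' ∈ S → dist x x' < ε)
      (univ : Set T) :=
    hT.arcTree_univ.smallTree (fun A A' h h' x x' hx hx' => h' x x' (h hx) (h hx'))
      fun t => exists_open_nhds_dist_lt hg (hgε t)
  have key : ∀ K : Set T, SmallTree (fun S => ∀ x x', g x ∈ S → g x' ∈ S → dist x x' < ε) K →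
      LiftsOver p u g η Z K := by
    intro K hK
    induction hK with
    | @of_small A _ hA =>
      refine fun x₁ hx₁ e₁ he₁ => hp.exists_coherentLift_of_small hη hsep
        (hu.mono inter_subset_left) (fun x hx x' hx' e he => hopen e (u x') ?_) hx₁ he₁
      rw [he]
      exact huε x hx.1 x' hx'.1 (hA x x' hx.2 hx'.2)
    | glue hK hL h ihK ihL =>
      exact ihK.union hp.surjective hsep hg hZ hK.isClosed hL.isClosed ihL h
  obtain ⟨s, hs, hs₀⟩ := key univ hsmall x₀ ⟨hx₀, trivial⟩ e₀ he₀
  simp only [preimage_univ, inter_univ] at hs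
  exact ⟨s, hs.continuousOn, hs.lift, hs₀⟩

lemma isUniformCovering_of_isOpenMap {X Y : Type*} [MetricSpace X] [CompactSpace X]
    [MetricSpace Y] [CompactSpace Y] {f : X → Y} (hf : Continuous f)
    (hsurj : Function.Surjective f) (hopen : IsOpenMap f)
    (hloc : ∀ x : X, ∃ U ∈ 𝓝 x, Set.InjOn f U) : IsUniformCovering f := by
  refine ⟨hsurj, ?_, fun ρ hρ => ?_⟩
  · choose U hU hUinj using hloc
    obtain ⟨δ, hδ, hball⟩ := lebesgue_number_lemma_of_metric (c := fun x => interior (U x))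
      isCompact_univ (fun x => isOpen_interior)
      (fun x _ => mem_iUnion.2 ⟨x, mem_interior_iff_mem_nhds.2 (hU x)⟩)
    refine ⟨δ / 2, by positivity, fun e e' h hd => ?_⟩
    obtain ⟨i, hi⟩ := hball e trivial
    refine hUinj i (interior_subset (hi (mem_ball_self hδ))) (interior_subset (hi ?_)) h
    rw [mem_ball, dist_comm]
    linarith
  · have hV : IsOpen (Prod.map id f '' {q : X × X | dist q.1 q.2 < ρ}) :=
      (IsOpenMap.id.prodMap hopen) _ (isOpen_lt continuous_dist continuous_const)
    obtain ⟨δ, hδ, hle⟩ := hV.isClosed_compl.isCompact.exists_forall_le'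
      (f := fun q : X × Y => dist (f q.1) q.2) (a := 0)
      (by fun_prop) (by
        rintro ⟨e, b⟩ hq
        refine dist_pos.2 fun h => hq ⟨(e, e), ?_, Prod.ext rfl h⟩
        simpa using hρ)
    refine ⟨δ, hδ, fun e b hd => ?_⟩
    by_contra! hcon
    refine (hle (e, b) ?_).not_gt hd
    rintro ⟨⟨e₁, e'⟩, hd', h⟩
    obtain ⟨rfl, h₂⟩ := Prod.mk.inj h
    exact (hcon e' h₂).not_gt hd'

lemma isUniformCovering_unitAddCircle : IsUniformCovering (fun t : ℝ => (t : UnitAddCircle)) := by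
  refine ⟨QuotientAddGroup.mk_surjective, ⟨1 / 2, by norm_num, fun e e' h hd => ?_⟩,
    fun ρ hρ => ⟨ρ, hρ, fun e b hd => ?_⟩⟩
  · have h₀ : ((e - e' : ℝ) : UnitAddCircle) = 0 := by
      rw [AddCircle.coe_sub, sub_eq_zero]
      exact h
    obtain ⟨n, hn⟩ := (AddCircle.coe_eq_zero_iff 1).1 h₀
    rw [Real.dist_eq, ← hn] at hd
    have hn' : |n| < 1 := by
      have : |(n : ℝ)| < 1 := by simpa using hd
      exact_mod_cast this
    rw [Int.abs_lt_one_iff.1 hn'] at hn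
    simp only [zero_smul] at hn
    linarith
  · obtain ⟨b, rfl⟩ := QuotientAddGroup.mk_surjective b
    refine ⟨b + round (e - b), ?_, ?_⟩
    · have : ((round (e - b) : ℝ) : UnitAddCircle) = 0 :=
        (AddCircle.coe_eq_zero_iff 1).2 ⟨round (e - b), by simp⟩
      rw [AddCircle.coe_add, this, add_zero]
    · have hd' : ‖((e - b : ℝ) : UnitAddCircle)‖ < ρ := by
        rw [AddCircle.coe_sub, ← dist_eq_norm]
        exact hd
      rw [UnitAddCircle.norm_eq] at hd'
      rwa [Real.dist_eq, ← sub_sub]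

/-- Circle-valued maps on closed subsets of treelike continua have real lifts. -/
lemma Treelike.exists_real_lift {X : Type*} [MetricSpace X] [CompactSpace X] (hX : Treelike X)
    {Z : Set X} (hZ : IsClosed Z) {u : X → UnitAddCircle} (hu : ContinuousOn u Z) :
    ∃ s : X → ℝ, ContinuousOn s Z ∧ ∀ x ∈ Z, (s x : UnitAddCircle) = u x := by
  rcases Z.eq_empty_or_nonempty with rfl | ⟨x₀, hx₀⟩
  · exact ⟨fun _ => 0, continuousOn_empty _, by simp⟩
  · obtain ⟨e₀, he₀⟩ := isUniformCovering_unitAddCircle.surjective (u x₀)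
    obtain ⟨s, hs, hs', -⟩ := hX.exists_lift isUniformCovering_unitAddCircle hZ hu hx₀ he₀
    exact ⟨s, hs, hs'⟩

lemma Treelike.exists_circle_extension {X : Type*} [MetricSpace X] [CompactSpace X]
    (hX : Treelike X) {Z : Set X} (hZ : IsClosed Z) {u : X → UnitAddCircle}
    (hu : ContinuousOn u Z) : ∃ w : X → UnitAddCircle, Continuous w ∧ EqOn w u Z := by
  obtain ⟨s, hs, hsu⟩ := hX.exists_real_lift hZ hu
  obtain ⟨r, hr⟩ := ContinuousMap.exists_restrict_eq hZ ⟨Z.domRestrict s, hs.domRestrict⟩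
  refine ⟨fun x => (r x : UnitAddCircle), (AddCircle.continuous_mk' 1).comp r.continuous,
    fun x hx => ?_⟩
  have : r x = s x := congrArg (fun φ : C(Z, ℝ) => φ ⟨x, hx⟩) hr
  simp only [this, hsu x hx]

section Equivariant

variable {X : Type*} [MetricSpace X] [CompactSpace X] {s : X → X} {m : ℕ} {c : UnitAddCircle}

/-- An equivariant circle-valued map on a closed invariant set extends to a closed invariant set
containing a given closed set which is disjoint from its translates. -/
lemma Treelike.extend_equivariant (hX : Treelike X) (hs : Continuous s) (hm : 0 < m)
    (hsm : s^[m] = id) (hc : m • c = 0) {Z : Set X} (hZ : IsClosed Z) (hsZ : MapsTo s Z Z)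
    {v : X → UnitAddCircle} (hv : ContinuousOn v Z) (hvs : ∀ x ∈ Z, v (s x) = v x + c)
    {A : Set X} (hA : IsClosed A) (hdisj : ∀ i, 0 < i → i < m → ∀ x ∈ A, s^[i] x ∉ A) :
    ∃ Z' : Set X, IsClosed Z' ∧ MapsTo s Z' Z' ∧ Z ⊆ Z' ∧ A ⊆ Z' ∧
      ∃ v' : X → UnitAddCircle, ContinuousOn v' Z' ∧ ∀ x ∈ Z', v' (s x) = v' x + c := by
  classical
  obtain ⟨vA, hvA, hvAeq⟩ := hX.exists_circle_extension (hZ.inter hA) (hv.mono inter_subset_left)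
  have hviter : ∀ i, ∀ x ∈ Z, s^[i] x ∈ Z ∧ v (s^[i] x) = v x + i • c := by
    intro i x hx
    induction i with
    | zero => simpa using hx
    | succ i ih =>
      rw [Function.iterate_succ_apply', hvs _ ih.1, ih.2, succ_nsmul, add_assoc]
      exact ⟨hsZ ih.1, rfl⟩
  have hidx : ∀ x, ∃ i, (∃ j < m, s^[j] x ∈ A) → i < m ∧ s^[i] x ∈ A := by
    intro x
    by_cases h : ∃ j < m, s^[j] x ∈ A
    · obtain ⟨j, hj⟩ := h
      exact ⟨j, fun _ => hj⟩
    · exact ⟨0, fun h' => absurd h' h⟩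
  choose idx hidx using hidx
  have hlt : ∀ x i j, i < j → j < m → s^[i] x ∈ A → s^[j] x ∉ A := by
    intro x i j hij hj hi
    have := hdisj (j - i) (by omega) (by omega) _ hi
    rwa [← Function.iterate_add_apply, Nat.sub_add_cancel hij.le] at this
  set w : X → UnitAddCircle := fun x => vA (s^[idx x] x) - idx x • c with hw
  have hweq : ∀ i < m, ∀ x, s^[i] x ∈ A → w x = vA (s^[i] x) - i • c := by
    intro i hi x hx
    obtain ⟨hm', hA'⟩ := hidx x ⟨i, hi, hx⟩
    have : idx x = i := by
      rcases lt_trichotomy (idx x) i with h | h | h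
      · exact absurd hx (hlt x _ _ h hi hA')
      · exact h
      · exact absurd hA' (hlt x _ _ h hm' hx)
    rw [hw]
    simp only [this]
  set W : Set X := ⋃ i ∈ Finset.range m, s^[i] ⁻¹' A with hW
  have hmemW : ∀ {x}, x ∈ W ↔ ∃ i < m, s^[i] x ∈ A := by simp [hW]
  have hWi : ∀ i, IsClosed (s^[i] ⁻¹' A) := fun i => hA.preimage (hs.iterate i)
  have hWc : IsClosed W := Set.Finite.isClosed_biUnion (Finset.finite_toSet _) fun i _ => hWi i
  have hwc : ContinuousOn w W := by
    have : W = ⋃ i : Fin m, s^[i] ⁻¹' A := by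
      ext x
      simp [hmemW, Fin.exists_iff]
    rw [this]
    refine (locallyFinite_of_finite _).continuousOn_iUnion (fun i => hWi i) fun i => ?_
    refine ContinuousOn.congr (f := fun x => vA (s^[i] x) - (i : ℕ) • c) ?_
      fun x hx => hweq i i.2 x hx
    exact ((hvA.comp (hs.iterate i)).sub continuous_const).continuousOn
  have hwW : ∀ x ∈ W, s x ∈ W ∧ w (s x) = w x + c := by
    intro x hx
    obtain ⟨i, hi, hxi⟩ := hmemW.1 hx
    rcases i with _ | i
    · obtain ⟨n, rfl⟩ : ∃ n, m = n + 1 := ⟨m - 1, by omega⟩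
      have hsx : s^[n] (s x) = x := by
        rw [← Function.iterate_succ_apply, hsm, id]
      have hmem : s^[n] (s x) ∈ A := by
        rw [hsx]
        exact hxi
      refine ⟨hmemW.2 ⟨n, by omega, hmem⟩, ?_⟩
      rw [hweq n (by omega) _ hmem, hweq 0 hi x hxi, hsx]
      have hnc : n • c = -c := by
        rw [succ_nsmul] at hc
        exact eq_neg_of_add_eq_zero_left hc
      simp [hnc]
    · have hmem : s^[i] (s x) ∈ A := hxi
      refine ⟨hmemW.2 ⟨i, by omega, hmem⟩, ?_⟩
      rw [hweq i (by omega) _ hmem, hweq (i + 1) hi x hxi, Function.iterate_succ_apply, succ_nsmul]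
      abel
  have hagree : ∀ x ∈ Z, x ∈ W → v x = w x := by
    intro x hxZ hxW
    obtain ⟨i, hi, hxi⟩ := hmemW.1 hxW
    obtain ⟨h₁, h₂⟩ := hviter i x hxZ
    rw [hweq i hi x hxi, hvAeq ⟨h₁, hxi⟩, h₂, add_sub_cancel_right]
  set v' : X → UnitAddCircle := fun x => if x ∈ Z then v x else w x
  have hv'Z : EqOn v' v Z := fun x hx => if_pos hx
  have hv'W : EqOn v' w W := by
    intro x hx
    by_cases h : x ∈ Z
    · exact (if_pos h).trans (hagree x h hx)
    · exact if_neg h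
  refine ⟨Z ∪ W, hZ.union hWc, ?_, subset_union_left, fun x hx => Or.inr (hmemW.2 ⟨0, hm, hx⟩),
    v', (hv.congr hv'Z).union_of_isClosed (hwc.congr hv'W) hZ hWc, ?_⟩
  · rintro x (hx | hx)
    · exact Or.inl (hsZ hx)
    · exact Or.inr (hwW x hx).1
  · rintro x (hx | hx)
    · rw [hv'Z hx, hv'Z (hsZ hx), hvs x hx]
    · rw [hv'W hx, hv'W (hwW x hx).1, (hwW x hx).2]

lemma Treelike.exists_equivariant (hX : Treelike X) (hs : Continuous s) (hm : 0 < m)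
    (hsm : s^[m] = id) (hfree : ∀ i, 0 < i → i < m → ∀ x, s^[i] x ≠ x) (hc : m • c = 0) :
    ∃ v : X → UnitAddCircle, Continuous v ∧ ∀ x, v (s x) = v x + c := by
  have hloc : ∀ x : X, ∃ N ∈ 𝓝 x, IsClosed N ∧ ∀ i, 0 < i → i < m → ∀ y ∈ N, s^[i] y ∉ N := by
    intro x
    have h : ∀ i, ∃ N ∈ 𝓝 x, 0 < i → i < m → ∀ y ∈ N, s^[i] y ∉ N := by
      intro i
      by_cases hi : 0 < i ∧ i < m
      · obtain ⟨U, V, hU, hV, hUV⟩ := t2_separation_nhds (hfree i hi.1 hi.2 x).symm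
        refine ⟨U ∩ s^[i] ⁻¹' V, Filter.inter_mem hU
          ((hs.iterate i).continuousAt.preimage_mem_nhds hV), fun _ _ y hy hy' => ?_⟩
        exact disjoint_left.1 hUV hy'.1 hy.2
      · exact ⟨univ, Filter.univ_mem, fun h₁ h₂ => absurd ⟨h₁, h₂⟩ hi⟩
    choose N hN hNd using h
    have hmem : ⋂ i ∈ Finset.range m, N i ∈ 𝓝 x :=
      (Filter.biInter_finset_mem _).2 fun i _ => hN i
    obtain ⟨C, hC, hCc, hCN⟩ := exists_mem_nhds_isClosed_subset hmem
    refine ⟨C, hC, hCc, fun i h₀ hi y hy hy' => ?_⟩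
    have hsub : C ⊆ N i := hCN.trans (biInter_subset_of_mem (by simpa using hi))
    exact hNd i h₀ hi y (hsub hy) (hsub hy')
  choose N hN hNc hNd using hloc
  obtain ⟨F, -, hF⟩ := isCompact_univ.elim_nhds_subcover N fun x _ => hN x
  have key : ∀ F : Finset X, ∃ Z : Set X, IsClosed Z ∧ MapsTo s Z Z ∧ ⋃ x ∈ F, N x ⊆ Z ∧
      ∃ v : X → UnitAddCircle, ContinuousOn v Z ∧ ∀ x ∈ Z, v (s x) = v x + c := by
    classical
    intro F
    induction F using Finset.induction_on with
    | empty =>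
      exact ⟨∅, isClosed_empty, mapsTo_empty _ _, by simp, 0, continuousOn_empty _, by simp⟩
    | insert a F _ ih =>
      obtain ⟨Z, hZ, hsZ, hFZ, v, hv, hvs⟩ := ih
      obtain ⟨Z', hZ', hsZ', hZZ', hAZ', hv'⟩ :=
        hX.extend_equivariant hs hm hsm hc hZ hsZ hv hvs (hNc a) (hNd a)
      refine ⟨Z', hZ', hsZ', ?_, hv'⟩
      rw [Finset.set_biUnion_insert]
      exact union_subset hAZ' (hFZ.trans hZZ')
  obtain ⟨Z, -, -, hFZ, v, hv, hvs⟩ := key F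
  have hZ : Z = univ := univ_subset_iff.1 (hF.trans hFZ)
  rw [hZ] at hv hvs
  exact ⟨v, continuousOn_univ.1 hv, fun x => hvs x trivial⟩

/-- A treelike continuum has no free periodic map of period at least two. -/
lemma Treelike.not_free_periodic [ConnectedSpace X] (hX : Treelike X) (hs : Continuous s)
    (hm : 1 < m) (hsm : s^[m] = id) (hfree : ∀ i, 0 < i → i < m → ∀ x, s^[i] x ≠ x) : False := by
  set c : UnitAddCircle := ((1 / m : ℝ) : UnitAddCircle) with hcdef
  have hm0 : (m : ℝ) ≠ 0 := by positivity
  have hc : m • c = 0 := by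
    rw [hcdef, ← AddCircle.coe_nsmul, nsmul_eq_mul, mul_one_div_cancel hm0]
    exact AddCircle.coe_period 1
  have hc0 : c ≠ 0 := by
    intro h
    obtain ⟨n, hn⟩ := (AddCircle.coe_eq_zero_iff 1).1 h
    have : (n * m : ℤ) = 1 := by
      have : (n : ℝ) * m = 1 := by
        simp only [zsmul_eq_mul, mul_one] at hn
        rw [hn]
        field_simp
      exact_mod_cast this
    have := Int.le_of_dvd one_pos ⟨n, by rw [mul_comm, this]⟩
    omega
  obtain ⟨v, hv, hvs⟩ := hX.exists_equivariant hs (by omega) hsm hfree hc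
  obtain ⟨r, hr, hrv⟩ := hX.exists_real_lift isClosed_univ hv.continuousOn
  rw [continuousOn_univ] at hr
  obtain ⟨a, -, ha⟩ := isCompact_univ.exists_isMinOn univ_nonempty hr.continuousOn
  obtain ⟨b, -, hb⟩ := isCompact_univ.exists_isMaxOn univ_nonempty hr.continuousOn
  obtain ⟨z, hz⟩ := intermediate_value_univ₂ (a := a) (b := b) hr (hr.comp hs)
    (ha (mem_univ (s a))) (hb (mem_univ (s b)))
  have h := hvs z
  rw [← hrv z trivial, ← hrv (s z) trivial, hz] at h
  exact hc0 (by simpa using h)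

end Equivariant

/-- A locally injective uniform covering with finite fibres is injective if its domain is a
treelike continuum. -/
lemma Treelike.injective_of_isUniformCovering {X Y : Type*} [MetricSpace X] [CompactSpace X]
    [ConnectedSpace X] [MetricSpace Y] (hX : Treelike X) {f : X → Y} (hf : Continuous f)
    (hcov : IsUniformCovering f) (hloc : IsLocallyInjective f)
    (hfin : ∀ y, (f ⁻¹' {y}).Finite) : Function.Injective f := by
  intro x₀ x₁ h01
  by_contra hne
  have huniq : ∀ s t : X → X, Continuous s → Continuous t → f ∘ s = f → f ∘ t = f →
      ∀ x, s x = t x → s = t := fun s t hs ht hfs hft x hx =>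
    (T2Space.isSeparatedMap f).eq_of_comp_eq hloc hs ht (hfs.trans hft.symm) x hx
  have hlift : ∀ x x', f x = f x' → ∃ s : X → X, Continuous s ∧ f ∘ s = f ∧ s x = x' := by
    intro x x' h
    obtain ⟨s, hs, hfs, hsx⟩ :=
      hX.exists_lift hcov isClosed_univ hf.continuousOn (mem_univ x) h.symm
    exact ⟨s, continuousOn_univ.1 hs, funext fun x => hfs x trivial, hsx⟩
  obtain ⟨s, hs, hfs, hs0⟩ := hlift x₀ x₁ h01
  obtain ⟨t, ht, hft, ht1⟩ := hlift x₁ x₀ h01.symm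
  have hts : t ∘ s = id := huniq _ _ (ht.comp hs) continuous_id
    (by rw [← Function.comp_assoc, hft, hfs]) rfl x₀ (by simp [hs0, ht1])
  have hinj : Function.Injective s := (Function.leftInverse_iff_comp.2 hts).injective
  have hfiter : ∀ n, f ∘ s^[n] = f := by
    intro n
    induction n with
    | zero => rfl
    | succ n ih => rw [Function.iterate_succ, ← Function.comp_assoc, ih, hfs]
  obtain ⟨i, j, hij, hsij⟩ : ∃ i j, i < j ∧ s^[i] x₀ = s^[j] x₀ := by
    have hmaps : ∀ n : ℕ, s^[n] x₀ ∈ f ⁻¹' {f x₀} := fun n => congrFun (hfiter n) x₀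
    have := (hfin (f x₀)).to_subtype
    obtain ⟨i, j, hne, h⟩ := Finite.exists_ne_map_eq_of_infinite
      fun n : ℕ => (⟨s^[n] x₀, hmaps n⟩ : f ⁻¹' {f x₀})
    have h' : s^[i] x₀ = s^[j] x₀ := congrArg Subtype.val h
    rcases hne.lt_or_gt with hlt | hlt
    · exact ⟨i, j, hlt, h'⟩
    · exact ⟨j, i, hlt, h'.symm⟩
  have hper : x₀ ∈ Function.periodicPts s := by
    refine ⟨j - i, by omega, hinj.iterate i ?_⟩
    rw [← Function.iterate_add_apply, Nat.add_sub_cancel' hij.le, hsij]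
  set m := Function.minimalPeriod s x₀ with hm
  have hm0 : 0 < m := Function.minimalPeriod_pos_of_mem_periodicPts hper
  have hm1 : m ≠ 1 := by
    intro h
    exact hne ((Function.minimalPeriod_eq_one_iff_isFixedPt.1 h).symm.trans hs0)
  refine hX.not_free_periodic hs (m := m) (by omega) ?_ ?_
  · exact huniq _ _ (hs.iterate m) continuous_id (hfiter m) rfl x₀
      (Function.iterate_minimalPeriod)
  · intro i hi him x hx
    have hid := huniq _ _ (hs.iterate i) continuous_id (hfiter i) rfl x hx
    exact him.not_ge (Function.IsPeriodicPt.minimalPeriod_le hi (congrFun hid x₀))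

/-- No treelike continuum admits a nontrivial `k`-fold covering map: any open, locally
injective, exactly `k`-to-1 continuous surjection from a treelike continuum onto a
continuum has `k = 1`. -/
theorem treelike_no_nontrivial_covering_map
    (X Y : Type) [MetricSpace X] [CompactSpace X] [ConnectedSpace X] [Nonempty X]
    [MetricSpace Y] [CompactSpace Y] [ConnectedSpace Y] [Nonempty Y]
    (htree : Treelike X)
    (f : X → Y) (hf : Continuous f) (hsurj : Function.Surjective f)
    (hopen : IsOpenMap f) (hloc : ∀ x : X, ∃ U ∈ 𝓝 x, Set.InjOn f U)
    (k : ℕ) (hk : 0 < k) (hfib : ∀ y : Y, (f ⁻¹' {y}).ncard = k) :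
    k = 1 := by
  have hcov := isUniformCovering_of_isOpenMap hf hsurj hopen hloc
  have hinj := htree.injective_of_isUniformCovering hf hcov (isLocallyInjective_iff_nhds.2 hloc)
    fun y => finite_of_ncard_pos (by rw [hfib y]; exact hk)
  obtain ⟨x⟩ := ‹Nonempty X›
  rw [← hfib (f x), ← image_singleton, hinj.preimage_image, ncard_singleton]
end

section
/- If f is a simple, strictly locally 1-to-1 continuous map defined on a treelike continuum X, then f(X) is a 2-to-1 retract of a continuum. -/
open Set Metric Topology

/-- `x` and `y` are the endpoints of an arc lying in `K`. -/
def JoinedByArcIn {T : Type*} [TopologicalSpace T] (K : Set T) (x y : T) : Prop :=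
  ∃ α : ℝ → T, ContinuousOn α (Icc 0 1) ∧ InjOn α (Icc 0 1) ∧ MapsTo α (Icc 0 1) K ∧
    α 0 = x ∧ α 1 = y

section Arcs

variable {T : Type*} [TopologicalSpace T]

/-- The map following `α` on `[0, 1]` and then `β` on `[1, 2]`, shifted to start at time `1`. -/
noncomputable def concatPath (α β : ℝ → T) (t : ℝ) : T := if t ≤ 1 then α t else β (t - 1)

theorem continuousOn_concatPath {α β : ℝ → T} (hα : ContinuousOn α (Icc 0 1))
    (hβ : ContinuousOn β (Icc 0 1)) (h : α 1 = β 0) :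
    ContinuousOn (concatPath α β) (Icc 0 2) := by
  have h1 : ContinuousOn (concatPath α β) (Icc 0 1) :=
    hα.congr fun t ht => by simp [concatPath, ht.2]
  have h2 : ContinuousOn (concatPath α β) (Icc 1 2) := by
    have : ContinuousOn (fun t : ℝ => β (t - 1)) (Icc 1 2) :=
      hβ.comp (by fun_prop) fun t ht => ⟨by linarith [ht.1], by linarith [ht.2]⟩
    refine this.congr fun t ht => ?_
    rcases ht.1.eq_or_lt with rfl | h'
    · simp [concatPath, h]
    · simp [concatPath, h']
  refine (h1.union_of_isClosed h2 isClosed_Icc isClosed_Icc).mono fun t ht => ?_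
  rcases le_total t 1 with h' | h'
  · exact Or.inl ⟨ht.1, h'⟩
  · exact Or.inr ⟨h', ht.2⟩

theorem JoinedByArcIn.mono {K L : Set T} {x y : T} (h : JoinedByArcIn K x y) (hKL : K ⊆ L) :
    JoinedByArcIn L x y := by
  obtain ⟨α, h1, h2, h3, h4⟩ := h
  exact ⟨α, h1, h2, h3.mono_right hKL, h4⟩

theorem JoinedByArcIn.symm {K : Set T} {x y : T} (h : JoinedByArcIn K x y) :
    JoinedByArcIn K y x := by
  obtain ⟨α, hc, hi, hm, h0, h1⟩ := h
  have hmaps : MapsTo (fun t : ℝ => 1 - t) (Icc 0 1) (Icc 0 1) := fun t ht =>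
    ⟨by linarith [ht.2], by linarith [ht.1]⟩
  refine ⟨fun t => α (1 - t), hc.comp (by fun_prop) hmaps, fun s hs t ht hst => ?_,
    fun t ht => hm (hmaps ht), by simpa, by simpa⟩
  linarith [hi (hmaps hs) (hmaps ht) hst]

theorem joinedByArcIn_image_of_lt {γ : ℝ → T} (hc : ContinuousOn γ (Icc 0 1))
    (hi : InjOn γ (Icc 0 1)) {a b : ℝ} (ha : 0 ≤ a) (hab : a < b) (hb : b ≤ 1) :
    JoinedByArcIn (γ '' Icc a b) (γ a) (γ b) := by
  have hmaps : MapsTo (fun t : ℝ => a + t * (b - a)) (Icc 0 1) (Icc a b) := fun t ht =>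
    ⟨by nlinarith [ht.1], by nlinarith [ht.2]⟩
  have hsub : Icc a b ⊆ Icc 0 1 := Icc_subset_Icc ha hb
  refine ⟨fun t => γ (a + t * (b - a)), (hc.mono hsub).comp (by fun_prop) hmaps,
    fun s hs t ht hst => ?_, fun t ht => mem_image_of_mem _ (hmaps ht), by simp, by simp⟩
  have := hi (hsub (hmaps hs)) (hsub (hmaps ht)) hst
  exact mul_right_cancel₀ (sub_ne_zero.2 hab.ne') (add_left_cancel this)

theorem joinedByArcIn_image {γ : ℝ → T} (hc : ContinuousOn γ (Icc 0 1))
    (hi : InjOn γ (Icc 0 1)) {x y : T} (hx : x ∈ γ '' Icc 0 1) (hy : y ∈ γ '' Icc 0 1)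
    (hxy : x ≠ y) : JoinedByArcIn (γ '' Icc 0 1) x y := by
  obtain ⟨a, ha, rfl⟩ := hx
  obtain ⟨b, hb, rfl⟩ := hy
  have hab : a ≠ b := fun h => hxy (h ▸ rfl)
  rcases hab.lt_or_gt with h | h
  · exact (joinedByArcIn_image_of_lt hc hi ha.1 h hb.2).mono
      (image_mono (Icc_subset_Icc ha.1 hb.2))
  · exact ((joinedByArcIn_image_of_lt hc hi hb.1 h ha.2).mono
      (image_mono (Icc_subset_Icc hb.1 ha.2))).symm

theorem JoinedByArcIn.trans {K L : Set T} {x p y : T} (hK : JoinedByArcIn K x p)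
    (hL : JoinedByArcIn L p y) (hKL : K ∩ L ⊆ {p}) : JoinedByArcIn (K ∪ L) x y := by
  obtain ⟨α, hαc, hαi, hαm, rfl, rfl⟩ := hK
  obtain ⟨β, hβc, hβi, hβm, h0, rfl⟩ := hL
  have key : ∀ s ∈ Icc (0:ℝ) 1, ∀ t : ℝ, 1 < t → t ≤ 2 → α s ≠ β (t - 1) := by
    intro s hs t ht1 ht2 hst
    have htm : t - 1 ∈ Icc (0:ℝ) 1 := ⟨by linarith, by linarith⟩
    have h1 : β (t - 1) = β 0 := by
      rw [h0]
      exact hKL ⟨hst ▸ hαm hs, hβm htm⟩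
    linarith [hβi htm (by simp) h1]
  have hinj : InjOn (concatPath α β) (Icc 0 2) := by
    intro s hs t ht hst
    unfold concatPath at hst
    split_ifs at hst with h1 h2 h2
    · exact hαi ⟨hs.1, h1⟩ ⟨ht.1, h2⟩ hst
    · exact absurd hst (key s ⟨hs.1, h1⟩ t (not_le.1 h2) ht.2)
    · exact absurd hst.symm (key t ⟨ht.1, h2⟩ s (not_le.1 h1) hs.2)
    · rw [not_le] at h1 h2
      linarith [hβi ⟨by linarith, by linarith [hs.2]⟩ ⟨by linarith, by linarith [ht.2]⟩ hst]
  have hmaps : MapsTo (fun t : ℝ => 2 * t) (Icc 0 1) (Icc 0 2) := fun t ht =>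
    ⟨by linarith [ht.1], by linarith [ht.2]⟩
  refine ⟨fun t => concatPath α β (2 * t),
    (continuousOn_concatPath hαc hβc h0.symm).comp (by fun_prop) hmaps,
    fun s hs t ht hst => by linarith [hinj (hmaps hs) (hmaps ht) hst], fun t ht => ?_,
    by simp [concatPath], ?_⟩
  · by_cases h : 2 * t ≤ 1
    · simp only [concatPath, h, if_true]
      exact Or.inl (hαm ⟨(hmaps ht).1, h⟩)
    · simp only [concatPath, h, if_false]
      rw [not_le] at h
      exact Or.inr (hβm ⟨by linarith, by linarith [ht.2]⟩)
  · norm_num [concatPath]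

/-- Two arcs with common endpoints and no other common point form a simple closed curve. -/
theorem exists_homeomorph_sphere_of_arcs [T2Space T] {K L : Set T} {x y : T}
    (hK : JoinedByArcIn K x y) (hL : JoinedByArcIn L x y) (hKL : K ∩ L ⊆ {x, y}) :
    ∃ S : Set T, Nonempty (S ≃ₜ (Metric.sphere (0:ℂ) 1)) := by
  obtain ⟨α, hαc, hαi, hαm, rfl, rfl⟩ := hK
  obtain ⟨β, hβc, hβi, hβm, h0, h1⟩ := hL.symm
  have key : ∀ s ∈ Icc (0:ℝ) 1, ∀ t : ℝ, 1 < t → t < 2 → α s ≠ β (t - 1) := by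
    intro s hs t ht1 ht2 hst
    have htm : t - 1 ∈ Icc (0:ℝ) 1 := ⟨by linarith, by linarith⟩
    rcases hKL ⟨hst ▸ hαm hs, hβm htm⟩ with h | h
    · linarith [hβi htm (by simp) (h.trans h1.symm)]
    · linarith [hβi htm (by simp) (h.trans h0.symm)]
  have hinj : InjOn (concatPath α β) (Ico 0 2) := by
    intro s hs t ht hst
    unfold concatPath at hst
    split_ifs at hst with h1 h2 h2
    · exact hαi ⟨hs.1, h1⟩ ⟨ht.1, h2⟩ hst
    · exact absurd hst (key s ⟨hs.1, h1⟩ t (not_le.1 h2) ht.2)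
    · exact absurd hst.symm (key t ⟨ht.1, h2⟩ s (not_le.1 h1) hs.2)
    · rw [not_le] at h1 h2
      linarith [hβi ⟨by linarith, by linarith [hs.2]⟩ ⟨by linarith, by linarith [ht.2]⟩ hst]
  have : Fact ((0:ℝ) < 2) := ⟨two_pos⟩
  have hcont : Continuous (AddCircle.liftIco (2:ℝ) 0 (concatPath α β)) := by
    refine AddCircle.liftIco_continuous ?_ ?_
    · norm_num [concatPath, h1]
    · simpa using continuousOn_concatPath hαc hβc h0.symm
  have hinj' : Function.Injective (AddCircle.liftIco (2:ℝ) 0 (concatPath α β)) := by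
    intro a b hab
    obtain ⟨s, hs, rfl⟩ := AddCircle.eq_coe_Ico a
    obtain ⟨t, ht, rfl⟩ := AddCircle.eq_coe_Ico b
    rw [AddCircle.liftIco_zero_coe_apply hs, AddCircle.liftIco_zero_coe_apply ht] at hab
    rw [hinj hs ht hab]
  exact ⟨_, ⟨(hcont.isClosedEmbedding hinj').isEmbedding.toHomeomorph.symm.trans
    (AddCircle.homeomorphCircle two_ne_zero)⟩⟩

end Arcs

section TreeInduction

variable {T : Type*}

/-- A property of closed sets that holds locally and is preserved by unions meeting in a single
point holds for arcs. -/
theorem arc_induction [TopologicalSpace T] [T2Space T] {good : Set T → Prop}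
    (hloc : ∀ t, ∃ O ∈ 𝓝 t, ∀ C ⊆ O, IsClosed C → good C)
    (hglue : ∀ C D : Set T, ∀ p, IsClosed C → IsClosed D → C ∩ D = {p} →
      good C → good D → good (C ∪ D))
    {γ : ℝ → T} (hc : ContinuousOn γ (Icc 0 1)) (hi : InjOn γ (Icc 0 1)) :
    good (γ '' Icc 0 1) := by
  choose O hO hOgood using hloc
  have hcr : Continuous fun s : Icc (0:ℝ) 1 => γ s := hc.domRestrict
  obtain ⟨t, ht0, htm, ⟨m, hm⟩, ht⟩ := exists_monotone_Icc_subset_open_cover_Icc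
    (zero_le_one (α := ℝ)) (c := fun x : T => (fun s : Icc (0:ℝ) 1 => γ s) ⁻¹' interior (O x))
    (fun x => isOpen_interior.preimage hcr)
    (fun s _ => mem_iUnion.2 ⟨γ s, mem_interior_iff_mem_nhds.2 (hO _)⟩)
  have hclosed : ∀ a b : Icc (0:ℝ) 1, IsClosed (γ '' Icc a b) := fun a b =>
    (isCompact_Icc.image_of_continuousOn
      (hc.mono (Icc_subset_Icc a.2.1 b.2.2))).isClosed
  have hsmall : ∀ k, good (γ '' Icc (t k) (t (k + 1))) := by
    intro k
    obtain ⟨x, hx⟩ := ht k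
    refine hOgood x _ ?_ (hclosed _ _)
    rintro _ ⟨s, hs, rfl⟩
    have hs' : s ∈ Icc (0:ℝ) 1 := ⟨(t k).2.1.trans hs.1, hs.2.trans (t (k + 1)).2.2⟩
    exact interior_subset (hx (show (⟨s, hs'⟩ : Icc (0:ℝ) 1) ∈ Icc (t k) (t (k + 1)) from hs))
  have hall : ∀ k, good (γ '' Icc (t 0) (t (k + 1))) := by
    intro k
    induction k with
    | zero => exact hsmall 0
    | succ k ih =>
      have h1 : (t 0 : ℝ) ≤ t (k + 1) := htm (Nat.zero_le _)
      have h2 : (t (k + 1) : ℝ) ≤ t (k + 1 + 1) := htm (Nat.le_succ _)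
      rw [← Icc_union_Icc_eq_Icc h1 h2, image_union]
      refine hglue _ _ (γ (t (k + 1))) (hclosed _ _) (hclosed _ _) ?_ ih (hsmall _)
      rw [← hi.image_inter (Icc_subset_Icc (t 0).2.1 (t (k + 1)).2.2)
        (Icc_subset_Icc (t (k + 1)).2.1 (t (k + 1 + 1)).2.2), Icc_inter_Icc_eq_singleton h1 h2,
        image_singleton]
  simpa [ht0, hm (m + 1) (Nat.le_succ m)] using hall m

/-- A property of closed sets that holds locally and is preserved by unions meeting in a single
point holds for every tree. -/
theorem IsTree.induction [MetricSpace T] (hT : IsTree T) {good : Set T → Prop}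
    (hloc : ∀ t, ∃ O ∈ 𝓝 t, ∀ C ⊆ O, IsClosed C → good C)
    (hglue : ∀ C D : Set T, ∀ p, IsClosed C → IsClosed D → C ∩ D = {p} →
      good C → good D → good (C ∪ D)) :
    good univ := by
  classical
  obtain ⟨-, hconn, hne, ⟨n, γ, hγ, hcover, hinter⟩, hcirc⟩ := hT
  have hclosed : ∀ s : Finset (Fin n), IsClosed (⋃ i ∈ s, γ i '' Icc 0 1) := fun s =>
    isClosed_biUnion_finset fun i _ => (isCompact_Icc.image_of_continuousOn (hγ i).1).isClosed
  let P : Finset (Fin n) → Prop := fun s => good (⋃ i ∈ s, γ i '' Icc 0 1) ∧ s.Nonempty ∧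
    ∀ x ∈ ⋃ i ∈ s, γ i '' Icc 0 1, ∀ y ∈ ⋃ i ∈ s, γ i '' Icc 0 1, x ≠ y →
      JoinedByArcIn (⋃ i ∈ s, γ i '' Icc 0 1) x y
  have hP : ∃ s, P s := by
    obtain ⟨x⟩ := hne
    obtain ⟨i, -⟩ := mem_iUnion.1 (hcover.symm ▸ mem_univ x)
    refine ⟨{i}, ?_, by simp, ?_⟩
    · simpa using arc_induction hloc hglue (hγ i).1 (hγ i).2
    · simpa only [Finset.mem_singleton, iUnion_iUnion_eq_left] using
        fun x hx y hy hxy => joinedByArcIn_image (hγ i).1 (hγ i).2 hx hy hxy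
  obtain ⟨s, hs⟩ := (Set.toFinite {s | P s}).exists_maximal hP
  obtain ⟨⟨hgood, hsne, harc⟩, hmax⟩ := hs
  set K := ⋃ i ∈ s, γ i '' Icc 0 1 with hK
  by_cases hKu : K = univ
  · rwa [← hKu]
  exfalso
  have hLclosed := hclosed sᶜ
  set L := ⋃ i ∈ sᶜ, γ i '' Icc 0 1 with hL
  have hKL : K ∪ L = univ := by
    refine eq_univ_of_forall fun x => ?_
    obtain ⟨i, hi⟩ := mem_iUnion.1 (hcover.symm ▸ mem_univ x)
    by_cases his : i ∈ s
    · exact Or.inl (mem_biUnion (by exact his) hi)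
    · exact Or.inr (mem_biUnion (by simpa using his) hi)
  have hKne : K.Nonempty := by
    obtain ⟨i, hi⟩ := hsne
    exact ⟨γ i 0, mem_biUnion (by exact hi) ⟨0, by simp, rfl⟩⟩
  have hLne : L.Nonempty := by
    obtain ⟨x, hx⟩ := (ne_univ_iff_exists_notMem K).1 hKu
    exact ⟨x, (hKL.symm ▸ mem_univ x : x ∈ K ∪ L).resolve_left hx⟩
  obtain ⟨q, -, hqK, hqL⟩ := isPreconnected_closed_iff.1 isPreconnected_univ K L (hclosed s)
    hLclosed hKL.ge (by simpa) (by simpa)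
  obtain ⟨i, his, hqi⟩ := mem_iUnion₂.1 hqL
  rw [Finset.mem_compl] at his
  have hfin : (K ∩ γ i '' Icc 0 1).Finite := by
    rw [hK, iUnion₂_inter]
    refine s.finite_toSet.biUnion fun j hj => Set.Finite.subset (Set.toFinite _)
      (hinter j i ?_)
    rintro rfl
    exact his hj
  have hsingle : K ∩ γ i '' Icc 0 1 = {q} := by
    refine Subset.antisymm (fun z hz => ?_) (singleton_subset_iff.2 ⟨hqK, hqi⟩)
    by_contra hzq
    let F : Set ℝ := Icc 0 1 ∩ γ i ⁻¹' K
    have hF : F.Finite := by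
      refine Set.Finite.of_finite_image (f := γ i) (hfin.subset ?_)
        ((hγ i).2.mono inter_subset_left)
      rintro _ ⟨t, ht, rfl⟩
      exact ⟨ht.2, t, ht.1, rfl⟩
    obtain ⟨a, b', ha, hb', hab'⟩ : ∃ a b, a ∈ F ∧ b ∈ F ∧ a < b := by
      obtain ⟨u, hu, rfl⟩ := hqi
      obtain ⟨hvK, v, hv, rfl⟩ := hz
      have huv : u ≠ v := fun h => hzq (by simp [h])
      rcases huv.lt_or_gt with h | h
      · exact ⟨u, v, ⟨hu, hqK⟩, ⟨hv, hvK⟩, h⟩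
      · exact ⟨v, u, ⟨hv, hvK⟩, ⟨hu, hqK⟩, h⟩
    obtain ⟨b, ⟨hbF, hab⟩, hbmin⟩ := Set.exists_min_image (F ∩ Ioi a) id
      (hF.subset inter_subset_left) ⟨b', hb', hab'⟩
    have hne' : γ i a ≠ γ i b := fun h => hab.ne ((hγ i).2 ha.1 hbF.1 h)
    refine hcirc (exists_homeomorph_sphere_of_arcs (harc _ ha.2 _ hbF.2 hne')
      (joinedByArcIn_image_of_lt (hγ i).1 (hγ i).2 ha.1.1 hab hbF.1.2) ?_)
    rintro _ ⟨hwK, w, hw, rfl⟩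
    rcases hw.1.eq_or_lt with rfl | hwa
    · simp
    · have hbw : b ≤ w :=
        hbmin w ⟨⟨⟨ha.1.1.trans hw.1, hw.2.trans hbF.1.2⟩, hwK⟩, hwa⟩
      simp [le_antisymm hw.2 hbw]
  have hins : ⋃ j ∈ insert i s, γ j '' Icc 0 1 = K ∪ γ i '' Icc 0 1 := by
    rw [Finset.set_biUnion_insert, union_comm]
  have hPi : P (insert i s) := by
    refine ⟨?_, Finset.insert_nonempty _ _, ?_⟩
    · rw [hins]
      exact hglue _ _ q (hclosed s) (isCompact_Icc.image_of_continuousOn (hγ i).1).isClosed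
        hsingle hgood (arc_induction hloc hglue (hγ i).1 (hγ i).2)
    · rw [hins]
      have hcross : ∀ x ∈ K, ∀ y ∈ γ i '' Icc 0 1, x ≠ y →
          JoinedByArcIn (K ∪ γ i '' Icc 0 1) x y := by
        intro x hx y hy hxy
        by_cases hxq : x = q
        · subst hxq
          exact (joinedByArcIn_image (hγ i).1 (hγ i).2 hqi hy hxy).mono subset_union_right
        by_cases hyq : q = y
        · subst hyq
          exact (harc _ hx _ hqK hxy).mono subset_union_left
        · exact (harc _ hx _ hqK hxq).trans
            (joinedByArcIn_image (hγ i).1 (hγ i).2 hqi hy hyq) hsingle.subset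
      rintro x (hx | hx) y (hy | hy) hxy
      · exact (harc _ hx _ hy hxy).mono subset_union_left
      · exact hcross x hx y hy hxy
      · exact (hcross y hy x hx hxy.symm).symm
      · exact (joinedByArcIn_image (hγ i).1 (hγ i).2 hx hy hxy).mono subset_union_right
  exact his (hmax hPi (Finset.subset_insert i s) (Finset.mem_insert_self i s))

end TreeInduction

/-- Every closed off-diagonal subset of `D × D` is kept off the diagonal, locally uniformly, by
some continuous map of `D` into a tree. -/
def SeparatedByTrees (D : Type*) [TopologicalSpace D] : Prop :=
  ∀ R : Set (D × D), IsClosed R → (∀ x, (x, x) ∉ R) →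
    ∃ (T : Type) (_ : MetricSpace T), IsTree T ∧ ∃ g : D → T, Continuous g ∧
      ∀ t, ∃ O ∈ 𝓝 t, ∀ x y, (x, y) ∈ R → g x ∈ O → g y ∉ O

theorem Treelike.separatedByTrees {X D : Type*} [MetricSpace X] [CompactSpace X]
    [TopologicalSpace D] [CompactSpace D] (hX : Treelike X) {ι : D → X} (hι : Continuous ι)
    (hinj : Function.Injective ι) : SeparatedByTrees D := by
  intro R hR hdiag
  obtain ⟨ε, hε, hRε⟩ : ∃ ε > 0, ∀ q ∈ R, ε ≤ dist (ι q.1) (ι q.2) := by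
    rcases R.eq_empty_or_nonempty with rfl | hne
    · exact ⟨1, one_pos, by simp⟩
    obtain ⟨q, hq, hmin⟩ := hR.isCompact.exists_isMinOn hne
      (f := fun q => dist (ι q.1) (ι q.2)) (by fun_prop)
    refine ⟨dist (ι q.1) (ι q.2), dist_pos.2 fun h => hdiag q.1 ?_, fun q' hq' => hmin hq'⟩
    have : q.1 = q.2 := hinj h
    rwa [show (q.1, q.1) = q from Prod.ext rfl this]
  obtain ⟨T, _, hT, g, hg, -, hgε⟩ := hX ε hε
  have hgι : Continuous fun q : D × D => (g (ι q.1), g (ι q.2)) := by fun_prop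
  refine ⟨T, inferInstance, hT, g ∘ ι, hg.comp hι, fun t => ?_⟩
  have hclosed := (hR.isCompact.image hgι).isClosed
  have hmem : (t, t) ∉ (fun q : D × D => (g (ι q.1), g (ι q.2))) '' R := by
    rintro ⟨q, hq, hqt⟩
    rw [Prod.mk.injEq] at hqt
    exact ((dist_le_diam_of_mem isBounded_of_compactSpace (s := g ⁻¹' {t}) hqt.1
      hqt.2).trans_lt (hgε t)).not_ge (hRε q hq)
  obtain ⟨U, hU, V, hV, hUV⟩ := mem_nhds_prod_iff.1 (hclosed.isOpen_compl.mem_nhds hmem)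
  exact ⟨U ∩ V, Filter.inter_mem hU hV, fun x y hxy hx hy =>
    hUV ⟨hx.1, hy.2⟩ ⟨(x, y), hxy, rfl⟩⟩

section Lifting

open Real

variable {D : Type*} [TopologicalSpace D]

theorem continuousOn_ite_of_isClosed {E : Type*} [TopologicalSpace E] {A B : Set D}
    (hA : IsClosed A) (hB : IsClosed B) {u v : D → E} [∀ x, Decidable (x ∈ A)]
    (hu : ContinuousOn u A) (hv : ContinuousOn v B) (h : ∀ x ∈ A, x ∈ B → u x = v x) :
    ContinuousOn (fun x => if x ∈ A then u x else v x) (A ∪ B) := by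
  refine ContinuousOn.union_of_isClosed (hu.congr fun x hx => by simp [hx])
    (hv.congr fun x hx => ?_) hA hB
  by_cases hxA : x ∈ A
  · simp [hxA, h x hxA hx]
  · simp [hxA]

theorem continuousAt_angle_toReal {x : Angle} (hx : x ≠ π) : ContinuousAt Angle.toReal x := by
  have : Fact (0 < 2 * π) := ⟨two_pi_pos⟩
  have hx' : x ≠ ((-π : ℝ) : Angle) := by rwa [Angle.coe_neg, Angle.neg_coe_pi]
  have h := continuousAt_subtype_val.comp (AddCircle.continuousAt_equivIoc (2 * π) (-π) hx')
  refine h.congr (Filter.Eventually.of_forall fun y => ?_)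
  induction y using Angle.induction_on
  rfl

/-- On a closed subset of a space separated by trees, angle-valued maps lift to real-valued
ones. -/
theorem SeparatedByTrees.exists_lift [CompactSpace D] [T2Space D] (hD : SeparatedByTrees D)
    {S : Set D} (hS : IsClosed S) {θ : D → Angle} (hθ : ContinuousOn θ S) :
    ∃ φ : D → ℝ, Continuous φ ∧ ∀ x ∈ S, (φ x : Angle) = θ x := by
  classical
  suffices h : ∃ φ : D → ℝ, ContinuousOn φ S ∧ ∀ x ∈ S, (φ x : Angle) = θ x by
    obtain ⟨φ, hφ, hφθ⟩ := h
    obtain ⟨ψ, hψ⟩ := ContinuousMap.exists_restrict_eq hS ⟨S.domRestrict φ, hφ.domRestrict⟩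
    refine ⟨ψ, ψ.continuous, fun x hx => ?_⟩
    rw [← hφθ x hx]
    exact congrArg _ (DFunLike.congr_fun hψ ⟨x, hx⟩)
  have hR : IsClosed ((S ×ˢ S) ∩ {q : D × D | (θ q.1 - θ q.2).cos ≤ 0}) := by
    refine ContinuousOn.preimage_isClosed_of_isClosed (t := Iic 0)
      (f := fun q : D × D => (θ q.1 - θ q.2).cos) ?_ (hS.prod hS) isClosed_Iic
    refine Angle.continuous_cos.comp_continuousOn ?_
    exact (hθ.comp continuousOn_fst fun q hq => hq.1).sub
      (hθ.comp continuousOn_snd fun q hq => hq.2)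
  obtain ⟨T, _, hT, g, hg, hsep⟩ := hD _ hR (by simp)
  have hclosed : ∀ {C : Set T}, IsClosed C → IsClosed (S ∩ g ⁻¹' C) := fun hC =>
    hS.inter (hC.preimage hg)
  have hlift := hT.induction
    (good := fun C => ∃ φ : D → ℝ, ContinuousOn φ (S ∩ g ⁻¹' C) ∧
      (∀ x ∈ S ∩ g ⁻¹' C, (φ x : Angle) = θ x) ∧
      ∀ x ∈ S ∩ g ⁻¹' C, ∀ y ∈ S ∩ g ⁻¹' C, g x = g y → |φ x - φ y| < π) ?_ ?_
  · obtain ⟨φ, hφ, hφθ, -⟩ := hlift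
    exact ⟨φ, by simpa using hφ, by simpa using hφθ⟩
  · intro t
    obtain ⟨O, hO, hOR⟩ := hsep t
    refine ⟨O, hO, fun C hCO _ => ?_⟩
    rcases (S ∩ g ⁻¹' C).eq_empty_or_nonempty with he | ⟨x₀, hx₀⟩
    · exact ⟨0, by simp [he]⟩
    have hcos : ∀ x ∈ S ∩ g ⁻¹' C, |(θ x - θ x₀).toReal| < π / 2 := by
      intro x hx
      rw [← Angle.cos_pos_iff_abs_toReal_lt_pi_div_two]
      by_contra hneg
      exact hOR x x₀ ⟨⟨hx.1, hx₀.1⟩, not_lt.1 hneg⟩ (hCO hx.2) (hCO hx₀.2)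
    refine ⟨fun x => (θ x₀).toReal + (θ x - θ x₀).toReal, ?_, fun x hx => by simp, ?_⟩
    · refine continuousOn_const.add fun x hx => ?_
      have hne : θ x - θ x₀ ≠ π := by
        intro h
        have := hcos x hx
        rw [h, Angle.toReal_pi, abs_of_pos pi_pos] at this
        linarith [pi_pos]
      exact ContinuousAt.comp_continuousWithinAt (f := fun y => θ y - θ x₀)
        (continuousAt_angle_toReal hne)
        (((hθ.mono inter_subset_left) x hx).sub continuousWithinAt_const)
    · intro x hx y hy _
      have h1 := abs_lt.1 (hcos x hx)
      have h2 := abs_lt.1 (hcos y hy)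
      rw [abs_lt]
      constructor <;> linarith
  · rintro C₁ C₂ p hC₁ hC₂ hp ⟨φ₁, hφ₁, hφθ₁, hπ₁⟩ ⟨φ₂, hφ₂, hφθ₂, hπ₂⟩
    have hp₁ : p ∈ C₁ := (hp.ge rfl).1
    have hp₂ : p ∈ C₂ := (hp.ge rfl).2
    obtain ⟨c, hc, hcp⟩ : ∃ c : ℝ, (c : Angle) = 0 ∧
        ∀ x ∈ S, g x = p → φ₁ x = φ₂ x + c := by
      by_cases hz : ∃ z ∈ S, g z = p
      · obtain ⟨z, hzS, hz⟩ := hz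
        have hz₁ : z ∈ S ∩ g ⁻¹' C₁ := ⟨hzS, by simpa [hz]⟩
        have hz₂ : z ∈ S ∩ g ⁻¹' C₂ := ⟨hzS, by simpa [hz]⟩
        refine ⟨φ₁ z - φ₂ z, by simp [hφθ₁ z hz₁, hφθ₂ z hz₂], fun x hxS hx => ?_⟩
        have hx₁ : x ∈ S ∩ g ⁻¹' C₁ := ⟨hxS, by simpa [hx]⟩
        have hx₂ : x ∈ S ∩ g ⁻¹' C₂ := ⟨hxS, by simpa [hx]⟩
        have hang : ((φ₁ x - φ₂ x - (φ₁ z - φ₂ z) : ℝ) : Angle) = (0 : ℝ) := by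
          simp [hφθ₁ z hz₁, hφθ₂ z hz₂, hφθ₁ x hx₁, hφθ₂ x hx₂]
        obtain ⟨k, hk⟩ := Angle.angle_eq_iff_two_pi_dvd_sub.1 hang
        have h1 := abs_lt.1 (hπ₁ x hx₁ z hz₁ (hx.trans hz.symm))
        have h2 := abs_lt.1 (hπ₂ x hx₂ z hz₂ (hx.trans hz.symm))
        have hk1 : (k : ℝ) < 1 := by nlinarith [pi_pos]
        have hk2 : (-1 : ℝ) < k := by nlinarith [pi_pos]
        have hk0 : k = 0 := by
          have h3 : k < 1 := by exact_mod_cast hk1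
          have h4 : -1 < k := by exact_mod_cast hk2
          omega
        rw [hk0] at hk
        push_cast at hk
        linarith
      · exact ⟨0, by simp, fun x hxS hx => absurd ⟨x, hxS, hx⟩ hz⟩
    have hov : ∀ x ∈ S ∩ g ⁻¹' C₁, x ∈ S ∩ g ⁻¹' C₂ → φ₁ x = φ₂ x + c := fun x hx₁ hx₂ =>
      hcp x hx₁.1 (hp.le ⟨hx₁.2, hx₂.2⟩)
    have hun : S ∩ g ⁻¹' (C₁ ∪ C₂) = (S ∩ g ⁻¹' C₁) ∪ (S ∩ g ⁻¹' C₂) := by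
      rw [preimage_union, inter_union_distrib_left]
    have heq₁ : ∀ x ∈ S ∩ g ⁻¹' C₁, (if x ∈ S ∩ g ⁻¹' C₁ then φ₁ x else φ₂ x + c) = φ₁ x :=
      fun x hx => if_pos hx
    have heq₂ : ∀ x ∈ S ∩ g ⁻¹' C₂,
        (if x ∈ S ∩ g ⁻¹' C₁ then φ₁ x else φ₂ x + c) = φ₂ x + c := by
      intro x hx
      split_ifs with h
      · exact hov x h hx
      · rfl
    refine ⟨fun x => if x ∈ S ∩ g ⁻¹' C₁ then φ₁ x else φ₂ x + c, ?_, ?_, ?_⟩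
    · rw [hun]
      exact continuousOn_ite_of_isClosed (hclosed hC₁) (hclosed hC₂) hφ₁
        (hφ₂.add continuousOn_const) hov
    · rw [hun]
      rintro x (hx | hx)
      · exact (congrArg _ (heq₁ x hx)).trans (hφθ₁ x hx)
      · refine (congrArg _ (heq₂ x hx)).trans ?_
        rw [Angle.coe_add, hc, add_zero, hφθ₂ x hx]
    · rw [hun]
      intro x hx y hy hxy
      by_cases hxC : g x ∈ C₁
      · have hx' : x ∈ S ∩ g ⁻¹' C₁ := ⟨hx.elim And.left And.left, hxC⟩
        have hy' : y ∈ S ∩ g ⁻¹' C₁ := ⟨hy.elim And.left And.left, show g y ∈ C₁ from hxy ▸ hxC⟩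
        simpa only [heq₁ x hx', heq₁ y hy'] using hπ₁ x hx' y hy' hxy
      · have hx' : x ∈ S ∩ g ⁻¹' C₂ := hx.resolve_left fun h => hxC h.2
        have hy' : y ∈ S ∩ g ⁻¹' C₂ := hy.resolve_left fun h => hxC (show g x ∈ C₁ from hxy ▸ h.2)
        simpa only [heq₂ x hx', heq₂ y hy', add_sub_add_right_eq_sub] using hπ₂ x hx' y hy' hxy

/-- A fixed-point-free involution of a compact space separated by trees is a trivial double
cover. -/
theorem SeparatedByTrees.exists_isClopen [CompactSpace D] [T2Space D] (hD : SeparatedByTrees D)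
    {σ : D → D} (hσ : Continuous σ) (hσσ : ∀ x, σ (σ x) = x) (hfix : ∀ x, σ x ≠ x) :
    ∃ A : Set D, IsClopen A ∧ ∀ x, x ∈ A ↔ σ x ∉ A := by
  classical
  suffices hodd : ∃ θ : D → Angle, Continuous θ ∧ ∀ x, θ (σ x) = θ x + π by
    obtain ⟨θ, hθ, hθσ⟩ := hodd
    obtain ⟨φ, hφ, hφθ⟩ := hD.exists_lift isClosed_univ hθ.continuousOn
    have hne : ∀ x, φ x ≠ φ (σ x) := by
      intro x hx
      have h := hθσ x
      rw [← hφθ _ (mem_univ (σ x)), ← hx, hφθ _ (mem_univ x), left_eq_add] at h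
      exact Angle.pi_ne_zero h
    refine ⟨{x | φ x < φ (σ x)}, ⟨?_, isOpen_lt hφ (hφ.comp hσ)⟩, fun x => ?_⟩
    · have : {x | φ x < φ (σ x)} = {x | φ x ≤ φ (σ x)} :=
        Set.ext fun x => (hne x).le_iff_lt.symm
      rw [this]
      exact isClosed_le hφ (hφ.comp hσ)
    · simp only [mem_ofPred_eq, hσσ, not_lt]
      exact ⟨le_of_lt, fun h => lt_of_le_of_ne h (hne x)⟩
  obtain ⟨T, _, hT, g, hg, hsep⟩ := hD {q | q.2 = σ q.1}
    (isClosed_eq continuous_snd (hσ.comp continuous_fst)) fun x hx => hfix x (Eq.symm hx)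
  have hgσ : ∀ x, g x ≠ g (σ x) := by
    intro x hx
    obtain ⟨O, hO, hOx⟩ := hsep (g x)
    exact hOx x (σ x) rfl (mem_of_mem_nhds hO) (hx ▸ mem_of_mem_nhds hO)
  have hpi : ∀ a : Angle, a + π + π = a := fun a => by
    rw [add_assoc, Angle.coe_pi_add_coe_pi, add_zero]
  have hpre : ∀ {C C' : Set T}, IsClosed C → IsClosed C' →
      IsClosed {x | g x ∈ C ∧ g (σ x) ∈ C'} := fun hC hC' =>
    (hC.preimage hg).inter (hC'.preimage (hg.comp hσ))
  have hodd := hT.induction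
    (good := fun C => ∃ θ : D → Angle, ContinuousOn θ {x | g x ∈ C ∧ g (σ x) ∈ C} ∧
      ∀ x, g x ∈ C → g (σ x) ∈ C → θ (σ x) = θ x + π) ?_ ?_
  · obtain ⟨θ, hθ, hθσ⟩ := hodd
    exact ⟨θ, by simpa using hθ, by simpa using hθσ⟩
  · intro t
    obtain ⟨O, hO, hOx⟩ := hsep t
    refine ⟨O, hO, fun C hC _ => ⟨0, continuousOn_const, fun x hx hx' => ?_⟩⟩
    exact absurd (hC hx') (hOx x (σ x) rfl (hC hx))
  rintro C₁ C₂ p hC₁ hC₂ hp ⟨θ₁, hθ₁, hθσ₁⟩ ⟨θ₂, hθ₂, hθσ₂⟩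
  have heq : ∀ {x}, g x ∈ C₁ → g x ∈ C₂ → g x = p := fun h₁ h₂ => hp.le ⟨h₁, h₂⟩
  set E₁ := {x | g x ∈ C₁ ∧ g (σ x) ∈ C₁} with hE₁
  set E₂ := {x | g x ∈ C₂ ∧ g (σ x) ∈ C₂} with hE₂
  have hdisj : ∀ x ∈ E₁, x ∉ E₂ := fun x h₁ h₂ =>
    hgσ x ((heq h₁.1 h₂.1).trans (heq h₁.2 h₂.2).symm)
  have hσE₁ : ∀ {x}, σ x ∈ E₁ ↔ x ∈ E₁ := by
    intro x
    simp only [hE₁, mem_ofPred_eq, hσσ]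
    exact and_comm
  have hσE₂ : ∀ {x}, σ x ∈ E₂ ↔ x ∈ E₂ := by
    intro x
    simp only [hE₂, mem_ofPred_eq, hσσ]
    exact and_comm
  have hE₁c : IsClosed E₁ := hpre hC₁ hC₁
  have hE₂c : IsClosed E₂ := hpre hC₂ hC₂
  obtain ⟨θ, hθ, hθσ⟩ : ∃ θ : D → Angle, ContinuousOn θ (E₁ ∪ E₂) ∧
      ∀ x ∈ E₁ ∪ E₂, θ (σ x) = θ x + π := by
    refine ⟨fun x => if x ∈ E₁ then θ₁ x else θ₂ x, continuousOn_ite_of_isClosed hE₁c hE₂c hθ₁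
      hθ₂ fun x h₁ h₂ => absurd h₂ (hdisj x h₁), fun x hx => ?_⟩
    by_cases h : x ∈ E₁
    · simp only [hσE₁, h, if_true]
      exact hθσ₁ x h.1 h.2
    · have h₂ := hx.resolve_left h
      simp only [hσE₁, h, if_false]
      exact hθσ₂ x h₂.1 h₂.2
  have hEc : IsClosed (E₁ ∪ E₂) := hE₁c.union hE₂c
  have hσE : ∀ {x}, σ x ∈ E₁ ∪ E₂ ↔ x ∈ E₁ ∪ E₂ := or_congr hσE₁ hσE₂
  generalize hE : E₁ ∪ E₂ = E at hθ hθσ hEc hσE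
  set M := {x | g x ∈ C₁ ∧ g (σ x) ∈ C₂} with hM
  set N := {x | g x ∈ C₂ ∧ g (σ x) ∈ C₁} with hN
  have hMc : IsClosed M := hpre hC₁ hC₂
  have hNc : IsClosed N := hpre hC₂ hC₁
  have hMN : ∀ x ∈ M, x ∉ N := fun x h₁ h₂ =>
    hgσ x ((heq h₁.1 h₂.1).trans (heq h₂.2 h₁.2).symm)
  have hσM : ∀ {x}, σ x ∈ M ↔ x ∈ N := by
    intro x
    simp only [hM, hN, mem_ofPred_eq, hσσ]
    exact and_comm
  have hσN : ∀ {x}, σ x ∈ N ↔ x ∈ M := fun {x} => by rw [← hσM, hσσ]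
  obtain ⟨φ, hφ, hφθ⟩ := hD.exists_lift (hMc.inter hEc) (hθ.mono inter_subset_right)
  have hcover : {x | g x ∈ C₁ ∪ C₂ ∧ g (σ x) ∈ C₁ ∪ C₂} = E ∪ (M ∪ N) := by
    ext x
    simp only [← hE, hE₁, hE₂, hM, hN, mem_union, mem_ofPred_eq]
    tauto
  have hMNcont : ContinuousOn (fun x => if x ∈ M then (φ x : Angle) else φ (σ x) + π)
      (M ∪ N) := by
    refine continuousOn_ite_of_isClosed hMc hNc
      (Angle.continuous_coe.comp hφ).continuousOn ?_ fun x h₁ h₂ => absurd h₂ (hMN x h₁)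
    exact ((Angle.continuous_coe.comp (hφ.comp hσ)).add continuous_const).continuousOn
  refine ⟨fun x => if x ∈ E then θ x else if x ∈ M then (φ x : Angle) else φ (σ x) + π, ?_,
    fun x hx hx' => ?_⟩
  · rw [hcover]
    refine continuousOn_ite_of_isClosed hEc (hMc.union hNc) hθ hMNcont fun x hxE hx => ?_
    by_cases hxM : x ∈ M
    · simp only [hxM, if_true]
      exact (hφθ x ⟨hxM, hxE⟩).symm
    · have hxN := hx.resolve_left hxM
      simp only [hxM, if_false]
      rw [hφθ _ ⟨hσM.2 hxN, hσE.2 hxE⟩, hθσ x hxE, hpi]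
  · have hx'' : x ∈ E ∪ (M ∪ N) := hcover ▸ ⟨hx, hx'⟩
    by_cases hxE : x ∈ E
    · simp only [hσE, hxE, if_true]
      exact hθσ x hxE
    · rcases hx''.resolve_left hxE with hxM | hxN
      · simp [hσE, hxE, hσM, hMN x hxM, hxM, hσσ]
      · have hxM : x ∉ M := fun h => hMN x h hxN
        simp only [hσE, hxE, hσM, hxN, hxM, if_true, if_false, hpi]

end Lifting

section Covers

variable {X Y : Type*} [TopologicalSpace X]

/-- The pairs of distinct points identified by a map. -/
def identifiedPairs (f : X → Y) : Set (X × X) := {q | f q.1 = f q.2 ∧ q.1 ≠ q.2}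

theorem isClosed_identifiedPairs [TopologicalSpace Y] [T2Space Y] {f : X → Y}
    (hf : Continuous f) (hloc : ∀ x : X, ∃ U ∈ 𝓝 x, InjOn f U) :
    IsClosed (identifiedPairs f) := by
  rw [← isOpen_compl_iff, isOpen_iff_mem_nhds]
  intro q hq
  by_cases h : q.1 = q.2
  · obtain ⟨U, hU, hinj⟩ := hloc q.1
    have hUU : U ×ˢ U ∈ 𝓝 q := prod_mem_nhds hU (h ▸ hU)
    exact Filter.mem_of_superset hUU fun z hz hz' => hz'.2 (hinj hz.1 hz.2 hz'.1)
  · have hopen : IsOpen {z : X × X | f z.1 ≠ f z.2} :=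
      isOpen_ne_fun (hf.comp continuous_fst) (hf.comp continuous_snd)
    exact Filter.mem_of_superset (hopen.mem_nhds fun h' => hq ⟨h', h⟩) fun z hz hz' => hz hz'.1

theorem SimpleMap.eq_of_eq_of_ne {X Y : Type*} {f : X → Y} (hf : SimpleMap f) {x y z : X}
    (hxy : f x = f y) (hxz : f x = f z) (hy : x ≠ y) (hz : x ≠ z) : y = z := by
  by_contra hyz
  have hcard := hf (f x) (mem_range_self x)
  have hfin : (f ⁻¹' {f x}).Finite := finite_of_ncard_pos (by omega)
  have hsub : ({x, y, z} : Set X) ⊆ f ⁻¹' {f x} := by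
    rintro w (rfl | rfl | rfl)
    · rfl
    · exact hxy.symm
    · exact hxz.symm
  have h3 : ({x, y, z} : Set X).ncard = 3 := ncard_eq_three.2 ⟨x, y, z, hy, hz, hyz, rfl⟩
  have := ncard_le_ncard hsub hfin
  omega

theorem SimpleMap.hasOneToOneCover {X Y : Type*} [MetricSpace X] [CompactSpace X]
    [TopologicalSpace Y] [T2Space Y] (hX : Treelike X) {f : X → Y} (hf : Continuous f)
    (hsimple : SimpleMap f) (hsl : StrictlyLocallyInjective f) : HasOneToOneCover f := by
  have hclosed := isClosed_identifiedPairs hf hsl.1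
  have : CompactSpace (identifiedPairs f) := isCompact_iff_compactSpace.1 hclosed.isCompact
  let ι : identifiedPairs f → X := fun q => q.1.1
  have hι : Continuous ι := continuous_fst.comp continuous_subtype_val
  have hinj : Function.Injective ι := by
    rintro ⟨⟨x, y⟩, hy⟩ ⟨⟨x', z⟩, hz⟩ (rfl : x = x')
    have : y = z := hsimple.eq_of_eq_of_ne hy.1 hz.1 hy.2 hz.2
    simp [this]
  let σ : identifiedPairs f → identifiedPairs f := fun q =>
    ⟨(q.1.2, q.1.1), q.2.1.symm, q.2.2.symm⟩
  obtain ⟨A, hA, hAσ⟩ := (hX.separatedByTrees hι hinj).exists_isClopen (σ := σ)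
    (by fun_prop) (fun _ => rfl) fun q h => q.2.2 (congrArg ι h).symm
  have hB : ∀ {q : identifiedPairs f}, ι q ∈ ι '' A ↔ q ∈ A := hinj.mem_set_image
  refine ⟨(ι '' A)ᶜ, (hA.1.isCompact.image hι).isClosed.isOpen_compl, ?_, ?_, ?_⟩
  · obtain ⟨x, y, hxy, hne⟩ := Function.not_injective_iff.1 hsl.2
    let q : identifiedPairs f := ⟨(x, y), hxy, hne⟩
    intro huniv
    have hq : ∀ q, q ∉ A := fun q hq =>
      (huniv ▸ mem_univ (ι q) : ι q ∈ (ι '' A)ᶜ) (mem_image_of_mem ι hq)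
    exact hq q ((hAσ q).2 (hq _))
  · intro x hx y hy hxy
    by_contra hne
    let q : identifiedPairs f := ⟨(x, y), hxy, hne⟩
    exact hx ⟨q, (hAσ q).2 fun h => hy ⟨σ q, h, rfl⟩, rfl⟩
  · refine Subset.antisymm (image_subset_range _ _) ?_
    rintro _ ⟨x, rfl⟩
    by_cases hx : x ∈ ι '' A
    · obtain ⟨q, hq, rfl⟩ := hx
      exact ⟨ι (σ q), fun h => (hAσ q).1 hq (hB.1 h), q.2.1.symm⟩
    · exact ⟨x, hx, rfl⟩

/-- The union of `Y × {0}` and a graph over the domain of a 1-to-1 cover `U` of `f` exhibits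
the range of `f` as a 2-to-1 retract. -/
theorem HasOneToOneCover.isMToOneRetract_range {X Y : Type} [MetricSpace X] [CompactSpace X]
    [ConnectedSpace X] [MetricSpace Y] {f : X → Y} (hf : Continuous f)
    (hcover : HasOneToOneCover f) : IsMToOneRetract 2 (range f) := by
  obtain ⟨U, hU, hne, hinj, hrange⟩ := hcover
  let B : Set X := Uᶜ
  have hBc : IsClosed B := hU.isClosed_compl
  have hBne : B.Nonempty := nonempty_compl.2 hne
  let F : X → range f := rangeFactorization f
  have hF : Continuous F := hf.subtype_mk _
  let G : X → range f × ℝ := fun x => (F x, infDist x B)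
  have hG : Continuous G := hF.prodMk (continuous_infDist_pt B)
  let H : X → range f × ℝ := fun x => (F x, 0)
  have hH : Continuous H := hF.prodMk continuous_const
  have hpos : ∀ {x}, x ∉ B → 0 < infDist x B := fun hx =>
    (hBc.notMem_iff_infDist_pos hBne).1 hx
  have hzero : ∀ {x}, x ∈ B → infDist x B = 0 := fun hx => infDist_zero_of_mem hx
  let Z : Set (range f × ℝ) := range H ∪ range G
  have hZ : IsCompact Z := (isCompact_range hH).union (isCompact_range hG)
  have hZconn : IsConnected Z := by
    obtain ⟨b, hb⟩ := hBne
    refine (isConnected_range hH).union ⟨H b, ⟨b, rfl⟩, b, ?_⟩ (isConnected_range hG)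
    simp [G, H, hzero hb]
  have : CompactSpace Z := isCompact_iff_compactSpace.1 hZ
  have : ConnectedSpace Z := isConnected_iff_connectedSpace.1 hZconn
  let e : range f → Z := fun y => ⟨(y, 0), Or.inl <| by
    obtain ⟨x, hx⟩ := y.2
    exact ⟨x, Prod.ext (Subtype.ext hx) rfl⟩⟩
  have he : Continuous e := by fun_prop
  have heinj : Function.Injective e := fun y z h =>
    congrArg (fun w : Z => w.1.1) h
  have : CompactSpace (range f) := isCompact_iff_compactSpace.1 (isCompact_range hf)
  have : ConnectedSpace (range f) := isConnected_iff_connectedSpace.1 (isConnected_range hf)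
  refine ⟨Z, inferInstance, inferInstance, inferInstance, inferInstance, range e,
    ⟨isCompact_range he, isConnected_range he⟩,
    ⟨(he.isClosedEmbedding heinj).isEmbedding.toHomeomorph⟩,
    fun z => e z.1.1, by fun_prop, fun z => mem_range_self _, ?_, ?_⟩
  · rintro _ ⟨y, rfl⟩
    rfl
  · rintro _ ⟨y, rfl⟩
    obtain ⟨u, hu, huy⟩ : y.1 ∈ f '' U := hrange.ge y.2
    have hFu : F u = y := Subtype.ext huy
    let w : Z := ⟨G u, Or.inr ⟨u, rfl⟩⟩
    have hu0 : 0 < infDist u B := hpos (not_not.2 hu)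
    rw [ncard_eq_two]
    refine ⟨e y, w, fun h => ?_, ?_⟩
    · exact hu0.ne (congrArg (fun z : Z => z.1.2) h)
    · ext z
      simp only [mem_ofPred_eq, mem_insert_iff, mem_singleton_iff, heinj.eq_iff]
      constructor
      · intro hz
        obtain ⟨⟨z₁, z₂⟩, ⟨x, hx⟩ | ⟨x, hx⟩⟩ := z
        · left
          obtain ⟨rfl, rfl⟩ := Prod.mk.inj hx
          exact Subtype.ext (Prod.ext hz rfl)
        · obtain ⟨rfl, rfl⟩ := Prod.mk.inj hx
          by_cases hxB : x ∈ B
          · left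
            exact Subtype.ext (Prod.ext hz (hzero hxB))
          · right
            have hfx : f x = f u := (congrArg Subtype.val hz).trans huy.symm
            obtain rfl := hinj (not_not.1 hxB) hu hfx
            rfl
      · rintro (rfl | rfl)
        · rfl
        · exact hFu

end Covers

/-- The image of a simple strictly locally 1-to-1 map defined on a treelike continuum is
a 2-to-1 retract of a continuum. -/
theorem image_of_treelike_simple_strictlyLocallyInjective_is_retract
    (X Y : Type) [MetricSpace X] [CompactSpace X] [ConnectedSpace X] [Nonempty X]
    [MetricSpace Y] (htree : Treelike X)
    (f : X → Y) (hf : Continuous f) (hsimple : SimpleMap f)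
    (hsl : StrictlyLocallyInjective f) :
    IsMToOneRetract 2 ↥(Set.range f) := by
  exact (hsimple.hasOneToOneCover htree hf hsl).isMToOneRetract_range hf
end

section
/- If f is a simple, strictly locally 1-to-1 continuous map defined on a continuum X that is a finite union of subcontinua each of which is either treelike or hereditarily decomposable, then f(X) is a 2-to-1 retract of a continuum. -/
open Set Metric Topology

/-- If `f` restricted to a subcontinuum `K` is bijective onto `f '' K` away from a nonempty closed
subset `F` of `K`, then the image of `f` is a `2`-to-`1` retract: take the union of two
graphs over the image and of the copy of `K` whose height over the image is the distance to `F`. -/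
theorem isMToOneRetract_two_of_injOn_diff {X Z : Type} [MetricSpace X] [CompactSpace X]
    [ConnectedSpace X] [MetricSpace Z] {f : X → Z} (hf : Continuous f)
    (hsurj : Function.Surjective f) {K F : Set X} (hK : IsSubcontinuum K) (hF : IsClosed F)
    (hFne : F.Nonempty) (hFK : F ⊆ K) (hinj : InjOn f (K \ F)) (hcov : f '' K ⊆ f '' (K \ F)) :
    IsMToOneRetract 2 Z := by
  have hZc : CompactSpace Z := hsurj.compactSpace hf
  have hZn : ConnectedSpace Z := hsurj.connectedSpace hf
  set W : Set Z := f '' K with hW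
  have hWc : IsClosed W := (hK.1.image hf).isClosed
  have hWne : W.Nonempty := hK.2.nonempty.image f
  set A : Set (Z × ℝ) := range (fun z => (z, (0 : ℝ))) with hA
  set B : Set (Z × ℝ) := (fun x => (f x, infDist x F)) '' K with hB
  set C : Set (Z × ℝ) := range (fun z => (z, infDist z W)) with hC
  have hAcont : Continuous (fun z : Z => (z, (0 : ℝ))) := by fun_prop
  have hBcont : Continuous (fun x => (f x, infDist x F)) := by fun_prop
  have hCcont : Continuous (fun z => (z, infDist z W)) := by fun_prop
  have hAconn : IsConnected A := isConnected_range hAcont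
  have hBconn : IsConnected B := hK.2.image _ hBcont.continuousOn
  have hCconn : IsConnected C := isConnected_range hCcont
  have hAcomp : IsCompact A := isCompact_range hAcont
  have hcomp : IsCompact (A ∪ B ∪ C) :=
    (hAcomp.union (hK.1.image hBcont)).union (isCompact_range hCcont)
  have hconn : IsConnected (A ∪ B ∪ C) := by
    obtain ⟨x, hx⟩ := hFne
    refine IsConnected.union ⟨(f x, 0), Or.inl ⟨f x, rfl⟩, f x, ?_⟩
      (IsConnected.union ⟨(f x, 0), ⟨f x, rfl⟩, x, hFK hx, ?_⟩ hAconn hBconn) hCconn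
    · simp [infDist_zero_of_mem (show f x ∈ W from ⟨x, hFK hx, rfl⟩)]
    · simp [infDist_zero_of_mem hx]
  have hAS : ∀ z : Z, (z, (0 : ℝ)) ∈ A ∪ B ∪ C := fun z => Or.inl (Or.inl ⟨z, rfl⟩)
  have hc : CompactSpace ↥(A ∪ B ∪ C) := isCompact_iff_compactSpace.mp hcomp
  have hn : ConnectedSpace ↥(A ∪ B ∪ C) := isConnected_iff_connectedSpace.mp hconn
  let ι : Z → ↥(A ∪ B ∪ C) := fun z => ⟨(z, 0), hAS z⟩
  have hι : Continuous ι := hAcont.subtype_mk _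
  have hιinj : Function.Injective ι := fun a b h => by
    have := congrArg (fun p => p.1.1) h
    exact this
  refine ⟨↥(A ∪ B ∪ C), inferInstance, hc, hn, inferInstance, range ι,
    ⟨isCompact_range hι, isConnected_range hι⟩,
    ⟨(hι.isClosedEmbedding hιinj).isEmbedding.toHomeomorph⟩, fun p => ι p.1.1, ?_, ?_, ?_, ?_⟩
  · exact hι.comp (continuous_fst.comp continuous_subtype_val)
  · exact fun p => ⟨_, rfl⟩
  · rintro _ ⟨z, rfl⟩
    rfl
  · rintro _ ⟨z, rfl⟩
    rw [Set.ncard_eq_two]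
    have key : ∃ s : ℝ, s ≠ 0 ∧ ∀ t : ℝ, (z, t) ∈ A ∪ B ∪ C ↔ t = 0 ∨ t = s := by
      by_cases hz : z ∈ W
      · obtain ⟨x, ⟨hxK, hxF⟩, hxz⟩ := hcov hz
        refine ⟨infDist x F, ((hF.notMem_iff_infDist_pos hFne).mp hxF).ne', fun t => ⟨?_, ?_⟩⟩
        · rintro ((⟨z', hz'⟩ | ⟨x', hx', hz'⟩) | ⟨z', hz'⟩)
          · exact Or.inl (congrArg Prod.snd hz').symm
          · obtain ⟨h1, rfl⟩ := Prod.mk.inj hz'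
            by_cases hx'F : x' ∈ F
            · exact Or.inl (infDist_zero_of_mem hx'F)
            · rw [hinj ⟨hx', hx'F⟩ ⟨hxK, hxF⟩ (h1.trans hxz.symm)]
              exact Or.inr rfl
          · obtain ⟨rfl, rfl⟩ := Prod.mk.inj hz'
            exact Or.inl (infDist_zero_of_mem hz)
        · rintro (rfl | rfl)
          · exact hAS z
          · exact Or.inl (Or.inr ⟨x, hxK, Prod.ext hxz rfl⟩)
      · refine ⟨infDist z W, ((hWc.notMem_iff_infDist_pos hWne).mp hz).ne', fun t => ⟨?_, ?_⟩⟩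
        · rintro ((⟨z', hz'⟩ | ⟨x', hx', hz'⟩) | ⟨z', hz'⟩)
          · exact Or.inl (congrArg Prod.snd hz').symm
          · exact absurd ⟨x', hx', congrArg Prod.fst hz'⟩ hz
          · obtain ⟨rfl, rfl⟩ := Prod.mk.inj hz'
            exact Or.inr rfl
        · rintro (rfl | rfl)
          · exact hAS z
          · exact Or.inr ⟨z, rfl⟩
    obtain ⟨s, hs, hst⟩ := key
    refine ⟨ι z, ⟨(z, s), (hst s).2 (Or.inr rfl)⟩, fun h => hs ?_, ?_⟩
    · exact (congrArg (fun p => p.1.2) h).symm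
    · ext ⟨⟨w, t⟩, hp⟩
      simp only [mem_ofPred_eq, hιinj.eq_iff, mem_insert_iff, mem_singleton_iff, ι,
        Subtype.mk.injEq, Prod.mk.injEq]
      constructor
      · rintro ⟨rfl, -⟩
        rcases (hst t).1 hp with h | h <;> simp [h]
      · rintro (h | h) <;> simp [h.1]

/-- The set of pairs of distinct points identified by a locally injective map is closed. -/
theorem isClosed_setOf_identified {X Z : Type*} [TopologicalSpace X] [TopologicalSpace Z]
    [T2Space Z] {f : X → Z} (hf : Continuous f) (hloc : ∀ x, ∃ U ∈ 𝓝 x, InjOn f U) :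
    IsClosed {p : X × X | f p.1 = f p.2 ∧ p.1 ≠ p.2} := by
  have hE : IsClosed {p : X × X | f p.1 = f p.2} :=
    isClosed_eq (hf.comp continuous_fst) (hf.comp continuous_snd)
  rw [← isOpen_compl_iff, isOpen_iff_mem_nhds]
  rintro ⟨x, y⟩ hxy
  by_cases h : f x = f y
  · have hxy' : x = y := by
      by_contra hne
      exact hxy ⟨h, hne⟩
    subst hxy'
    obtain ⟨U, hU, hinj⟩ := hloc x
    filter_upwards [prod_mem_nhds hU hU] with p hp hp'
    exact hp'.2 (hinj hp.1 hp.2 hp'.1)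
  · filter_upwards [hE.isOpen_compl.mem_nhds h] with p hp hp'
    exact hp hp'.1

/-- A subcontinuum that is a union of two closed sets on each of which `f` is injective, while `f`
is not injective on it, makes the image of `f` a `2`-to-`1` retract. -/
theorem isMToOneRetract_two_of_union {X Z : Type} [MetricSpace X] [CompactSpace X]
    [ConnectedSpace X] [MetricSpace Z] {f : X → Z} (hf : Continuous f)
    (hsurj : Function.Surjective f) (hloc : ∀ x, ∃ U ∈ 𝓝 x, InjOn f U) {A B : Set X}
    (hA : IsClosed A) (hB : IsClosed B) (hAB : IsConnected (A ∪ B)) (hfA : InjOn f A)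
    (hfB : InjOn f B) (hnot : ¬ InjOn f (A ∪ B)) : IsMToOneRetract 2 Z := by
  have hFc : IsClosed (Prod.fst '' ({p : X × X | f p.1 = f p.2 ∧ p.1 ≠ p.2} ∩ A ×ˢ B)) :=
    (((isClosed_setOf_identified hf hloc).inter (hA.prod hB)).isCompact.image
      continuous_fst).isClosed
  have hmem : ∀ x, x ∈ Prod.fst '' ({p : X × X | f p.1 = f p.2 ∧ p.1 ≠ p.2} ∩ A ×ˢ B) ↔
      x ∈ A ∧ ∃ y ∈ B, f x = f y ∧ x ≠ y := by
    intro x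
    constructor
    · rintro ⟨⟨a, b⟩, ⟨h, h'⟩, rfl⟩
      exact ⟨h'.1, b, h'.2, h⟩
    · rintro ⟨hx, y, hy, h⟩
      exact ⟨(x, y), ⟨h, hx, hy⟩, rfl⟩
  generalize Prod.fst '' ({p : X × X | f p.1 = f p.2 ∧ p.1 ≠ p.2} ∩ A ×ˢ B) = F at hFc hmem
  refine isMToOneRetract_two_of_injOn_diff hf hsurj (K := A ∪ B) (F := F)
    ⟨(hA.union hB).isCompact, hAB⟩ hFc ?_ (fun x hx => Or.inl ((hmem x).1 hx).1) ?_ ?_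
  · by_contra hne
    rw [not_nonempty_iff_eq_empty] at hne
    refine hnot ?_
    rintro x (hx | hx) y (hy | hy) hxy
    · exact hfA hx hy hxy
    · by_contra h
      exact (hne ▸ (hmem x).2 ⟨hx, y, hy, hxy, h⟩ : x ∈ (∅ : Set X))
    · by_contra h
      exact (hne ▸ (hmem y).2 ⟨hy, x, hx, hxy.symm, Ne.symm h⟩ : y ∈ (∅ : Set X))
    · exact hfB hx hy hxy
  · rintro x ⟨hx | hx, hxF⟩ y ⟨hy | hy, hyF⟩ hxy
    · exact hfA hx hy hxy
    · by_contra h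
      exact hxF ((hmem x).2 ⟨hx, y, hy, hxy, h⟩)
    · by_contra h
      exact hyF ((hmem y).2 ⟨hy, x, hx, hxy.symm, Ne.symm h⟩)
    · exact hfB hx hy hxy
  · rintro _ ⟨x, hx, rfl⟩
    by_cases hxF : x ∈ F
    · obtain ⟨hxA, y, hy, hxy, hne⟩ := (hmem x).1 hxF
      exact ⟨y, ⟨Or.inr hy, fun hyF => hne (hfA hxA ((hmem y).1 hyF).1 hxy)⟩, hxy.symm⟩
    · exact ⟨x, ⟨hx, hxF⟩, rfl⟩

/-- In a connected space covered by finitely many closed sets, a union of some of the sets can be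
grown one meeting set at a time until it is everything. -/
theorem exists_finset_biUnion_eq_univ {X ι : Type*} [TopologicalSpace X] [PreconnectedSpace X]
    [Finite ι] [DecidableEq ι] {C : ι → Set X} (hC : ∀ i, IsClosed (C i))
    (hne : ∀ i, (C i).Nonempty) (hcover : ⋃ i, C i = univ) {Q : Finset ι → Prop} (i₀ : ι)
    (h0 : Q {i₀})
    (hstep : ∀ s, Q s → ∀ j ∉ s, ((⋃ i ∈ s, C i) ∩ C j).Nonempty → Q (insert j s)) :
    ∃ s, Q s ∧ ⋃ i ∈ s, C i = univ := by
  obtain ⟨s, hs, hmax⟩ := Set.exists_max_image {s | Q s} Finset.card (Set.toFinite _) ⟨_, h0⟩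
  refine ⟨s, hs, ?_⟩
  have hsne : s.Nonempty := Finset.card_pos.mp (by simpa using hmax _ h0)
  by_contra hnot
  obtain ⟨x, hx⟩ := (ne_univ_iff_exists_notMem _).mp hnot
  have hcov : ∀ y, ∃ i, y ∈ C i := fun y => by
    simpa using (hcover ▸ mem_univ y : y ∈ ⋃ i, C i)
  have hx' : x ∈ ⋃ i ∈ (s : Set ι)ᶜ, C i := by
    obtain ⟨i, hi⟩ := hcov x
    exact mem_biUnion (fun his => hx (mem_biUnion his hi)) hi
  obtain ⟨i, hi⟩ := hsne
  obtain ⟨z, hz⟩ := hne i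
  obtain ⟨y, -, hy1, hy2⟩ := isPreconnected_closed_iff.mp (isPreconnected_univ (α := X))
    (⋃ i ∈ s, C i) (⋃ i ∈ (s : Set ι)ᶜ, C i)
    (s.finite_toSet.isClosed_biUnion fun i _ => hC i)
    ((Set.toFinite _).isClosed_biUnion fun i _ => hC i)
    (fun y _ => by
      obtain ⟨i, hi⟩ := hcov y
      by_cases his : i ∈ s
      · exact Or.inl (mem_biUnion his hi)
      · exact Or.inr (mem_biUnion his hi))
    ⟨z, mem_univ z, mem_biUnion hi hz⟩ ⟨x, mem_univ x, hx'⟩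
  obtain ⟨j, hj, hyj⟩ := mem_iUnion₂.mp hy2
  have hle : (insert j s).card ≤ s.card := hmax _ (hstep s hs j hj ⟨y, hy1, hyj⟩)
  rw [Finset.card_insert_of_notMem hj] at hle
  omega

/-- The intersection of a nonempty chain of subcontinua is a subcontinuum. -/
theorem isSubcontinuum_sInter {X : Type*} [TopologicalSpace X] [T2Space X] {c : Set (Set X)}
    (hc : IsChain (· ⊆ ·) c) (hne : c.Nonempty) (h : ∀ K ∈ c, IsSubcontinuum K) :
    IsSubcontinuum (⋂₀ c) := by
  have hdir : DirectedOn (· ⊇ ·) c :=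
    IsChain.directedOn (r := fun K L : Set X => K ⊇ L) hc.symm
  have : Nonempty c := hne.to_subtype
  have hcl : IsClosed (⋂₀ c) := isClosed_sInter fun K hK => (h K hK).1.isClosed
  obtain ⟨K₀, hK₀⟩ := hne
  have hcomp : IsCompact (⋂₀ c) := (h K₀ hK₀).1.of_isClosed_subset hcl (sInter_subset_of_mem hK₀)
  refine ⟨hcomp, IsCompact.nonempty_sInter_of_directed_nonempty_isCompact_isClosed hdir
    (fun K hK => (h K hK).2.nonempty) (fun K hK => (h K hK).1) (fun K hK => (h K hK).1.isClosed),
    ?_⟩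
  rw [isPreconnected_closed_iff]
  rintro A B hA hB hAB ⟨a, ha, haA⟩ ⟨b, hb, hbB⟩
  by_contra hcon
  obtain ⟨U, V, hU, hV, hAU, hBV, hUV⟩ := SeparatedNhds.of_isCompact_isCompact
    (hcomp.inter_right hA) (hcomp.inter_right hB) (by
      rw [Set.disjoint_left]
      exact fun x hx hx' => hcon ⟨x, hx.1, hx.2, hx'.2⟩)
  obtain ⟨⟨K, hK⟩, hKUV⟩ := exists_subset_nhds_of_isCompact (V := fun K : c => (K : Set X))
    hdir.directed_val (fun K => (h K K.2).1) (U := U ∪ V) (by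
      intro x hx
      rw [← sInter_eq_iInter] at hx
      refine (hU.union hV).mem_nhds ?_
      exact (hAB hx).imp (fun h => hAU ⟨hx, h⟩) (fun h => hBV ⟨hx, h⟩))
  obtain ⟨x, -, hxU, hxV⟩ := (h K hK).2.isPreconnected U V hU hV hKUV
    ⟨a, ha K hK, hAU ⟨ha, haA⟩⟩ ⟨b, hb K hK, hBV ⟨hb, hbB⟩⟩
  exact Set.disjoint_left.mp hUV hxU hxV

/-- A locally injective map that is not injective on a compact connected space is not injective on
some subcontinuum that is minimal with this property. -/
theorem exists_minimal_not_injOn {X Z : Type*} [TopologicalSpace X] [T2Space X] [CompactSpace X]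
    [ConnectedSpace X] [TopologicalSpace Z] [T2Space Z] {f : X → Z} (hf : Continuous f)
    (hloc : ∀ x, ∃ U ∈ 𝓝 x, InjOn f U) (hnot : ¬ Function.Injective f) :
    ∃ K, Minimal (fun K => IsSubcontinuum K ∧ ¬ InjOn f K) K := by
  suffices H : ∀ c ⊆ {K | IsSubcontinuum K ∧ ¬ InjOn f K}, IsChain (· ⊆ ·) c → c.Nonempty →
      ∃ K ∈ {K | IsSubcontinuum K ∧ ¬ InjOn f K}, ∀ s ∈ c, K ⊆ s by
    obtain ⟨K, -, hK⟩ := zorn_superset_nonempty _ H univ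
      ⟨⟨isCompact_univ, isConnected_univ⟩, by rwa [injOn_univ]⟩
    exact ⟨K, hK⟩
  intro c hcS hc hne
  refine ⟨⋂₀ c, ⟨isSubcontinuum_sInter hc hne fun K hK => (hcS hK).1, ?_⟩,
    fun s hs => sInter_subset_of_mem hs⟩
  have : Nonempty c := hne.to_subtype
  have hN := (isClosed_setOf_identified hf hloc).isCompact
  have hcpt : ∀ K : c,
      IsCompact ({p : X × X | f p.1 = f p.2 ∧ p.1 ≠ p.2} ∩ (K : Set X) ×ˢ (K : Set X)) :=
    fun K => hN.inter ((hcS K.2).1.1.prod (hcS K.2).1.1)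
  have hdir : DirectedOn (· ⊇ ·) c :=
    IsChain.directedOn (r := fun K L : Set X => K ⊇ L) hc.symm
  obtain ⟨p, hp⟩ := IsCompact.nonempty_iInter_of_directed_nonempty_isCompact_isClosed
    (fun K : c => {p : X × X | f p.1 = f p.2 ∧ p.1 ≠ p.2} ∩ (K : Set X) ×ˢ (K : Set X))
    (fun K L => by
      obtain ⟨M, hKM, hLM⟩ := hdir.directed_val K L
      exact ⟨M, inter_subset_inter_right _ (prod_mono hKM hKM),
        inter_subset_inter_right _ (prod_mono hLM hLM)⟩)
    (fun K => by
      have := (hcS K.2).2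
      simp only [InjOn, not_forall] at this
      obtain ⟨x, hx, y, hy, hxy, h⟩ := this
      exact ⟨(x, y), ⟨hxy, h⟩, hx, hy⟩) hcpt (fun K => (hcpt K).isClosed)
  rw [mem_iInter] at hp
  intro hinj
  obtain ⟨K₀⟩ := this
  exact (hp K₀).1.2 (hinj (fun K hK => (hp ⟨K, hK⟩).2.1) (fun K hK => (hp ⟨K, hK⟩).2.2)
    (hp K₀).1.1)

/-- On a hereditarily decomposable continuum, a locally injective map that is not injective fails
to be injective on a union of two subcontinua on each of which it is injective. -/
theorem HereditarilyDecomposable.exists_union_not_injOn {X Z : Type*} [TopologicalSpace X]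
    [T2Space X] [CompactSpace X] [ConnectedSpace X] [TopologicalSpace Z] [T2Space Z] {f : X → Z}
    (hX : HereditarilyDecomposable X) (hf : Continuous f)
    (hloc : ∀ x, ∃ U ∈ 𝓝 x, InjOn f U) (hnot : ¬ Function.Injective f) :
    ∃ A B : Set X, IsClosed A ∧ IsClosed B ∧ IsConnected (A ∪ B) ∧ InjOn f A ∧ InjOn f B ∧
      ¬ InjOn f (A ∪ B) := by
  obtain ⟨K, hK⟩ := exists_minimal_not_injOn hf hloc hnot
  have hKnt : K.Nontrivial := by
    by_contra h
    exact hK.prop.2 ((not_nontrivial_iff.mp h).injOn f)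
  obtain ⟨A, B, hA, hB, hAK, hBK, hA', hB', rfl⟩ := hX K hK.prop.1 hKnt
  refine ⟨A, B, hA.1.isClosed, hB.1.isClosed, hK.prop.1.2, ?_, ?_, hK.prop.2⟩
  · by_contra h
    exact hA' (hAK.antisymm (hK.le_of_le ⟨hA, h⟩ hAK))
  · by_contra h
    exact hB' (hBK.antisymm (hK.le_of_le ⟨hB, h⟩ hBK))

/-- A continuous involution of a compact space that maps no point into its own connected component
exchanges a clopen set with its complement. -/
theorem exists_isClopen_of_involution {D : Type*} [TopologicalSpace D] [CompactSpace D] [T2Space D]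
    {σ : D → D} (hσ : Continuous σ) (hinv : Function.Involutive σ)
    (hcomp : ∀ x, σ x ∉ connectedComponent x) :
    ∃ F : Set D, IsClopen F ∧ ∀ x, σ x ∈ F ↔ x ∉ F := by
  have hloc : ∀ x, ∃ W : Set D, IsClopen W ∧ x ∈ W ∧ ∀ y ∈ W, σ y ∉ W := by
    intro x
    have h := hcomp x
    rw [connectedComponent_eq_iInter_isClopen, mem_iInter] at h
    push Not at h
    obtain ⟨⟨V, hV, hxV⟩, hσV⟩ := h
    exact ⟨V ∩ σ ⁻¹' Vᶜ, hV.inter (hV.compl.preimage hσ), ⟨hxV, hσV⟩, fun y hy hy' => hy.2 hy'.1⟩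
  choose W hW hxW hσW using hloc
  obtain ⟨t, ht⟩ := isCompact_univ.elim_finite_subcover W (fun x => (hW x).isOpen)
    (fun x _ => mem_iUnion.mpr ⟨x, hxW x⟩)
  have key : ∀ s : Finset D, ∃ F : Set D, IsClopen F ∧ (∀ x ∈ F, σ x ∉ F) ∧
      ∀ i ∈ s, ∀ x ∈ W i, x ∈ F ∨ σ x ∈ F := by
    classical
    intro s
    induction s using Finset.induction_on with
    | empty => exact ⟨∅, isClopen_empty, by simp, by simp⟩
    | insert i s _ ih =>
      obtain ⟨F, hF, hdisj, hcov⟩ := ih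
      refine ⟨F ∪ (W i \ (F ∪ σ ⁻¹' F)), hF.union ((hW i).diff (hF.union (hF.preimage hσ))),
        ?_, ?_⟩
      · rintro x (hx | ⟨hx, hx'⟩) (h | ⟨h, h'⟩)
        · exact hdisj x hx h
        · exact h' (Or.inr (by rwa [mem_preimage, hinv x]))
        · exact hx' (Or.inr h)
        · exact hσW i x hx h
      · intro j hj x hx
        rcases Finset.mem_insert.mp hj with rfl | hj
        · by_cases h : x ∈ F ∪ σ ⁻¹' F
          · exact h.imp Or.inl Or.inl
          · exact Or.inl (Or.inr ⟨hx, h⟩)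
        · exact (hcov j hj x hx).imp Or.inl Or.inl
  obtain ⟨F, hF, hdisj, hcov⟩ := key t
  refine ⟨F, hF, fun x => ⟨fun h h' => hdisj x h' h, fun h => ?_⟩⟩
  obtain ⟨i, hi, hxi⟩ := mem_iUnion₂.mp (ht (mem_univ x))
  exact (hcov i hi x hxi).resolve_left h

/-- `γ` parametrizes an arc by the unit interval. -/
def IsArcParam {T : Type*} [TopologicalSpace T] (γ : ℝ → T) : Prop :=
  ContinuousOn γ (Icc 0 1) ∧ InjOn γ (Icc 0 1)

theorem lineMap_mem_uIcc (a b : ℝ) {t : ℝ} (ht : t ∈ Icc (0 : ℝ) 1) :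
    AffineMap.lineMap a b t ∈ uIcc a b := by
  rw [← segment_eq_uIcc, segment_eq_image_lineMap]
  exact mem_image_of_mem _ ht

theorem IsArcParam.comp_lineMap {T : Type*} [TopologicalSpace T] {γ : ℝ → T} (hγ : IsArcParam γ)
    {a b : ℝ} (ha : a ∈ Icc (0 : ℝ) 1) (hb : b ∈ Icc (0 : ℝ) 1) (hab : a ≠ b) :
    IsArcParam (γ ∘ AffineMap.lineMap a b) := by
  have hmaps : MapsTo (AffineMap.lineMap a b : ℝ → ℝ) (Icc 0 1) (Icc 0 1) := fun t ht =>
    uIcc_subset_Icc ha hb (lineMap_mem_uIcc a b ht)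
  exact ⟨hγ.1.comp (AffineMap.lineMap_continuous).continuousOn hmaps,
    hγ.2.comp (AffineMap.lineMap_injective ℝ hab).injOn hmaps⟩

/-- Traverse `α` on `[0, 1/2]` and `β` on `[1/2, 1]`. -/
noncomputable def concatParam {T : Type*} (α β : ℝ → T) (t : ℝ) : T :=
  if t ≤ 1 / 2 then α (2 * t) else β (2 * t - 1)

theorem concatParam_continuousOn {T : Type*} [TopologicalSpace T] {α β : ℝ → T}
    (hα : ContinuousOn α (Icc 0 1)) (hβ : ContinuousOn β (Icc 0 1)) (h : α 1 = β 0) :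
    ContinuousOn (concatParam α β) (Icc 0 1) := by
  have h1 : ContinuousOn (concatParam α β) (Icc 0 (1 / 2)) := by
    refine (hα.comp (f := fun t => 2 * t) (by fun_prop) ?_).congr ?_
    · intro t ht
      constructor <;> linarith [ht.1, ht.2]
    · intro t ht
      have := ht.2
      simp_all [concatParam]
  have h2 : ContinuousOn (concatParam α β) (Icc (1 / 2) 1) := by
    refine (hβ.comp (f := fun t => 2 * t - 1) (by fun_prop) ?_).congr ?_
    · intro t ht
      constructor <;> linarith [ht.1, ht.2]
    · intro t ht
      rcases ht.1.eq_or_lt with rfl | hlt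
      · simp [concatParam, h]
      · simp only [concatParam, if_neg (not_le.mpr hlt), Function.comp]
  have := h1.union_of_isClosed h2 isClosed_Icc isClosed_Icc
  rwa [Icc_union_Icc_eq_Icc (by norm_num) (by norm_num)] at this

theorem concatParam_injOn {T : Type*} {α β : ℝ → T} {U : Set ℝ} (hU : U ⊆ Icc 0 1)
    (hα : InjOn α (Icc 0 1)) (hβ : InjOn β (Icc 0 1))
    (h : ∀ s ∈ U, ∀ t ∈ U, s ≤ 1 / 2 → 1 / 2 < t → α (2 * s) ≠ β (2 * t - 1)) :
    InjOn (concatParam α β) U := by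
  intro s hs t ht hst
  have hs' := hU hs
  have ht' := hU ht
  unfold concatParam at hst
  split_ifs at hst with h1 h2 h2
  · have := hα (x₁ := 2 * s) (x₂ := 2 * t) ⟨by linarith [hs'.1], by linarith⟩
      ⟨by linarith [ht'.1], by linarith⟩ hst
    linarith
  · exact absurd hst (h s hs t ht h1 (not_le.mp h2))
  · exact absurd hst.symm (h t ht s hs h2 (not_le.mp h1))
  · have := hβ (x₁ := 2 * s - 1) (x₂ := 2 * t - 1) ⟨by linarith, by linarith [hs'.2]⟩
      ⟨by linarith, by linarith [ht'.2]⟩ hst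
    linarith

theorem concatParam_mem {T : Type*} {α β : ℝ → T} {S : Set T} (hα : MapsTo α (Icc 0 1) S)
    (hβ : MapsTo β (Icc 0 1) S) : MapsTo (concatParam α β) (Icc 0 1) S := by
  intro t ht
  unfold concatParam
  split_ifs with h
  · exact hα ⟨by linarith [ht.1], by linarith⟩
  · exact hβ ⟨by linarith, by linarith [ht.2]⟩

/-- A loop that is injective apart from its endpoints traces a simple closed curve. -/
theorem exists_homeomorph_sphere_of_loop {T : Type*} [TopologicalSpace T] [T2Space T] {γ : ℝ → T}
    (hγ : ContinuousOn γ (Icc 0 1)) (hinj : InjOn γ (Ico 0 1)) (h01 : γ 0 = γ 1) :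
    ∃ S : Set T, Nonempty (S ≃ₜ (Metric.sphere (0 : ℂ) 1)) := by
  have hcont := AddCircle.liftIco_zero_continuous (p := 1) h01 hγ
  have hinj' : Function.Injective (AddCircle.liftIco (1 : ℝ) 0 γ) := by
    have hex : ∀ z : AddCircle (1 : ℝ), ∃ t ∈ Ico (0 : ℝ) 1, (t : AddCircle (1 : ℝ)) = z := by
      intro z
      have := (AddCircle.coe_image_Ico_eq (1 : ℝ) 0).symm ▸ mem_univ z
      simpa using this
    intro z w hzw
    obtain ⟨s, hs, rfl⟩ := hex z
    obtain ⟨t, ht, rfl⟩ := hex w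
    rw [AddCircle.liftIco_zero_coe_apply hs, AddCircle.liftIco_zero_coe_apply ht] at hzw
    rw [hinj hs ht hzw]
  have e : Circle ≃ₜ Metric.sphere (0 : ℂ) 1 := Homeomorph.refl _
  exact ⟨_, ⟨(hcont.isClosedEmbedding hinj').isEmbedding.toHomeomorph.symm.trans
    ((AddCircle.homeomorphCircle one_ne_zero).trans e)⟩⟩

/-- Two points are joined by an arc inside `S`. -/
def ArcJoined {T : Type*} [TopologicalSpace T] (S : Set T) (x y : T) : Prop :=
  ∃ γ : ℝ → T, IsArcParam γ ∧ γ 0 = x ∧ γ 1 = y ∧ MapsTo γ (Icc 0 1) S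

theorem IsArcParam.arcJoined {T : Type*} [TopologicalSpace T] {γ : ℝ → T} (hγ : IsArcParam γ)
    {S : Set T} {a b : ℝ} (ha : a ∈ Icc (0 : ℝ) 1) (hb : b ∈ Icc (0 : ℝ) 1) (hab : a ≠ b)
    (hS : MapsTo γ (uIcc a b) S) : ArcJoined S (γ a) (γ b) :=
  ⟨_, hγ.comp_lineMap ha hb hab, by simp, by simp, fun _ ht => hS (lineMap_mem_uIcc a b ht)⟩

theorem ArcJoined.symm {T : Type*} [TopologicalSpace T] {S : Set T} {x y : T}
    (h : ArcJoined S x y) : ArcJoined S y x := by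
  obtain ⟨γ, hγ, rfl, rfl, hS⟩ := h
  refine hγ.arcJoined (right_mem_Icc.mpr zero_le_one) (left_mem_Icc.mpr zero_le_one)
    one_ne_zero ?_
  rwa [uIcc_of_ge zero_le_one]

theorem ArcJoined.mono {T : Type*} [TopologicalSpace T] {S S' : Set T} {x y : T}
    (h : ArcJoined S x y) (hSS' : S ⊆ S') : ArcJoined S' x y := by
  obtain ⟨γ, hγ, h0, h1, hS⟩ := h
  exact ⟨γ, hγ, h0, h1, hS.mono_right hSS'⟩

/-- Sets obtained from a point by repeatedly attaching arcs at one endpoint. -/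
inductive IsArcBuilt {T : Type*} [TopologicalSpace T] : Set T → Prop
  | singleton (p : T) : IsArcBuilt {p}
  | attach {S : Set T} {γ : ℝ → T} : IsArcBuilt S → IsArcParam γ → γ 0 ∈ S →
      (∀ t ∈ Ioc (0 : ℝ) 1, γ t ∉ S) → IsArcBuilt (S ∪ γ '' Icc 0 1)

theorem IsArcBuilt.isClosed {T : Type*} [TopologicalSpace T] [T2Space T] {S : Set T}
    (hS : IsArcBuilt S) : IsClosed S := by
  induction hS with
  | singleton p => exact isClosed_singleton
  | attach _ hγ _ _ ih => exact ih.union (isCompact_Icc.image_of_continuousOn hγ.1).isClosed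

theorem IsArcBuilt.arcJoined {T : Type*} [TopologicalSpace T] {S : Set T} (hS : IsArcBuilt S) :
    ∀ x ∈ S, ∀ y ∈ S, x ≠ y → ArcJoined S x y := by
  induction hS with
  | singleton p =>
    intro x hx y hy hxy
    exact absurd ((mem_singleton_iff.mp hx).trans (mem_singleton_iff.mp hy).symm) hxy
  | @attach S γ _ hγ h0 hout ih =>
    have hz : (0 : ℝ) ∈ Icc (0 : ℝ) 1 := left_mem_Icc.mpr zero_le_one
    have hsub : ∀ {a b : ℝ}, a ∈ Icc (0 : ℝ) 1 → b ∈ Icc (0 : ℝ) 1 → a ≠ b →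
        ArcJoined (S ∪ γ '' Icc 0 1) (γ a) (γ b) := fun ha hb hab =>
      hγ.arcJoined ha hb hab fun t ht => Or.inr ⟨t, uIcc_subset_Icc ha hb ht, rfl⟩
    have hmixed : ∀ x ∈ S, ∀ b ∈ Icc (0 : ℝ) 1, x ≠ γ b →
        ArcJoined (S ∪ γ '' Icc 0 1) x (γ b) := by
      intro x hx b hb hxb
      by_cases hx0 : x = γ 0
      · rw [hx0] at hxb ⊢
        exact hsub hz hb fun h => hxb (by rw [h])
      by_cases hb0 : b = 0
      · rw [hb0] at hxb ⊢
        exact (ih x hx _ h0 hx0).mono subset_union_left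
      obtain ⟨α, hα, hα0, hα1, hαS⟩ := ih x hx _ h0 hx0
      have hβ := hγ.comp_lineMap hz hb (Ne.symm hb0)
      refine ⟨concatParam α (γ ∘ AffineMap.lineMap 0 b),
        ⟨concatParam_continuousOn hα.1 hβ.1 (by simp [hα1]),
          concatParam_injOn Subset.rfl hα.2 hβ.2 ?_⟩, by simp [concatParam, hα0], ?_,
        concatParam_mem (hαS.mono_right subset_union_left) fun t ht =>
          Or.inr ⟨_, uIcc_subset_Icc hz hb (lineMap_mem_uIcc 0 b ht), rfl⟩⟩
      · intro s hs t ht hs2 ht2 heq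
        refine hout ((2 * t - 1) * b) ⟨?_, ?_⟩ ?_
        · exact mul_pos (by linarith) (lt_of_le_of_ne hb.1 (Ne.symm hb0))
        · exact mul_le_one₀ (by linarith [ht.2]) hb.1 hb.2
        · have : α (2 * s) ∈ S := hαS ⟨by linarith [hs.1], by linarith⟩
          rw [heq] at this
          simpa [AffineMap.lineMap_apply] using this
      · norm_num [concatParam]
    rintro x (hx | ⟨a, ha, rfl⟩) y (hy | ⟨b, hb, rfl⟩) hxy
    · exact (ih x hx y hy hxy).mono subset_union_left
    · exact hmixed x hx b hb hxy
    · exact (hmixed y hy a ha hxy.symm).symm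
    · exact hsub ha hb fun h => hxy (by rw [h])

theorem IsArcBuilt.union_subarc {T : Type*} [TopologicalSpace T] {S : Set T} (hS : IsArcBuilt S)
    {γ : ℝ → T} (hγ : IsArcParam γ) {a b : ℝ} (ha : a ∈ Icc (0 : ℝ) 1) (hb : b ∈ Icc (0 : ℝ) 1)
    (haS : γ a ∈ S) (hout : ∀ t ∈ uIcc a b, t ≠ a → γ t ∉ S) :
    IsArcBuilt (S ∪ γ '' uIcc a b) := by
  by_cases hab : a = b
  · subst hab
    rwa [uIcc_self, image_singleton, union_eq_left.mpr (singleton_subset_iff.mpr haS)]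
  · have himg : (γ ∘ AffineMap.lineMap a b) '' Icc (0 : ℝ) 1 = γ '' uIcc a b := by
      rw [image_comp, ← segment_eq_image_lineMap, segment_eq_uIcc]
    rw [← himg]
    refine hS.attach (hγ.comp_lineMap ha hb hab) (by simpa using haS) fun t ht => ?_
    refine hout _ (lineMap_mem_uIcc a b ⟨ht.1.le, ht.2⟩) fun h => ht.1.ne' ?_
    exact AffineMap.lineMap_injective ℝ hab (by simpa using h)

/-- In a space without simple closed curves, an arc meeting an arc-built set in finitely many
points meets it in at most one point. -/
theorem IsArcBuilt.eq_of_finite_inter {T : Type*} [TopologicalSpace T] [T2Space T]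
    (hT : ¬ ∃ S : Set T, Nonempty (S ≃ₜ (Metric.sphere (0 : ℂ) 1))) {S : Set T}
    (hS : IsArcBuilt S) {γ : ℝ → T} (hγ : IsArcParam γ) (hfin : (S ∩ γ '' Icc 0 1).Finite)
    {a b : ℝ} (ha : a ∈ Icc (0 : ℝ) 1) (hb : b ∈ Icc (0 : ℝ) 1) (haS : γ a ∈ S) (hbS : γ b ∈ S) :
    a = b := by
  by_contra hne
  wlog hab : a < b generalizing a b
  · exact this hb ha hbS haS (Ne.symm hne) (lt_of_le_of_ne (not_lt.mp hab) (Ne.symm hne))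
  have hFfin : {t | t ∈ Ioc a b ∧ γ t ∈ S}.Finite := by
    have hsub : {t | t ∈ Ioc a b ∧ γ t ∈ S} ⊆ Icc 0 1 := fun t ht =>
      ⟨ha.1.trans ht.1.1.le, ht.1.2.trans hb.2⟩
    refine Finite.of_finite_image (f := γ) (hfin.subset ?_) (hγ.2.mono hsub)
    rintro _ ⟨t, ht, rfl⟩
    exact ⟨ht.2, t, hsub ht, rfl⟩
  obtain ⟨c, ⟨hc, hcS⟩, hmin⟩ := Set.exists_min_image _ id hFfin ⟨b, ⟨hab, le_rfl⟩, hbS⟩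
  have hc' : c ∈ Icc (0 : ℝ) 1 := ⟨ha.1.trans hc.1.le, hc.2.trans hb.2⟩
  have hβ := hγ.comp_lineMap ha hc' hc.1.ne
  have hout : ∀ t ∈ Ioo (0 : ℝ) 1, (γ ∘ AffineMap.lineMap a c) t ∉ S := by
    intro t ht htS
    have hmem : AffineMap.lineMap a c t ∈ Ioo a c := by
      rw [← openSegment_eq_Ioo hc.1, openSegment_eq_image_lineMap]
      exact mem_image_of_mem _ ht
    exact absurd (hmin _ ⟨⟨hmem.1, hmem.2.le.trans hc.2⟩, htS⟩) (not_le.mpr hmem.2)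
  obtain ⟨α, hα, hα0, hα1, hαS⟩ := hS.arcJoined _ hcS _ haS fun h =>
    hc.1.ne' (hγ.2 hc' ha h)
  refine hT (exists_homeomorph_sphere_of_loop (γ := concatParam α (γ ∘ AffineMap.lineMap a c))
    (concatParam_continuousOn hα.1 hβ.1 (by simp [hα1]))
    (concatParam_injOn Ico_subset_Icc_self hα.2 hβ.2 ?_) ?_)
  · intro s hs t ht hs2 ht2 heq
    refine hout (2 * t - 1) ⟨by linarith, by linarith [ht.2]⟩ ?_
    rw [← heq]
    exact hαS ⟨by linarith [hs.1], by linarith⟩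
  · norm_num [concatParam, hα0]

/-- Every tree can be built from a point by attaching arcs. -/
theorem IsTree.isArcBuilt {T : Type*} [MetricSpace T] (hT : IsTree T) :
    IsArcBuilt (univ : Set T) := by
  classical
  obtain ⟨_, _, ⟨p⟩, ⟨n, γ, hγ, hcover, hinter⟩, hno⟩ := hT
  have hγ' : ∀ i, IsArcParam (γ i) := hγ
  have hz : (0 : ℝ) ∈ Icc (0 : ℝ) 1 := left_mem_Icc.mpr zero_le_one
  have ho : (1 : ℝ) ∈ Icc (0 : ℝ) 1 := right_mem_Icc.mpr zero_le_one
  obtain ⟨i₀, -⟩ := mem_iUnion.mp (hcover ▸ mem_univ p)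
  suffices H : ∃ s : Finset (Fin n), IsArcBuilt (⋃ i ∈ s, γ i '' Icc (0 : ℝ) 1) ∧
      ⋃ i ∈ s, γ i '' Icc (0 : ℝ) 1 = univ by
    obtain ⟨s, hs, hsu⟩ := H
    rwa [hsu] at hs
  refine exists_finset_biUnion_eq_univ
    (fun i => (isCompact_Icc.image_of_continuousOn (hγ i).1).isClosed)
    (fun i => ⟨γ i 0, 0, hz, rfl⟩) hcover
    (Q := fun s => IsArcBuilt (⋃ i ∈ s, γ i '' Icc (0 : ℝ) 1)) i₀ ?_ ?_
  · have := (IsArcBuilt.singleton (γ i₀ 0)).union_subarc (hγ' i₀) hz ho rfl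
      fun t ht hne h => hne ((hγ i₀).2 (by rwa [uIcc_of_le zero_le_one] at ht) hz h)
    rw [uIcc_of_le zero_le_one, union_eq_right.mpr
      (singleton_subset_iff.mpr (mem_image_of_mem _ hz))] at this
    simpa using this
  · rintro s hs j hj ⟨_, hxs, a, ha, rfl⟩
    have hfin : ((⋃ i ∈ s, γ i '' Icc (0 : ℝ) 1) ∩ γ j '' Icc 0 1).Finite := by
      rw [iUnion₂_inter]
      refine Set.Finite.biUnion s.finite_toSet fun i hi => ?_
      exact (Set.toFinite _).subset (hinter i j fun h => hj (h ▸ hi))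
    have honly : ∀ t ∈ Icc (0 : ℝ) 1, γ j t ∈ ⋃ i ∈ s, γ i '' Icc (0 : ℝ) 1 → t = a :=
      fun t ht h => hs.eq_of_finite_inter hno (hγ' j) hfin ht ha h hxs
    have h1 := hs.union_subarc (hγ' j) ha ho hxs fun t ht hne h =>
      hne (honly t (uIcc_subset_Icc ha ho ht) h)
    have h2 := h1.union_subarc (hγ' j) ha hz (Or.inl hxs) (fun t ht hne h => by
      have ht' := uIcc_subset_Icc ha hz ht
      rcases h with h | ⟨u, hu, hut⟩
      · exact hne (honly t ht' h)
      · have := (hγ j).2 (uIcc_subset_Icc ha ho hu) ht' hut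
        rw [uIcc_of_le ha.2] at hu
        rw [uIcc_of_ge ha.1] at ht
        exact hne (le_antisymm ht.2 (this ▸ hu.1)))
    rw [union_assoc, ← image_union, uIcc_of_le ha.2, uIcc_of_ge ha.1, union_comm (Icc a 1),
      Icc_union_Icc_eq_Icc ha.1 ha.2] at h2
    rwa [Finset.set_biUnion_insert, union_comm]

/-- The inverse of a continuous injection on a compact set is continuous on the image. -/
theorem exists_continuousOn_leftInvOn {E T : Type*} [TopologicalSpace E] [Nonempty E]
    [TopologicalSpace T] [T2Space T] {γ : E → T} {K : Set E} (hK : IsCompact K)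
    (hγ : ContinuousOn γ K) (hinj : InjOn γ K) :
    ∃ τ : T → E, ContinuousOn τ (γ '' K) ∧ LeftInvOn τ γ K := by
  refine ⟨Function.invFunOn γ K, ?_, hinj.leftInvOn_invFunOn⟩
  rw [continuousOn_iff_isClosed]
  intro t ht
  refine ⟨γ '' (K ∩ t), ((hK.inter_right ht).image_of_continuousOn
    (hγ.mono inter_subset_left)).isClosed, ?_⟩
  ext x
  constructor
  · rintro ⟨hx, s, hs, rfl⟩
    rw [mem_preimage, hinj.leftInvOn_invFunOn hs] at hx
    exact ⟨⟨s, ⟨hs, hx⟩, rfl⟩, s, hs, rfl⟩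
  · rintro ⟨⟨s, ⟨hs, hst⟩, rfl⟩, -⟩
    refine ⟨?_, s, hs, rfl⟩
    rwa [mem_preimage, hinj.leftInvOn_invFunOn hs]

/-- An arc-built set embeds in the plane inside a finite union of nonvertical lines. -/
theorem IsArcBuilt.exists_planar {T : Type*} [TopologicalSpace T] [T2Space T] {S : Set T}
    (hS : IsArcBuilt S) :
    ∃ e : T → ℂ, ContinuousOn e S ∧ InjOn e S ∧
      ∃ L : Finset (ℝ × ℝ), ∀ x ∈ S, ∃ l ∈ L, (e x).im = l.1 * (e x).re + l.2 := by
  classical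
  induction hS with
  | singleton p =>
    exact ⟨fun _ => 0, continuousOn_const, injOn_singleton _ _, {(0, 0)}, fun _ _ =>
      ⟨(0, 0), by simp, by simp⟩⟩
  | @attach S γ hS hγ h0 hout ih =>
    obtain ⟨e, he, hinj, L, hL⟩ := ih
    obtain ⟨τ, hτ, hτγ⟩ := exists_continuousOn_leftInvOn isCompact_Icc hγ.1 hγ.2
    obtain ⟨M, hM⟩ : ∃ M : ℝ, ∀ l ∈ L, l.1 < M := by
      obtain ⟨M, hM⟩ := (L.image Prod.fst).bddAbove
      exact ⟨M + 1, fun l hl => (hM (Finset.mem_image_of_mem _ hl)).trans_lt (lt_add_one M)⟩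
    set q := e (γ 0) with hq
    have hev : ∀ᶠ u in 𝓝[>] (0 : ℝ), ∀ l ∈ L, q.im + u * M ≠ l.1 * (q.re + u) + l.2 := by
      rw [Filter.eventually_all_finset]
      intro l hl
      have hne : ∀ᶠ u in 𝓝[>] (0 : ℝ), u ≠ (l.1 * q.re + l.2 - q.im) / (M - l.1) := by
        rcases le_or_gt ((l.1 * q.re + l.2 - q.im) / (M - l.1)) 0 with h | h
        · filter_upwards [self_mem_nhdsWithin] with u hu
          exact (h.trans_lt hu).ne'
        · filter_upwards [Ioo_mem_nhdsGT h] with u hu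
          exact hu.2.ne
      filter_upwards [hne] with u hu heq
      refine hu ?_
      rw [eq_div_iff (sub_pos.mpr (hM l hl)).ne']
      linarith
    obtain ⟨δ, hδ, hδsub⟩ := mem_nhdsGT_iff_exists_Ioc_subset.mp hev
    let w : ℝ → ℂ := fun u => q + (u : ℂ) * (1 + M * Complex.I)
    have hwre : ∀ u, (w u).re = q.re + u := fun u => by simp [w]
    have hwim : ∀ u, (w u).im = q.im + u * M := fun u => by simp [w]
    have hw : Continuous w := by fun_prop
    have hδ0 : (0 : ℝ) < δ := hδ
    let e' : T → ℂ := fun x => if x ∈ S then e x else w (δ * τ x)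
    have hz : (0 : ℝ) ∈ Icc (0 : ℝ) 1 := left_mem_Icc.mpr zero_le_one
    have e'S : ∀ x ∈ S, e' x = e x := fun x hx => if_pos hx
    have e'γ : ∀ t ∈ Icc (0 : ℝ) 1, e' (γ t) = w (δ * t) := by
      intro t ht
      rcases ht.1.eq_or_lt with rfl | hpos
      · simp [e', h0, w, hq]
      · simp only [e', if_neg (hout t ⟨hpos, ht.2⟩), hτγ ht]
    have hsep : ∀ x ∈ S, ∀ t ∈ Ioc (0 : ℝ) 1, e' x ≠ e' (γ t) := by
      intro x hx t ht heq
      rw [e'S x hx, e'γ t ⟨ht.1.le, ht.2⟩] at heq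
      obtain ⟨l, hl, hlx⟩ := hL x hx
      rw [heq, hwre, hwim] at hlx
      exact hδsub ⟨mul_pos hδ0 ht.1, mul_le_of_le_one_right hδ0.le ht.2⟩ l hl hlx
    refine ⟨e', ?_, ?_, insert (M, q.im - M * q.re) L, ?_⟩
    · refine ContinuousOn.union_of_isClosed (he.congr e'S) ?_ hS.isClosed
        (isCompact_Icc.image_of_continuousOn hγ.1).isClosed
      refine (hw.comp_continuousOn (continuousOn_const.mul hτ) (f := fun x => δ * τ x)).congr ?_
      rintro _ ⟨t, ht, rfl⟩
      simp only [e'γ t ht, Function.comp, hτγ ht]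
    · have hcase : ∀ x ∈ S ∪ γ '' Icc 0 1, x ∈ S ∨ ∃ t ∈ Ioc (0 : ℝ) 1, γ t = x := by
        rintro x (hx | ⟨t, ht, rfl⟩)
        · exact Or.inl hx
        · rcases ht.1.eq_or_lt with rfl | hpos
          · exact Or.inl h0
          · exact Or.inr ⟨t, ⟨hpos, ht.2⟩, rfl⟩
      intro x hx y hy hxy
      rcases hcase x hx with hx | ⟨s, hs, rfl⟩ <;> rcases hcase y hy with hy | ⟨t, ht, rfl⟩
      · rw [e'S x hx, e'S y hy] at hxy
        exact hinj hx hy hxy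
      · exact absurd hxy (hsep x hx t ht)
      · exact absurd hxy.symm (hsep y hy s hs)
      · rw [e'γ s ⟨hs.1.le, hs.2⟩, e'γ t ⟨ht.1.le, ht.2⟩] at hxy
        have := congrArg Complex.re hxy
        rw [hwre, hwre] at this
        rw [mul_left_cancel₀ hδ0.ne' (add_left_cancel this)]
    · rintro x (hx | ⟨t, ht, rfl⟩)
      · obtain ⟨l, hl, hlx⟩ := hL x hx
        exact ⟨l, Finset.mem_insert_of_mem hl, by rwa [e'S x hx]⟩
      · refine ⟨_, Finset.mem_insert_self _ _, ?_⟩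
        rw [e'γ t ht, hwre, hwim]
        ring

/-- A property of closed sets that holds for small sets and passes to unions of two sets meeting in
at most one point holds for arc-built sets. -/
theorem IsArcBuilt.closed_induction {T : Type*} [TopologicalSpace T] [T2Space T]
    {R : Set T → Prop} (hsmall : ∀ t, ∃ N ∈ 𝓝 t, ∀ A ⊆ N, R A)
    (hunion : ∀ A B p, IsClosed A → IsClosed B → R A → R B → A ∩ B ⊆ {p} → R (A ∪ B)) {S : Set T}
    (hS : IsArcBuilt S) : R S := by
  have hsing : ∀ p, R {p} := fun p => by
    obtain ⟨N, hN, h⟩ := hsmall p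
    exact h _ (singleton_subset_iff.mpr (mem_of_mem_nhds hN))
  have harc : ∀ γ : ℝ → T, IsArcParam γ → R (γ '' Icc 0 1) := by
    intro γ hγ
    choose N hN hNR using hsmall
    have hcont : Continuous (fun s : unitInterval => γ s) :=
      continuousOn_iff_continuous_domRestrict.mp hγ.1
    obtain ⟨t, ht0, htm, ⟨m, hm⟩, htc⟩ := exists_monotone_Icc_subset_open_cover_unitInterval
      (c := fun i => (fun s : unitInterval => γ s) ⁻¹' interior (N i))
      (fun i => isOpen_interior.preimage hcont)
      (fun s _ => mem_iUnion.mpr ⟨γ s, mem_interior_iff_mem_nhds.mpr (hN _)⟩)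
    have hclosed : ∀ a b : ℝ, 0 ≤ a → b ≤ 1 → IsClosed (γ '' Icc a b) := fun a b ha hb =>
      (isCompact_Icc.image_of_continuousOn (hγ.1.mono (Icc_subset_Icc ha hb))).isClosed
    have key : ∀ n, R (γ '' Icc 0 (t n : ℝ)) := by
      intro n
      induction n with
      | zero => simpa [ht0] using hsing (γ 0)
      | succ n ih =>
        have hle : (t n : ℝ) ≤ t (n + 1) := htm n.le_succ
        rw [← Icc_union_Icc_eq_Icc (t n).2.1 hle, image_union]
        refine hunion _ _ (γ (t n)) (hclosed _ _ le_rfl (t n).2.2)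
          (hclosed _ _ (t n).2.1 (t (n + 1)).2.2) ih ?_ ?_
        · obtain ⟨i, hi⟩ := htc n
          refine hNR i _ ?_
          rintro _ ⟨s, hs, rfl⟩
          exact interior_subset (hi (a := ⟨s, (t n).2.1.trans hs.1, hs.2.trans (t (n + 1)).2.2⟩) hs)
        · rw [← hγ.2.image_inter (Icc_subset_Icc le_rfl (t n).2.2)
            (Icc_subset_Icc (t n).2.1 (t (n + 1)).2.2)]
          rintro _ ⟨s, ⟨hs1, hs2⟩, rfl⟩
          rw [le_antisymm hs1.2 hs2.1]
          exact rfl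
    simpa [hm m le_rfl] using key m
  induction hS with
  | singleton p => exact hsing p
  | @attach S γ hS hγ h0 hout ih =>
    refine hunion _ _ (γ 0) hS.isClosed (isCompact_Icc.image_of_continuousOn hγ.1).isClosed ih
      (harc γ hγ) ?_
    rintro _ ⟨hx, t, ht, rfl⟩
    rcases ht.1.eq_or_lt with rfl | hpos
    · rfl
    · exact absurd hx (hout t ⟨hpos, ht.2⟩)

/-- A nonvanishing function that varies little on the fibers of a map to an arc-built space has a
continuous logarithm. -/
theorem IsArcBuilt.exists_continuous_log {L T : Type*} [TopologicalSpace L] [CompactSpace L]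
    [TopologicalSpace T] [T2Space T] (hT : IsArcBuilt (univ : Set T)) {g : L → T}
    (hg : Continuous g) {φ : L → ℂ} (hφ : Continuous φ) (hφ0 : ∀ x, φ x ≠ 0)
    (hfib : ∀ x y, g x = g y → 0 < (φ x / φ y).re) :
    ∃ θ : L → ℂ, Continuous θ ∧ ∀ x, Complex.exp (θ x) = φ x := by
  classical
  suffices H : ∃ θ : L → ℂ, ContinuousOn θ (g ⁻¹' univ) ∧
      (∀ x ∈ g ⁻¹' univ, Complex.exp (θ x) = φ x) ∧
      ∀ x ∈ g ⁻¹' univ, ∀ y ∈ g ⁻¹' univ, g x = g y → |(θ x - θ y).im| < Real.pi by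
    obtain ⟨θ, h1, h2, -⟩ := H
    exact ⟨θ, continuousOn_univ.mp h1, fun x => h2 x (mem_univ _)⟩
  refine hT.closed_induction (R := fun A => ∃ θ : L → ℂ, ContinuousOn θ (g ⁻¹' A) ∧
      (∀ x ∈ g ⁻¹' A, Complex.exp (θ x) = φ x) ∧
      ∀ x ∈ g ⁻¹' A, ∀ y ∈ g ⁻¹' A, g x = g y → |(θ x - θ y).im| < Real.pi) ?_ ?_
  · intro t
    have hBad : IsClosed (Prod.map g g '' {p : L × L | (φ p.1 / φ p.2).re ≤ 0}) := by
      refine (IsClosed.isCompact ?_).image (hg.prodMap hg) |>.isClosed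
      refine isClosed_le (Complex.continuous_re.comp ?_) continuous_const
      exact (hφ.comp continuous_fst).div (hφ.comp continuous_snd) fun p => hφ0 _
    have hnot : (t, t) ∉ Prod.map g g '' {p : L × L | (φ p.1 / φ p.2).re ≤ 0} := by
      rintro ⟨⟨x, y⟩, hp, hxy⟩
      obtain ⟨h1, h2⟩ := Prod.mk.inj hxy
      exact absurd (hfib x y (h1.trans h2.symm)) (not_lt.mpr hp)
    obtain ⟨U, hU, V, hV, hUV⟩ := mem_nhds_prod_iff.mp (hBad.isOpen_compl.mem_nhds hnot)
    refine ⟨U ∩ V, Filter.inter_mem hU hV, fun A hA => ?_⟩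
    have hre : ∀ x ∈ g ⁻¹' A, ∀ y ∈ g ⁻¹' A, 0 < (φ x / φ y).re := by
      intro x hx y hy
      by_contra h
      exact hUV (mk_mem_prod (hA hx).1 (hA hy).2) ⟨(x, y), not_lt.mp h, rfl⟩
    rcases (g ⁻¹' A).eq_empty_or_nonempty with he | ⟨x₀, hx₀⟩
    · exact ⟨0, by simp [he]⟩
    have hne : ∀ x, φ x / φ x₀ ≠ 0 := fun x => div_ne_zero (hφ0 x) (hφ0 x₀)
    refine ⟨fun x => Complex.log (φ x / φ x₀) + Complex.log (φ x₀), ?_, ?_, ?_⟩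
    · refine ContinuousOn.add (ContinuousOn.clog (by fun_prop) ?_) continuousOn_const
      exact fun x hx => Or.inl (hre x hx x₀ hx₀)
    · intro x hx
      rw [Complex.exp_add, Complex.exp_log (hne x), Complex.exp_log (hφ0 x₀),
        div_mul_cancel₀ _ (hφ0 x₀)]
    · intro x hx y hy _
      have h1 := Complex.abs_arg_lt_pi_div_two_iff.mpr (Or.inl (hre x hx x₀ hx₀))
      have h2 := Complex.abs_arg_lt_pi_div_two_iff.mpr (Or.inl (hre y hy x₀ hx₀))
      rw [add_sub_add_right_eq_sub, Complex.sub_im, Complex.log_im, Complex.log_im]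
      rw [abs_lt] at h1 h2 ⊢
      constructor <;> linarith [h1.1, h1.2, h2.1, h2.2]
  · rintro A B p hA hB ⟨θ, hθc, hθe, hθ⟩ ⟨η, hηc, hηe, hη⟩ hAB
    have hk : ∃ k : ℤ, ∀ x ∈ g ⁻¹' (A ∩ B), θ x = η x + k * (2 * Real.pi * Complex.I) := by
      rcases (g ⁻¹' (A ∩ B)).eq_empty_or_nonempty with he | ⟨x₀, hx₀⟩
      · exact ⟨0, by simp [he]⟩
      have hint : ∀ x ∈ g ⁻¹' (A ∩ B), ∃ k : ℤ, θ x = η x + k * (2 * Real.pi * Complex.I) :=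
        fun x hx => Complex.exp_eq_exp_iff_exists_int.mp ((hθe x hx.1).trans (hηe x hx.2).symm)
      obtain ⟨k, hk⟩ := hint x₀ hx₀
      refine ⟨k, fun x hx => ?_⟩
      obtain ⟨j, hj⟩ := hint x hx
      have hgx : g x = g x₀ := (hAB hx).trans (hAB hx₀).symm
      have h1 := hθ x hx.1 x₀ hx₀.1 hgx
      have h2 := hη x hx.2 x₀ hx₀.2 hgx
      have h3 : (θ x - θ x₀).im = (η x - η x₀).im + ((j : ℝ) - k) * (2 * Real.pi) := by
        rw [hj, hk]
        simp
        ring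
      have hpi := Real.pi_pos
      rw [h3, abs_lt] at h1
      rw [abs_lt] at h2
      have h4 : ((j - k : ℤ) : ℝ) < 1 := by
        push_cast
        nlinarith [h1.2, h2.1]
      have h5 : (-1 : ℝ) < ((j - k : ℤ) : ℝ) := by
        push_cast
        nlinarith [h1.1, h2.2]
      have h6 : j - k < 1 := by exact_mod_cast h4
      have h7 : -1 < j - k := by exact_mod_cast h5
      rw [hj, show j = k by omega]
    obtain ⟨k, hk⟩ := hk
    let ζ : L → ℂ := fun x => if g x ∈ A then θ x else η x + k * (2 * Real.pi * Complex.I)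
    have ζA : ∀ x ∈ g ⁻¹' A, ζ x = θ x := fun x hx => if_pos hx
    have ζB : ∀ x ∈ g ⁻¹' B, ζ x = η x + k * (2 * Real.pi * Complex.I) := by
      intro x hx
      by_cases h : g x ∈ A
      · rw [ζA x h, hk x ⟨h, hx⟩]
      · exact if_neg h
    refine ⟨ζ, ?_, ?_, ?_⟩
    · rw [preimage_union]
      exact (hθc.congr ζA).union_of_isClosed ((hηc.add continuousOn_const).congr ζB)
        (hA.preimage hg) (hB.preimage hg)
    · rintro x (hx | hx)
      · rw [ζA x hx, hθe x hx]
      · rw [ζB x hx, Complex.exp_add, Complex.exp_int_mul_two_pi_mul_I, mul_one, hηe x hx]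
    · intro x hx y hy hxy
      by_cases h : g x ∈ A
      · have h' : g y ∈ A := hxy ▸ h
        rw [ζA x h, ζA y h']
        exact hθ x h y h' hxy
      · have h' : g y ∉ A := hxy ▸ h
        rw [ζB x (hx.resolve_left h), ζB y (hy.resolve_left h'), add_sub_add_right_eq_sub]
        exact hη x (hx.resolve_left h) y (hy.resolve_left h') hxy

/-- A nonvanishing odd function with a continuous logarithm does not exist on a connected space
with an involution. -/
theorem not_exists_odd_log {L : Type*} [TopologicalSpace L] [PreconnectedSpace L] [Nonempty L]
    {σ : L → L} (hσ : Continuous σ) (hinv : Function.Involutive σ) {φ θ : L → ℂ}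
    (hodd : ∀ x, φ (σ x) = -φ x) (hθ : Continuous θ) (hexp : ∀ x, Complex.exp (θ x) = φ x) :
    False := by
  have hu : ∀ x, Complex.exp (θ (σ x) - θ x) = -1 := by
    intro x
    rw [Complex.exp_sub, hexp, hexp, hodd, neg_div, div_self]
    rw [← hexp]
    exact Complex.exp_ne_zero _
  have hcont : Continuous fun x => (θ (σ x) - θ x).im := by fun_prop
  obtain ⟨x₀⟩ := ‹Nonempty L›
  have hneg : (θ (σ (σ x₀)) - θ (σ x₀)).im = -(θ (σ x₀) - θ x₀).im := by
    rw [hinv x₀, ← Complex.neg_im, neg_sub]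
  obtain ⟨x, hx⟩ : ∃ x, (θ (σ x) - θ x).im = 0 := by
    rcases le_total (θ (σ x₀) - θ x₀).im 0 with h | h
    · exact mem_range_of_exists_le_of_exists_ge hcont ⟨x₀, h⟩ ⟨σ x₀, by linarith⟩
    · exact mem_range_of_exists_le_of_exists_ge hcont ⟨σ x₀, by linarith⟩ ⟨x₀, h⟩
  have hre : (Complex.exp (θ (σ x) - θ x)).re = -1 := by rw [hu]; simp
  rw [Complex.exp_re, hx, Real.cos_zero, mul_one] at hre
  linarith [Real.exp_pos (θ (σ x) - θ x).re]

/-- A connected subset of a treelike continuum has no fixed-point-free involution. -/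
theorem Treelike.exists_fixedPoint {C L : Type*} [MetricSpace C] [CompactSpace C]
    (hC : Treelike C) [MetricSpace L] [CompactSpace L] [ConnectedSpace L] {i : L → C}
    (hi : Isometry i) {σ : L → L} (hσ : Continuous σ) (hinv : Function.Involutive σ) :
    ∃ x, σ x = x := by
  by_contra! hfix
  have hfibers : ∀ ε > 0, ∃ (T : Type) (_ : MetricSpace T), IsTree T ∧
      ∃ g : L → T, Continuous g ∧ ∀ x y, g x = g y → dist x y < ε := by
    intro ε hε
    obtain ⟨T, hTm, hT, g, hg, -, hdiam⟩ := hC ε hε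
    refine ⟨T, hTm, hT, g ∘ i, hg.comp hi.continuous, fun x y hxy => ?_⟩
    rw [← hi.dist_eq]
    exact (dist_le_diam_of_mem (Bornology.IsBounded.all _) (show i x ∈ g ⁻¹' {g (i y)} from hxy)
      (show i y ∈ g ⁻¹' {g (i y)} from rfl)).trans_lt (hdiam _)
  have hpos : ∀ {h : L → ℝ}, Continuous h → (∀ x, 0 < h x) → ∃ m > 0, ∀ x, m ≤ h x := by
    intro h hh h0
    obtain ⟨x, -, hx⟩ := isCompact_univ.exists_isMinOn univ_nonempty hh.continuousOn
    exact ⟨h x, h0 x, fun y => hx (mem_univ y)⟩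
  obtain ⟨δ, hδ, hδσ⟩ := hpos (h := fun x => dist x (σ x)) (by fun_prop)
    fun x => dist_pos.mpr (hfix x).symm
  obtain ⟨T, _, hT, g, hg, hgδ⟩ := hfibers δ hδ
  obtain ⟨e, he, heinj, -⟩ := hT.isArcBuilt.exists_planar
  rw [continuousOn_univ] at he
  rw [injOn_univ] at heinj
  let φ : L → ℂ := fun x => e (g x) - e (g (σ x))
  have hφ : Continuous φ := by fun_prop
  have hφ0 : ∀ x, φ x ≠ 0 := fun x h =>
    absurd (hgδ _ _ (heinj (sub_eq_zero.mp h))) (not_lt.mpr (hδσ x))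
  obtain ⟨m, hm, hmφ⟩ := hpos (h := fun x => ‖φ x‖) (by fun_prop) fun x => norm_pos_iff.mpr (hφ0 x)
  obtain ⟨ε, hε, hεφ⟩ := Metric.uniformContinuous_iff.mp
    (CompactSpace.uniformContinuous_of_continuous hφ) m hm
  obtain ⟨T', _, hT', g', hg', hg'ε⟩ := hfibers ε hε
  obtain ⟨θ, hθ, hexp⟩ := hT'.isArcBuilt.exists_continuous_log hg' hφ hφ0 (by
    intro x y hxy
    have h1 : ‖φ x / φ y - 1‖ < 1 := by
      rw [div_sub_one (hφ0 y), norm_div, div_lt_one (norm_pos_iff.mpr (hφ0 y)), ← dist_eq_norm]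
      exact (hεφ (hg'ε x y hxy)).trans_le (hmφ y)
    have h2 := (abs_le.mp (Complex.abs_re_le_norm (φ x / φ y - 1))).1
    rw [Complex.sub_re, Complex.one_re] at h2
    linarith)
  refine not_exists_odd_log hσ hinv (φ := φ) (fun x => ?_) hθ hexp
  simp only [φ, hinv x, neg_sub]

/-- A function with closed graph into a compact space is continuous. -/
theorem continuous_of_isClosed_setOf_eq {D E : Type*} [TopologicalSpace D] [TopologicalSpace E]
    [CompactSpace E] {σ : D → E} (h : IsClosed {p : D × E | σ p.1 = p.2}) : Continuous σ := by
  rw [continuous_iff_isClosed]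
  intro t ht
  have hmap := isClosedMap_fst_of_compactSpace (X := D) (Y := E) _
    (h.inter (ht.preimage continuous_snd))
  convert hmap using 1
  ext x
  constructor
  · exact fun hx => ⟨(x, σ x), ⟨rfl, hx⟩, rfl⟩
  · rintro ⟨⟨a, b⟩, ⟨hab, hb⟩, rfl⟩
    have hab' : σ a = b := hab
    exact mem_preimage.mpr (hab' ▸ hb)

/-- A locally injective map of a treelike continuum with at most two points in each fiber becomes
injective, with the same image, after deleting a suitable nonempty closed set. -/
theorem Treelike.exists_isClosed_injOn_compl {C Z : Type*} [MetricSpace C] [CompactSpace C]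
    (hC : Treelike C) [TopologicalSpace Z] [T2Space Z] {f : C → Z} (hf : Continuous f)
    (hloc : ∀ x, ∃ U ∈ 𝓝 x, InjOn f U)
    (hfib : ∀ x y z, f x = f y → x ≠ y → f x = f z → x ≠ z → y = z)
    (hnot : ¬ Function.Injective f) :
    ∃ F : Set C, IsClosed F ∧ F.Nonempty ∧ InjOn f Fᶜ ∧ range f ⊆ f '' Fᶜ := by
  have hE := isClosed_setOf_identified hf hloc
  set D : Set C := {x | ∃ y, f x = f y ∧ x ≠ y} with hD
  have hDc : IsClosed D := by
    convert (hE.isCompact.image continuous_fst).isClosed using 1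
    ext x
    constructor
    · rintro ⟨y, hy⟩
      exact ⟨(x, y), hy, rfl⟩
    · rintro ⟨⟨a, b⟩, hab, rfl⟩
      exact ⟨b, hab⟩
  have : CompactSpace D := isCompact_iff_compactSpace.mp hDc.isCompact
  have hpartner : ∀ x : D, ∃ y : D, f x = f y ∧ x.1 ≠ y := by
    rintro ⟨x, y, hxy, hne⟩
    exact ⟨⟨y, x, hxy.symm, hne.symm⟩, hxy, hne⟩
  choose σ hσf hσne using hpartner
  have huniq : ∀ x y : D, f x = f y → x.1 ≠ y → σ x = y := fun x y h h' =>
    Subtype.ext (hfib _ _ _ (hσf x) (hσne x) h h')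
  have hinv : Function.Involutive σ := fun x => huniq _ _ (hσf x).symm (hσne x).symm
  have hσ : Continuous σ := by
    refine continuous_of_isClosed_setOf_eq ?_
    convert hE.preimage (f := fun p : D × D => (p.1.1, p.2.1)) (by fun_prop) using 1
    ext ⟨x, y⟩
    constructor
    · intro h
      have h' : σ x = y := h
      subst h'
      exact ⟨hσf x, hσne x⟩
    · exact fun h => huniq x y h.1 h.2
  have hcomp : ∀ x, σ x ∉ connectedComponent x := by
    intro x hx
    have hmaps : MapsTo σ (connectedComponent x) (connectedComponent x) := by
      have h := hσ.image_connectedComponent_subset x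
      rw [← connectedComponent_eq hx] at h
      exact mapsTo_iff_image_subset.mpr h
    have : CompactSpace (connectedComponent x) :=
      isCompact_iff_compactSpace.mp isClosed_connectedComponent.isCompact
    have : ConnectedSpace (connectedComponent x) :=
      isConnected_iff_connectedSpace.mp isConnected_connectedComponent
    obtain ⟨z, hz⟩ := hC.exists_fixedPoint (L := connectedComponent x)
      (isometry_subtype_coe.comp isometry_subtype_coe) (hσ.restrict hmaps)
      (fun z => Subtype.ext (hinv z))
    exact hσne z (congrArg (fun w => w.1.1) hz).symm
  obtain ⟨F, hF, hFσ⟩ := exists_isClopen_of_involution hσ hinv hcomp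
  have hmem : ∀ x : D, x.1 ∈ ((↑) : D → C) '' F ↔ x ∈ F := fun x =>
    Subtype.val_injective.mem_set_image
  refine ⟨((↑) : D → C) '' F, (hF.1.isCompact.image continuous_subtype_val).isClosed, ?_, ?_, ?_⟩
  · simp only [Function.Injective, not_forall] at hnot
    obtain ⟨a, b, hab, hne⟩ := hnot
    by_cases h : (⟨a, b, hab, hne⟩ : D) ∈ F
    · exact ⟨_, _, h, rfl⟩
    · exact ⟨_, _, (hFσ _).2 h, rfl⟩
  · intro a ha b hb hab
    by_contra hne
    have h := huniq ⟨a, b, hab, hne⟩ ⟨b, a, hab.symm, Ne.symm hne⟩ hab hne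
    have ha' := mt (hmem ⟨a, b, hab, hne⟩).2 ha
    have hb' := mt (hmem ⟨b, a, hab.symm, Ne.symm hne⟩).2 hb
    exact hb' (h ▸ (hFσ _).2 ha')
  · rintro _ ⟨x, rfl⟩
    by_cases hx : x ∈ ((↑) : D → C) '' F
    · obtain ⟨y, hy, rfl⟩ := hx
      refine ⟨σ y, fun h => ?_, (hσf y).symm⟩
      exact (hFσ y).1 ((hmem _).1 h) hy
    · exact ⟨x, hx, rfl⟩

theorem exists_mem_nhds_injOn_comp_val {X Z : Type*} [TopologicalSpace X] {f : X → Z}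
    (hloc : ∀ x, ∃ U ∈ 𝓝 x, InjOn f U) (K : Set X) (x : K) :
    ∃ U ∈ 𝓝 x, InjOn (fun y : K => f y) U := by
  obtain ⟨U, hU, hinj⟩ := hloc x
  exact ⟨Subtype.val ⁻¹' U, continuous_subtype_val.continuousAt hU,
    fun a ha b hb hab => Subtype.ext (hinj ha hb hab)⟩

/-- If a map with at most two points in each fiber fails to be injective on a treelike
subcontinuum, then its image is a `2`-to-`1` retract. -/
theorem isMToOneRetract_two_of_treelike {X Z : Type} [MetricSpace X] [CompactSpace X]
    [ConnectedSpace X] [MetricSpace Z] {f : X → Z} (hf : Continuous f)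
    (hsurj : Function.Surjective f) (hloc : ∀ x, ∃ U ∈ 𝓝 x, InjOn f U)
    (hfib : ∀ x y z, f x = f y → x ≠ y → f x = f z → x ≠ z → y = z) {K : Set X}
    (hK : IsSubcontinuum K) (htree : Treelike K) (hnot : ¬ InjOn f K) : IsMToOneRetract 2 Z := by
  have : CompactSpace K := isCompact_iff_compactSpace.mp hK.1
  obtain ⟨F, hF, hFne, hinj, hcov⟩ := htree.exists_isClosed_injOn_compl
    (f := fun y : K => f y) (hf.comp continuous_subtype_val)
    (exists_mem_nhds_injOn_comp_val hloc K)
    (fun x y z h1 h2 h3 h4 => Subtype.ext (hfib _ _ _ h1 (Subtype.coe_ne_coe.mpr h2) h3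
      (Subtype.coe_ne_coe.mpr h4)))
    (fun h => hnot (injOn_iff_injective.mpr h))
  have hmem : ∀ {x} (hx : x ∈ K \ ((↑) : K → X) '' F), (⟨x, hx.1⟩ : K) ∈ Fᶜ :=
    fun hx h => hx.2 ⟨_, h, rfl⟩
  refine isMToOneRetract_two_of_injOn_diff hf hsurj hK
    (hF.isCompact.image continuous_subtype_val).isClosed (hFne.image _)
    (Subtype.coe_image_subset K F) ?_ ?_
  · exact fun a ha b hb hab => congrArg Subtype.val (hinj (hmem ha) (hmem hb) hab)
  · rintro _ ⟨x, hx, rfl⟩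
    obtain ⟨y, hy, hyx⟩ := hcov ⟨⟨x, hx⟩, rfl⟩
    exact ⟨y, ⟨y.2, fun h => hy (Subtype.val_injective.mem_set_image.mp h)⟩, hyx⟩

/-- If a locally injective map fails to be injective on a hereditarily decomposable subcontinuum,
then its image is a `2`-to-`1` retract. -/
theorem isMToOneRetract_two_of_hereditarilyDecomposable {X Z : Type} [MetricSpace X]
    [CompactSpace X] [ConnectedSpace X] [MetricSpace Z] {f : X → Z} (hf : Continuous f)
    (hsurj : Function.Surjective f) (hloc : ∀ x, ∃ U ∈ 𝓝 x, InjOn f U) {K : Set X}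
    (hK : IsSubcontinuum K) (hdec : HereditarilyDecomposable K) (hnot : ¬ InjOn f K) :
    IsMToOneRetract 2 Z := by
  have : CompactSpace K := isCompact_iff_compactSpace.mp hK.1
  have : ConnectedSpace K := isConnected_iff_connectedSpace.mp hK.2
  obtain ⟨A, B, hA, hB, hAB, hfA, hfB, hfAB⟩ := hdec.exists_union_not_injOn
    (f := fun y : K => f y) (hf.comp continuous_subtype_val)
    (exists_mem_nhds_injOn_comp_val hloc K) (fun h => hnot (injOn_iff_injective.mpr h))
  refine isMToOneRetract_two_of_union hf hsurj hloc
    (hA.isCompact.image continuous_subtype_val).isClosed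
    (hB.isCompact.image continuous_subtype_val).isClosed ?_ hfA.image_of_comp hfB.image_of_comp ?_
  · rw [← image_union]
    exact hAB.image _ continuous_subtype_val.continuousOn
  · rw [← image_union]
    exact fun h => hfAB (h.comp Subtype.val_injective.injOn (mapsTo_image _ _))

/-- If a locally injective map is injective on each of finitely many subcontinua covering its
domain but is not injective, then its image is a `2`-to-`1` retract. -/
theorem isMToOneRetract_two_of_forall_injOn {X Z : Type} [MetricSpace X] [CompactSpace X]
    [ConnectedSpace X] [MetricSpace Z] {f : X → Z} (hf : Continuous f)
    (hsurj : Function.Surjective f) (hloc : ∀ x, ∃ U ∈ 𝓝 x, InjOn f U) {ι : Type*} [Finite ι]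
    {C : ι → Set X} (hC : ∀ i, IsSubcontinuum (C i)) (hcover : ⋃ i, C i = univ)
    (hinj : ∀ i, InjOn f (C i)) (hnot : ¬ Function.Injective f) : IsMToOneRetract 2 Z := by
  classical
  by_contra hret
  obtain ⟨i₀, -⟩ := mem_iUnion.mp (hcover ▸ mem_univ (Classical.arbitrary X))
  have hclosed : ∀ i, IsClosed (C i) := fun i => (hC i).1.isClosed
  obtain ⟨s, ⟨-, hs⟩, hsu⟩ := exists_finset_biUnion_eq_univ hclosed (fun i => (hC i).2.nonempty)
    hcover (Q := fun s => IsConnected (⋃ i ∈ s, C i) ∧ InjOn f (⋃ i ∈ s, C i)) i₀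
    (by simpa using ⟨(hC i₀).2, hinj i₀⟩) (by
      rintro s ⟨hs, hfs⟩ j - hne
      rw [Finset.set_biUnion_insert, union_comm]
      have hconn := hs.union hne (hC j).2
      refine ⟨hconn, ?_⟩
      by_contra h
      exact hret (isMToOneRetract_two_of_union hf hsurj hloc
        (s.finite_toSet.isClosed_biUnion fun i _ => hclosed i) (hclosed j) hconn hfs (hinj j) h))
  rw [hsu, injOn_univ] at hs
  exact hnot hs

theorem SimpleMap.eq_of_ne_of_ne {X Y : Type*} {f : X → Y} (hf : SimpleMap f) {x y z : X}
    (hxy : f x = f y) (hxy' : x ≠ y) (hxz : f x = f z) (hxz' : x ≠ z) : y = z := by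
  by_contra hyz
  have hfin : (f ⁻¹' {f x}).Finite := finite_of_ncard_pos (by
    rcases hf _ ⟨x, rfl⟩ with h | h <;> omega)
  have hsub : ({x, y, z} : Set X) ⊆ f ⁻¹' {f x} := by
    rintro w (rfl | rfl | rfl)
    exacts [rfl, hxy.symm, hxz.symm]
  have hle := ncard_le_ncard hsub hfin
  rw [ncard_eq_three.mpr ⟨x, y, z, hxy', hxz', hyz, rfl⟩] at hle
  rcases hf _ ⟨x, rfl⟩ with h | h <;> omega

/-- If `f` is a simple strictly locally 1-to-1 map defined on a continuum `X` that is a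
finite union of subcontinua each of which is treelike or hereditarily decomposable,
then `f(X)` is a 2-to-1 retract. -/
theorem image_of_finite_union_treelike_or_hereditarilyDecomposable_is_retract
    (X Y : Type) [MetricSpace X] [CompactSpace X] [ConnectedSpace X] [Nonempty X]
    [MetricSpace Y]
    (n : ℕ) (C : Fin n → Set X) (hC : ∀ i, IsSubcontinuum (C i))
    (hcover : (⋃ i, C i) = Set.univ)
    (halt : ∀ i, Treelike ↥(C i) ∨ HereditarilyDecomposable ↥(C i))
    (f : X → Y) (hf : Continuous f) (hsimple : SimpleMap f)
    (hsl : StrictlyLocallyInjective f) :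
    IsMToOneRetract 2 ↥(Set.range f) := by
  obtain ⟨hloc, hnot⟩ := hsl
  have hg : Continuous (rangeFactorization f) := hf.rangeFactorization
  have hsurj : Function.Surjective (rangeFactorization f) := rangeFactorization_surjective
  have hgf : ∀ x y, rangeFactorization f x = rangeFactorization f y ↔ f x = f y :=
    fun _ _ => Subtype.ext_iff
  have hgloc : ∀ x, ∃ U ∈ 𝓝 x, InjOn (rangeFactorization f) U := by
    intro x
    obtain ⟨U, hU, hinj⟩ := hloc x
    exact ⟨U, hU, fun a ha b hb hab => hinj ha hb ((hgf a b).1 hab)⟩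
  by_cases hinj : ∀ i, InjOn (rangeFactorization f) (C i)
  · exact isMToOneRetract_two_of_forall_injOn hg hsurj hgloc hC hcover hinj
      fun h => hnot fun a b hab => h ((hgf a b).2 hab)
  push Not at hinj
  obtain ⟨i, hi⟩ := hinj
  rcases halt i with h | h
  · exact isMToOneRetract_two_of_treelike hg hsurj hgloc
      (fun x y z hxy hxy' hxz hxz' =>
        hsimple.eq_of_ne_of_ne ((hgf x y).1 hxy) hxy' ((hgf x z).1 hxz) hxz') (hC i) h hi
  · exact isMToOneRetract_two_of_hereditarilyDecomposable hg hsurj hgloc (hC i) h hi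
end
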